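/- Let n ≥ 2, k ≥ 1 and d ≥ 2 be integers. If there exists a homogeneous polynomial of degree k in ℂ[z_0, …, z_n] whose zero locus in ℙⁿ(ℂ) is a Brody hyperbolic hypersurface, then there exists a homogeneous polynomial of degree dk in ℂ[z_0, …, z_{n+1}] whose zero locus in ℙ^{n+1}(ℂ) is a Brody hyperbolic hypersurface. -/

import Mathlib

open MvPolynomial

/-- The hypersurface `{F = 0} ⊆ ℙ^{q-1}(ℂ)` is Brody hyperbolic. -/
def IsBrodyHyperbolicHypersurface {q : ℕ} (F : MvPolynomial (Fin q) ℂ) : Prop :=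
  ∀ f : Fin q → ℂ → ℂ,
    (∀ i, Differentiable ℂ (f i)) →
    (∀ z : ℂ, ∃ i, f i z ≠ 0) →
    (∀ z : ℂ, MvPolynomial.eval (fun i => f i z) F = 0) →
    ∃ (c : Fin q → ℂ) (u : ℂ → ℂ), Differentiable ℂ u ∧ ∀ i z, f i z = c i * u z

section

open Filter Topology Metric

lemma exists_log_sub {a : ℂ} {m : ℝ} (ha : m ≤ ‖a‖) :
    ∃ l : ℂ → ℂ, DifferentiableOn ℂ l (ball 0 m) ∧
      ∀ z ∈ ball (0 : ℂ) m, z - a = Complex.exp (l z) := by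
  rcases eq_or_ne a 0 with rfl | h0
  · have : m ≤ 0 := by simpa using ha
    rw [ball_eq_empty.2 this]
    exact ⟨0, by simp, by simp⟩
  have hs : ∀ z ∈ ball (0 : ℂ) m, 1 - z / a ∈ Complex.slitPlane := by
    intro z hz
    rw [sub_eq_add_neg]
    apply Complex.mem_slitPlane_of_norm_lt_one
    rw [norm_neg, norm_div, div_lt_one (norm_pos_iff.2 h0)]
    simp at hz
    linarith
  refine ⟨fun z => Complex.log (-a) + Complex.log (1 - z / a), ?_, ?_⟩
  · intro z hz
    apply DifferentiableAt.differentiableWithinAt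
    exact (differentiableAt_const _).add
      (((differentiableAt_const _).sub (differentiableAt_id.div_const _)).clog (hs z hz))
  · intro z hz
    rw [Complex.exp_add, Complex.exp_log (neg_ne_zero.2 h0),
      Complex.exp_log (Complex.slitPlane_ne_zero (hs z hz))]
    field_simp
    ring

lemma exists_log_prod (D : ℂ → ℕ) (s : Finset ℂ) {m : ℝ} (hs : ∀ a ∈ s, m ≤ ‖a‖) :
    ∃ l : ℂ → ℂ, DifferentiableOn ℂ l (ball 0 m) ∧
      ∀ z ∈ ball (0 : ℂ) m, ∏ a ∈ s, (z - a) ^ D a = Complex.exp (l z) := by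
  choose! l hl hl' using fun a (ha : a ∈ s) => exists_log_sub (hs a ha)
  refine ⟨fun z => ∑ a ∈ s, D a * l a z, ?_, ?_⟩
  · apply DifferentiableOn.fun_sum
    intro a ha
    exact (hl a ha).const_mul _
  · intro z hz
    rw [Complex.exp_sum]
    refine Finset.prod_congr rfl fun a ha => ?_
    rw [hl' a ha z hz, Complex.exp_nat_mul]

lemma exists_entire_approx {l : ℂ → ℂ} {r R : ℝ} (hr : r < R) (hl : DifferentiableOn ℂ l (ball 0 R))
    {ε : ℝ} (hε : 0 < ε) :
    ∃ q : ℂ → ℂ, Differentiable ℂ q ∧ ∀ z ∈ closedBall (0 : ℂ) r, ‖l z - q z‖ < ε := by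
  rcases lt_or_ge r 0 with h | h
  · exact ⟨0, differentiable_const 0, by simp [closedBall_eq_empty.2 h]⟩
  obtain ⟨r₁, h1, h1'⟩ := exists_between hr
  obtain ⟨r₂, h2, h2'⟩ := exists_between h1
  lift r₁ to NNReal using by linarith
  lift r₂ to NNReal using by linarith
  have h3 := (hl.mono (closedBall_subset_ball h1')).hasFPowerSeriesOnBall
    (by rw [← NNReal.coe_pos]; linarith)
  have h4 := h3.tendstoUniformlyOn (r' := r₂) (by exact_mod_cast h2')
  rw [Metric.tendstoUniformlyOn_iff] at h4
  obtain ⟨n, hn⟩ := (h4 ε hε).exists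
  refine ⟨fun z => (cauchyPowerSeries l 0 r₁).partialSum n z, ?_, ?_⟩
  · unfold FormalMultilinearSeries.partialSum
    simp only [FormalMultilinearSeries.apply_eq_pow_smul_coeff]
    fun_prop
  · intro z hz
    have := hn z (by
      simp at hz ⊢
      linarith)
    simpa [dist_eq_norm] using this

lemma analyticOrderAt_finset_prod {ι : Type*} (s : Finset ι) (f : ι → ℂ → ℂ) (z : ℂ)
    (hf : ∀ i ∈ s, AnalyticAt ℂ (f i) z) :
    analyticOrderAt (fun w => ∏ i ∈ s, f i w) z = ∑ i ∈ s, analyticOrderAt (f i) z := by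
  classical
  induction s using Finset.induction_on with
  | empty => simp [analyticOrderAt_eq_zero]
  | insert a s ha ih =>
    simp only [Finset.prod_insert ha, Finset.sum_insert ha]
    rw [← ih fun i hi => hf i (Finset.mem_insert_of_mem hi)]
    refine analyticOrderAt_mul (hf a (Finset.mem_insert_self _ _)) ?_
    exact Finset.analyticAt_fun_prod _ fun i hi => hf i (Finset.mem_insert_of_mem hi)

lemma exists_weierstrass_factor (D : ℂ → ℕ) (m : ℕ)
    (hD : {a : ℂ | D a ≠ 0 ∧ ⌊‖a‖⌋₊ = m}.Finite) :
    ∃ g : ℂ → ℂ, Differentiable ℂ g ∧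
      (∀ z, analyticOrderAt g z = if ⌊‖z‖⌋₊ = m then (D z : ℕ∞) else 0) ∧
      ∀ z, ‖z‖ ≤ m - 1 → ‖g z - 1‖ ≤ (1 / 2) ^ m := by
  have hs : ∀ a ∈ hD.toFinset, (m : ℝ) ≤ ‖a‖ := by
    intro a ha
    simp at ha
    rw [← ha.2]
    exact Nat.floor_le (norm_nonneg _)
  obtain ⟨l, hl, hl'⟩ := exists_log_prod D hD.toFinset hs
  obtain ⟨q, hq, hq'⟩ := exists_entire_approx (r := m - 1) (by linarith) hl
    (ε := (1 / 2) ^ m / 2) (by positivity)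
  have hP : Differentiable ℂ fun z => ∏ a ∈ hD.toFinset, (z - a) ^ D a := by fun_prop
  have hE : Differentiable ℂ fun z => Complex.exp (-q z) := by fun_prop
  refine ⟨(fun z => ∏ a ∈ hD.toFinset, (z - a) ^ D a) * fun z => Complex.exp (-q z),
    hP.mul hE, ?_, ?_⟩
  · intro z
    have hE0 : analyticOrderAt (fun z => Complex.exp (-q z)) z = 0 :=
      analyticOrderAt_eq_zero.2 (Or.inr (Complex.exp_ne_zero _))
    rw [analyticOrderAt_mul (hP.analyticAt z) (hE.analyticAt z),
      analyticOrderAt_finset_prod _ _ _ (fun i _ => by fun_prop), hE0, add_zero]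
    have h3 : ∀ a, analyticOrderAt (fun w : ℂ => (w - a) ^ D a) z =
        if a = z then (D a : ℕ∞) else 0 := by
      intro a
      have := analyticOrderAt_pow (f := fun w : ℂ => w - a) (z₀ := z) (by fun_prop) (D a)
      rw [show (fun w : ℂ => (w - a) ^ D a) = (fun w : ℂ => w - a) ^ D a from rfl, this]
      split_ifs with h
      · subst h; simp
      · rw [analyticOrderAt_id_sub_const_of_ne (Ne.symm h)]; simp
    simp only [h3]
    rw [Finset.sum_ite_eq']
    simp only [Set.Finite.mem_toFinset, Set.mem_ofPred_eq]
    by_cases hz : D z = 0 <;> simp [hz]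
  · intro z hz
    have hz1 : z ∈ ball (0 : ℂ) m := by simp; linarith
    have h4 := hq' z (by simpa using hz)
    have h5 : ((fun z => ∏ a ∈ hD.toFinset, (z - a) ^ D a) * fun z => Complex.exp (-q z)) z =
        Complex.exp (l z - q z) := by
      simp only [Pi.mul_apply]
      rw [hl' z hz1, ← Complex.exp_add, sub_eq_add_neg]
    rw [h5]
    have h6 : ((1 : ℝ) / 2) ^ m ≤ 1 := pow_le_one₀ (by norm_num) (by norm_num)
    refine (Complex.norm_exp_sub_one_le (by linarith)).trans (by linarith)

/-- **Weierstrass' theorem**: entire functions with prescribed zeros. -/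
theorem exists_entire_analyticOrderAt_eq (D : ℂ → ℕ)
    (hD : ∀ R : ℝ, {z : ℂ | D z ≠ 0 ∧ ‖z‖ ≤ R}.Finite) :
    ∃ w : ℂ → ℂ, Differentiable ℂ w ∧ ∀ z, analyticOrderAt w z = D z := by
  choose g hg hg1 hg2 using fun m : ℕ => exists_weierstrass_factor D m
    ((hD (m + 1)).subset (by
      rintro a ⟨h1, h2⟩
      refine ⟨h1, ?_⟩
      rw [← h2]
      exact (Nat.lt_floor_add_one _).le))
  set f : ℕ → ℂ → ℂ := fun m z => g m z - 1 with hf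
  have hfg : ∀ m z, 1 + f m z = g m z := by intro m z; simp [hf]
  have hfd : ∀ m, Differentiable ℂ (f m) := fun m => (hg m).sub_const 1
  have hu : Summable fun m : ℕ => ((1 : ℝ) / 2) ^ m := summable_geometric_two
  -- the shifted products are holomorphic
  have key : ∀ (N M : ℕ), DifferentiableOn ℂ (fun z => ∏' m, (1 + f (m + M) z)) (ball 0 N) := by
    intro N M
    have h1 : HasProdLocallyUniformlyOn (fun m z => 1 + f (m + M) z)
        (fun z => ∏' m, (1 + f (m + M) z)) (ball (0 : ℂ) N) := by
      refine Summable.hasProdLocallyUniformlyOn_nat_one_add isOpen_ball hu ?_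
        (fun n => (hfd _).continuous.continuousOn)
      filter_upwards [eventually_ge_atTop (N + 1)] with n hn z hz
      refine (hg2 (n + M) z ?_).trans (pow_le_pow_of_le_one (by norm_num) (by norm_num) (by omega))
      have : ((N : ℝ) + 1) ≤ n := by exact_mod_cast hn
      simp at hz
      push_cast
      have : (0 : ℝ) ≤ M := by positivity
      linarith
    have h2 := hasProdLocallyUniformlyOn_iff_tendstoLocallyUniformlyOn.1 h1
    refine h2.differentiableOn (Eventually.of_forall fun s => ?_) isOpen_ball
    refine DifferentiableOn.fun_finsetProd fun i _ => ?_
    exact ((differentiable_const 1).add (hfd _)).differentiableOn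
  have hsum : ∀ z, Summable fun m => ‖f m z‖ := by
    intro z
    obtain ⟨N, hN⟩ := exists_nat_ge (‖z‖ + 1)
    rw [← summable_nat_add_iff N]
    refine Summable.of_nonneg_of_le (fun _ => norm_nonneg _) (fun m => hg2 (m + N) z ?_)
      ((summable_nat_add_iff N).2 hu)
    push_cast
    have : (0 : ℝ) ≤ m := by positivity
    linarith
  refine ⟨fun z => ∏' m, (1 + f m z), ?_, ?_⟩
  · intro z
    obtain ⟨N, hN⟩ := exists_nat_gt ‖z‖
    have := key N 0
    exact this.differentiableAt (isOpen_ball.mem_nhds (by simpa using hN))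
  · intro z
    obtain ⟨N, hN⟩ := exists_nat_gt ‖z‖
    have hsplit : (fun z => ∏' m, (1 + f m z)) =
        (fun z => ∏ m ∈ Finset.range N, g m z) * fun z => ∏' m, (1 + f (m + N) z) := by
      funext z
      simp only [Pi.mul_apply]
      rw [← Multipliable.prod_mul_tprod_nat_mul' (k := N)]
      · simp [hfg]
      · exact multipliable_one_add_of_summable ((summable_nat_add_iff N).2 (hsum z))
    have hzN : ball (0 : ℂ) N ∈ 𝓝 z := isOpen_ball.mem_nhds (by simpa using hN)
    have h3 : AnalyticAt ℂ (fun z => ∏' m, (1 + f (m + N) z)) z := (key N N).analyticAt hzN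
    have hz' : ⌊‖z‖⌋₊ < N := (Nat.floor_lt (norm_nonneg _)).2 hN
    have h4 : ∏' m, (1 + f (m + N) z) ≠ 0 := by
      refine tprod_one_add_ne_zero_of_summable (fun m => ?_) ((summable_nat_add_iff N).2 (hsum z))
      rw [hfg]
      have := hg1 (m + N) z
      rw [if_neg (by omega)] at this
      rcases analyticOrderAt_eq_zero.1 this with h | h
      · exact absurd ((hg _).analyticAt z) h
      · exact h
    have h5 : analyticOrderAt (fun z => ∏' m, (1 + f (m + N) z)) z = 0 :=
      analyticOrderAt_eq_zero.2 (Or.inr h4)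
    rw [hsplit, analyticOrderAt_mul _ h3, h5, add_zero,
      analyticOrderAt_finset_prod _ _ _ (fun i _ => (hg i).analyticAt z)]
    · simp only [hg1]
      rw [Finset.sum_ite_eq]
      simp [hz']
    · exact Finset.analyticAt_fun_prod _ fun i _ => (hg i).analyticAt z

lemma finite_inter_closedBall_of_isolated {S : Set ℂ} (hS : ∀ z, ∀ᶠ y in 𝓝[≠] z, y ∉ S) (R : ℝ) :
    {z : ℂ | z ∈ S ∧ ‖z‖ ≤ R}.Finite := by
  by_contra h
  obtain ⟨x, -, hx⟩ := Set.Infinite.exists_accPt_of_subset_isCompact h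
    (isCompact_closedBall (0 : ℂ) R) (fun z hz => by simpa using hz.2)
  rw [accPt_iff_frequently_nhdsNE] at hx
  exact hx ((hS x).mono fun y hy hy0 => hy hy0.1)

/-- Holomorphic maps to projective space lift globally: local lifts that agree up to scalars
come from a global one. -/
theorem exists_global_lift {q : ℕ} (A : ℂ → ℂ → Fin q → ℂ) (r : ℂ → ℝ) (hr : ∀ z, 0 < r z)
    (hA : ∀ z₀, DifferentiableOn ℂ (A z₀) (ball z₀ (r z₀)))
    (h0 : ∀ z₀, ∀ z ∈ ball z₀ (r z₀), A z₀ z ≠ 0)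
    (hc : ∀ z₀, ∀ z ∈ ball z₀ (r z₀), ∃ c : ℂ, A z₀ z = c • A z z) :
    ∃ G : ℂ → Fin q → ℂ, Differentiable ℂ G ∧ (∀ z, G z ≠ 0) ∧
      ∀ z₀, ∀ z ∈ ball z₀ (r z₀), ∃ c : ℂ, c ≠ 0 ∧ G z = c • A z₀ z := by
  have hc0 : ∀ z₀, ∀ z ∈ ball z₀ (r z₀), ∃ c : ℂ, c ≠ 0 ∧ A z₀ z = c • A z z := by
    intro z₀ z hz
    obtain ⟨c, hc⟩ := hc z₀ z hz
    refine ⟨c, ?_, hc⟩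
    rintro rfl
    exact h0 z₀ z hz (by simpa using hc)
  have hnear : ∀ z, ∀ᶠ y in 𝓝 z, y ∈ ball z (r z) := fun z => ball_mem_nhds z (hr z)
  have hself : ∀ z, z ∈ ball z (r z) := fun z => mem_ball_self (hr z)
  obtain ⟨i₀, hi₀⟩ : ∃ i, A 0 0 i ≠ 0 := by
    by_contra! h
    exact h0 0 0 (hself 0) (funext h)
  have han : ∀ z₀ i, ∀ z ∈ ball z₀ (r z₀), AnalyticAt ℂ (fun z => A z₀ z i) z := by
    intro z₀ i z hz
    exact ((differentiableOn_pi.1 (hA z₀)) i).analyticAt (isOpen_ball.mem_nhds hz)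
  have han0 : ∀ z₀ i, AnalyticAt ℂ (fun z => A z₀ z i) z₀ := fun z₀ i => han z₀ i z₀ (hself z₀)
  -- the chosen coordinate does not vanish identically anywhere
  have hiff : ∀ z₀, ∀ z ∈ ball z₀ (r z₀), (A z₀ z i₀ = 0 ↔ A z z i₀ = 0) := by
    intro z₀ z hz
    obtain ⟨c, hc, h⟩ := hc0 z₀ z hz
    simp [h, hc]
  set S : Set ℂ := {z | A z z i₀ = 0} with hSdef
  have hdich : ∀ z, (∀ᶠ y in 𝓝 z, y ∈ S) ∨ ∀ᶠ y in 𝓝[≠] z, y ∉ S := by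
    intro z
    rcases (han0 z i₀).eventually_eq_zero_or_eventually_ne_zero with h | h
    · left
      filter_upwards [h, hnear z] with y hy hy'
      exact (hiff z y hy').1 hy
    · right
      filter_upwards [h, (hnear z).filter_mono nhdsWithin_le_nhds] with y hy hy' hyS
      exact hy ((hiff z y hy').2 hyS)
  have hiso : ∀ z, ∀ᶠ y in 𝓝[≠] z, y ∉ S := by
    by_contra! h
    obtain ⟨z₁, hz₁⟩ := h
    set T : Set ℂ := {z | ∀ᶠ y in 𝓝 z, y ∈ S} with hT
    have hTo : IsOpen T := by
      rw [isOpen_iff_mem_nhds]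
      intro z hz
      exact eventually_eventually_nhds.2 hz
    have hTc : IsClosed T := by
      rw [← isOpen_compl_iff, isOpen_iff_mem_nhds]
      intro z hz
      have h1 := (hdich z).resolve_left hz
      rw [eventually_nhdsWithin_iff] at h1
      filter_upwards [eventually_eventually_nhds.2 h1] with y hy hyT
      have : ∀ᶠ x in 𝓝 y, x = z := by
        filter_upwards [hy, hyT] with x hx hx'
        by_contra hne
        exact hx hne hx'
      have hzy : y = z := this.self_of_nhds
      subst hzy
      exact (show ¬ (∀ᶠ x in 𝓝 y, x ∈ S) from hz) hyT
    have hTu := IsClopen.eq_univ ⟨hTc, hTo⟩ ⟨z₁, (hdich z₁).resolve_right hz₁⟩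
    have : (0 : ℂ) ∈ T := hTu ▸ Set.mem_univ _
    exact hi₀ (show A 0 0 i₀ = 0 from (show ∀ᶠ y in 𝓝 (0 : ℂ), y ∈ S from this).self_of_nhds)
  have hord : ∀ z, analyticOrderAt (fun y => A z y i₀) z ≠ ⊤ := by
    intro z h
    rw [analyticOrderAt_eq_top] at h
    have h1 : ∀ᶠ y in 𝓝[≠] z, y ∈ S := by
      filter_upwards [h.filter_mono nhdsWithin_le_nhds,
        (hnear z).filter_mono nhdsWithin_le_nhds] with y hy hy'
      exact (hiff z y hy').1 hy
    obtain ⟨y, hy, hy'⟩ := (h1.and (hiso z)).exists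
    exact hy' hy
  obtain ⟨w, hw, hwo⟩ := exists_entire_analyticOrderAt_eq
    (fun z => analyticOrderNatAt (fun y => A z y i₀) z) (by
      intro R
      refine (finite_inter_closedBall_of_isolated hiso R).subset ?_
      rintro z ⟨h1, h2⟩
      refine ⟨?_, h2⟩
      by_contra h3
      apply h1
      have h4 : analyticOrderAt (fun y => A z y i₀) z = 0 := analyticOrderAt_eq_zero.2 (Or.inr h3)
      simp only [analyticOrderNatAt]
      rw [h4]
      rfl)
  have hquot : ∀ z, ∃ h : ℂ → ℂ, AnalyticAt ℂ h z ∧ h z ≠ 0 ∧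
      ∀ᶠ y in 𝓝 z, w y = h y * A z y i₀ := by
    intro z
    obtain ⟨a, ha, ha0, hae⟩ := (hw.analyticAt z).analyticOrderAt_eq_natCast.1 (hwo z)
    obtain ⟨b, hb, hb0, hbe⟩ := (han0 z i₀).analyticOrderAt_eq_natCast.1
      (Nat.cast_analyticOrderNatAt (hord z)).symm
    refine ⟨fun y => a y / b y, ha.div hb hb0, div_ne_zero ha0 hb0, ?_⟩
    filter_upwards [hae, hbe, hb.continuousAt.eventually_ne hb0] with y h1 h2 h3
    rw [h1, h2]
    simp only [smul_eq_mul]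
    field_simp
  choose h hh hh0 hhe using hquot
  have hG : ∀ z, (fun y => h y y • A y y) =ᶠ[𝓝 z] fun y => h z y • A z y := by
    intro z
    have h1 := hiso z
    rw [eventually_nhdsWithin_iff] at h1
    filter_upwards [h1, hhe z, hnear z] with y hy1 hy2 hy3
    rcases eq_or_ne y z with rfl | hne
    · rfl
    have hyS : A y y i₀ ≠ 0 := hy1 hne
    obtain ⟨c, hc, hce⟩ := hc0 z y hy3
    have h4 := (hhe y).self_of_nhds
    rw [h4, hce] at hy2
    simp only [Pi.smul_apply, smul_eq_mul] at hy2
    have : h y y = h z y * c := by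
      apply mul_right_cancel₀ hyS
      rw [hy2]; ring
    rw [hce, smul_smul, this]
  refine ⟨fun y => h y y • A y y, ?_, ?_, ?_⟩
  · intro z
    refine DifferentiableAt.congr_of_eventuallyEq ?_ (hG z)
    exact (hh z).differentiableAt.smul ((hA z).differentiableAt (ball_mem_nhds z (hr z)))
  · intro z
    exact smul_ne_zero (hh0 z) (h0 z z (hself z))
  · intro z₀ z hz
    obtain ⟨c, hc, hce⟩ := hc0 z₀ z hz
    refine ⟨h z z * c⁻¹, mul_ne_zero (hh0 z) (inv_ne_zero hc), ?_⟩
    rw [hce, smul_smul, mul_assoc, inv_mul_cancel₀ hc, mul_one]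

/-- Common zeros of a tuple of entire functions can be divided out. -/
theorem exists_nonvanishing_lift {q : ℕ} {g : ℂ → Fin q → ℂ} (hg : Differentiable ℂ g)
    (hg0 : ∃ z, g z ≠ 0) :
    ∃ G : ℂ → Fin q → ℂ, Differentiable ℂ G ∧ (∀ z, G z ≠ 0) ∧
      (∀ z, ∃ c : ℂ, g z = c • G z) ∧ ∀ z, ∀ᶠ y in 𝓝[≠] z, ∃ c : ℂ, G y = c • g y := by
  have hloc : ∀ z, ∃ (A : ℂ → Fin q → ℂ) (r : ℝ) (n : ℕ), 0 < r ∧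
      DifferentiableOn ℂ A (ball z r) ∧ (∀ y ∈ ball z r, A y ≠ 0) ∧
      ∀ y ∈ ball z r, g y = (y - z) ^ n • A y := by
    intro z
    have hne : analyticOrderAt g z ≠ ⊤ := by
      intro h
      rw [analyticOrderAt_eq_top] at h
      have := AnalyticOnNhd.eq_of_eventuallyEq (𝕜 := ℂ) (f := g) (g := 0)
        (fun y _ => hg.analyticAt y) (fun y _ => analyticAt_const) h
      obtain ⟨z', hz'⟩ := hg0
      exact hz' (by simp [this])
    obtain ⟨A, hA, hA0, hAe⟩ := (hg.analyticAt z).analyticOrderAt_eq_natCast.1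
      (Nat.cast_analyticOrderNatAt hne).symm
    obtain ⟨r, hr, hball⟩ := Metric.eventually_nhds_iff_ball.1
      (hA.eventually_analyticAt.and ((hA.continuousAt.eventually_ne hA0).and hAe))
    exact ⟨A, r, _, hr, fun y hy => (hball y hy).1.differentiableAt.differentiableWithinAt,
      fun y hy => (hball y hy).2.1, fun y hy => (hball y hy).2.2⟩
  choose A r n hr hA hA0 hAe using hloc
  have hgA : ∀ z₀, ∀ z ∈ ball z₀ (r z₀), z ≠ z₀ → g z = A z z ∧ g z ≠ 0 := by
    intro z₀ z hz hne
    have h1 := hAe z₀ z hz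
    have h2 : g z ≠ 0 := by
      rw [h1]
      exact smul_ne_zero (pow_ne_zero _ (sub_ne_zero.2 hne)) (hA0 z₀ z hz)
    refine ⟨?_, h2⟩
    have h3 := hAe z z (mem_ball_self (hr z))
    rw [sub_self] at h3
    rcases Nat.eq_zero_or_pos (n z) with h4 | h4
    · rw [h4] at h3; simpa using h3
    · rw [zero_pow h4.ne', zero_smul] at h3
      exact absurd h3 h2
  obtain ⟨G, hG, hG0, hGe⟩ := exists_global_lift A r hr hA hA0 (by
    intro z₀ z hz
    rcases eq_or_ne z z₀ with rfl | hne
    · exact ⟨1, by simp⟩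
    obtain ⟨h1, h2⟩ := hgA z₀ z hz hne
    refine ⟨((z - z₀) ^ n z₀)⁻¹, ?_⟩
    rw [← h1, hAe z₀ z hz, smul_smul, inv_mul_cancel₀ (pow_ne_zero _ (sub_ne_zero.2 hne)),
        one_smul])
  refine ⟨G, hG, hG0, ?_, ?_⟩
  · intro z
    have h3 := hAe z z (mem_ball_self (hr z))
    obtain ⟨c, hc, h4⟩ := hGe z z (mem_ball_self (hr z))
    refine ⟨(z - z) ^ n z * c⁻¹, ?_⟩
    rw [h3, h4, smul_smul, mul_assoc, inv_mul_cancel₀ hc, mul_one]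
  · intro z
    filter_upwards [mem_nhdsWithin_of_mem_nhds (ball_mem_nhds z (hr z)),
      self_mem_nhdsWithin] with y hy hne
    obtain ⟨c, hc, h4⟩ := hGe z y hy
    refine ⟨c * ((y - z) ^ n z)⁻¹, ?_⟩
    have hyz : (y - z) ^ n z ≠ 0 := pow_ne_zero _ (sub_ne_zero.2 hne)
    rw [hAe z y hy, h4, smul_smul, mul_assoc, inv_mul_cancel₀ hyz, mul_one]

lemma MvPolynomial.IsHomogeneous.eval_smul_eq {σ : Type*} [Fintype σ] {k : ℕ}
    {F : MvPolynomial σ ℂ} (hF : F.IsHomogeneous k) (c : ℂ) (v : σ → ℂ) :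
    eval (c • v) F = c ^ k * eval v F := by
  rw [eval_eq', eval_eq', Finset.mul_sum]
  refine Finset.sum_congr rfl fun d hd => ?_
  have h1 : ∑ i, d i = k := by
    have := hF (mem_support_iff.1 hd)
    rwa [show (Finsupp.weight 1 : (σ →₀ ℕ) →+ ℕ) d = d.degree from
      (congrFun (congrArg _ Finsupp.degree_eq_weight_one) d).symm, Finsupp.degree_eq_sum] at this
  simp only [Pi.smul_apply, smul_eq_mul, mul_pow, Finset.prod_mul_distrib,
      Finset.prod_pow_eq_pow_sum,
    h1]
  ring

lemma continuous_eval_comp {σ X : Type*} [Fintype σ] [TopologicalSpace X] (F : MvPolynomial σ ℂ)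
    {g : X → σ → ℂ} (hg : Continuous g) : Continuous fun z => eval (g z) F :=
  (MvPolynomial.continuous_eval F).comp hg

/-- A hyperbolic hypersurface contains no nonconstant entire curve, even if the coordinates of the
curve have common zeros. -/
theorem IsBrodyHyperbolicHypersurface.exists_eq_smul {q k : ℕ} {F : MvPolynomial (Fin q) ℂ}
    (hF : IsBrodyHyperbolicHypersurface F) (hk : F.IsHomogeneous k) {g : ℂ → Fin q → ℂ}
    (hg : Differentiable ℂ g) (hg0 : ∃ z, g z ≠ 0) (hFg : ∀ z, eval (g z) F = 0) :
    ∃ (c : Fin q → ℂ) (u : ℂ → ℂ), c ≠ 0 ∧ eval c F = 0 ∧ Differentiable ℂ u ∧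
      ∀ z, g z = u z • c := by
  obtain ⟨G, hG, hG0, hgG, hGg⟩ := exists_nonvanishing_lift hg hg0
  have hFG : ∀ z, eval (G z) F = 0 := by
    have hcont := continuous_eval_comp F hG.continuous
    intro z
    have h1 : Tendsto (fun y => eval (G y) F) (𝓝[≠] z) (𝓝 (eval (G z) F)) :=
      hcont.continuousAt.continuousWithinAt
    have h2 : Tendsto (fun y => eval (G y) F) (𝓝[≠] z) (𝓝 0) := by
      refine tendsto_const_nhds.congr' ?_
      filter_upwards [hGg z] with y ⟨c, hc⟩
      rw [hc, hk.eval_smul_eq, hFg, mul_zero]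
    exact tendsto_nhds_unique h1 h2
  obtain ⟨c, u, hu, hGc⟩ := hF (fun i z => G z i) (fun i => differentiable_pi.1 hG i)
    (fun z => Function.ne_iff.1 (hG0 z)) hFG
  have hGc' : ∀ z, G z = u z • c := fun z => funext fun i => by
    rw [hGc]; simp [mul_comm]
  have hu0 : ∀ z, u z ≠ 0 := fun z h => hG0 z (by rw [hGc' z, h, zero_smul])
  have hc0 : c ≠ 0 := by
    rintro rfl
    exact hG0 0 (by rw [hGc' 0, smul_zero])
  obtain ⟨j, hj⟩ := Function.ne_iff.1 hc0
  simp only [Pi.zero_apply] at hj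
  refine ⟨c, fun z => g z j / c j, hc0, ?_, ?_, ?_⟩
  · have := hFG 0
    rw [hGc' 0, hk.eval_smul_eq] at this
    exact (mul_eq_zero.1 this).resolve_left (pow_ne_zero _ (hu0 0))
  · exact (differentiable_pi.1 hg j).div_const _
  · intro z
    obtain ⟨t, ht⟩ := hgG z
    have h2 : g z j = t * (u z * c j) := by rw [ht, hGc' z]; rfl
    show g z = (g z j / c j) • c
    rw [h2, ht, hGc' z, smul_smul]
    congr 1
    field_simp

open ComplexConjugate in
/-- The orthogonal projection onto the line spanned by `v`, as a matrix. -/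
noncomputable def lineProj {q : ℕ} (v : Fin q → ℂ) : Fin q → Fin q → ℂ :=
  fun i j => v i * conj (v j) / ∑ l, v l * conj (v l)

/-- The speed, in the projective metric, of the curve `g` in homogeneous coordinates. -/
noncomputable def projSpeed {q : ℕ} (g : ℂ → Fin q → ℂ) (z : ℂ) : ℝ :=
  ‖fderiv ℝ (fun w => lineProj (g w)) z‖

section lineProj

open ComplexConjugate

variable {q : ℕ}

lemma sum_mul_conj (v : Fin q → ℂ) :
    ∑ l, v l * conj (v l) = ((∑ l, ‖v l‖ ^ 2 : ℝ) : ℂ) := by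
  push_cast
  exact Finset.sum_congr rfl fun i _ => Complex.mul_conj' _

lemma sum_mul_conj_ne_zero {v : Fin q → ℂ} (hv : v ≠ 0) : ∑ l, v l * conj (v l) ≠ 0 := by
  rw [sum_mul_conj]
  norm_cast
  obtain ⟨i, hi⟩ := Function.ne_iff.1 hv
  exact (Finset.sum_pos' (fun _ _ => by positivity)
    ⟨i, Finset.mem_univ _, by have := norm_pos_iff.2 hi; positivity⟩).ne'

lemma contDiffAt_lineProj {v : Fin q → ℂ} (hv : v ≠ 0) : ContDiffAt ℝ 2 lineProj v := by
  have h1 : ∀ i : Fin q, ContDiffAt ℝ 2 (fun v : Fin q → ℂ => v i) v := fun i => by fun_prop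
  have h2 : ∀ i : Fin q, ContDiffAt ℝ 2 (fun v : Fin q → ℂ => conj (v i)) v := fun i =>
    (Complex.conjCLE.contDiff.contDiffAt).comp v (h1 i)
  rw [contDiffAt_pi]
  intro i
  rw [contDiffAt_pi]
  intro j
  have h3 : ContDiffAt ℝ 2 (fun v : Fin q → ℂ => ∑ l, v l * conj (v l)) v :=
    ContDiffAt.sum fun l _ => (h1 l).mul (h2 l)
  simp only [lineProj, div_eq_mul_inv]
  exact ((h1 i).mul (h2 j)).mul (h3.inv (sum_mul_conj_ne_zero hv))

lemma lineProj_smul {c : ℂ} (hc : c ≠ 0) (v : Fin q → ℂ) : lineProj (c • v) = lineProj v := by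
  funext i j
  simp only [lineProj, Pi.smul_apply, smul_eq_mul, map_mul]
  have h : ∑ l, c * v l * (conj c * conj (v l)) = (c * conj c) * ∑ l, v l * conj (v l) := by
    rw [Finset.mul_sum]
    exact Finset.sum_congr rfl fun _ _ => by ring
  have hcc : c * conj c ≠ 0 := mul_ne_zero hc ((map_ne_zero _).2 hc)
  rw [h, show c * v i * (conj c * conj (v j)) = (c * conj c) * (v i * conj (v j)) by ring,
    mul_div_mul_left _ _ hcc]

lemma norm_lineProj_le (v : Fin q → ℂ) (i j : Fin q) : ‖lineProj v i j‖ ≤ 1 := by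
  unfold lineProj
  rw [sum_mul_conj, norm_div, norm_mul, RCLike.norm_conj, Complex.norm_real, Real.norm_eq_abs,
    abs_of_nonneg (by positivity)]
  refine div_le_one_of_le₀ ?_ (by positivity)
  have h1 : ∀ i, ‖v i‖ ^ 2 ≤ ∑ l, ‖v l‖ ^ 2 := fun i =>
    Finset.single_le_sum (f := fun l => ‖v l‖ ^ 2) (fun _ _ => by positivity) (Finset.mem_univ i)
  nlinarith [h1 i, h1 j, sq_nonneg (‖v i‖ - ‖v j‖)]

lemma lineProj_mul_lineProj (v : Fin q → ℂ) (i j k l : Fin q) :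
    lineProj v i j * lineProj v k l = lineProj v i l * lineProj v k j := by
  unfold lineProj; ring

lemma conj_lineProj (v : Fin q → ℂ) (i j : Fin q) : conj (lineProj v i j) = lineProj v j i := by
  unfold lineProj
  simp only [map_div₀, map_mul, Complex.conj_conj, map_sum]
  rw [mul_comm]
  congr 1
  exact Finset.sum_congr rfl fun _ _ => mul_comm _ _

lemma sum_lineProj {v : Fin q → ℂ} (hv : v ≠ 0) : ∑ i, lineProj v i i = 1 := by
  unfold lineProj
  rw [← Finset.sum_div, div_self (sum_mul_conj_ne_zero hv)]

lemma lineProj_div {v : Fin q → ℂ} {i : Fin q} (hi : v i ≠ 0) (l : Fin q) :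
    lineProj v l i / lineProj v i i = v l / v i := by
  have h1 := sum_mul_conj_ne_zero (v := v) (fun h => hi (by simp [h]))
  have h2 : conj (v i) ≠ 0 := (map_ne_zero _).2 hi
  unfold lineProj
  field_simp

lemma apply_ne_zero_of_lineProj_ne_zero {v : Fin q → ℂ} {i j : Fin q} (h : lineProj v i j ≠ 0) :
    v i ≠ 0 := by
  intro h'
  exact h (by simp [lineProj, h'])

lemma contDiffAt_lineProj_comp {g : ℂ → Fin q → ℂ} {z : ℂ} (hg : AnalyticAt ℂ g z) (h0 : g z ≠ 0) :
    ContDiffAt ℝ 2 (fun w => lineProj (g w)) z :=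
  (contDiffAt_lineProj h0).comp z (hg.contDiffAt.restrict_scalars ℝ)

lemma continuousAt_projSpeed {g : ℂ → Fin q → ℂ} {z : ℂ} (hg : AnalyticAt ℂ g z) (h0 : g z ≠ 0) :
    ContinuousAt (projSpeed g) z :=
  (((contDiffAt_lineProj_comp hg h0).fderiv_right (m := 0) (by norm_num)).continuousAt).norm

lemma projSpeed_comp_affine {g : ℂ → Fin q → ℂ} {a : ℂ} {ρ : ℝ} (hρ : 0 ≤ ρ) {z : ℂ}
    (hg : AnalyticAt ℂ g (a + ρ * z)) (h0 : g (a + ρ * z) ≠ 0) :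
    projSpeed (fun w => g (a + ρ * w)) z = ρ * projSpeed g (a + ρ * z) := by
  unfold projSpeed
  have h1 := ((contDiffAt_lineProj_comp hg h0).differentiableAt (by norm_num)).hasFDerivAt
  have h2 : HasFDerivAt (fun w : ℂ => a + ρ * w) (ρ • ContinuousLinearMap.id ℝ ℂ) z := by
    have := ((hasFDerivAt_id (𝕜 := ℝ) z).const_smul ρ).const_add a
    simpa using this
  have h3 := HasFDerivAt.comp (g := fun w => lineProj (g w)) z h1 h2
  have h4 := h3.fderiv
  simp only [Function.comp_def] at h4
  rw [h4]
  have : (fderiv ℝ (fun w => lineProj (g w)) (a + ρ * z)).comp (ρ • ContinuousLinearMap.id ℝ ℂ) =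
      ρ • fderiv ℝ (fun w => lineProj (g w)) (a + ρ * z) := by
    ext; simp
  rw [this, norm_smul, Real.norm_of_nonneg hρ]

end lineProj

/-- Brody's reparametrization. -/
lemma exists_reparametrization {q : ℕ} {g : ℂ → Fin q → ℂ} (hg : DifferentiableOn ℂ g (ball 0 1))
    (h0 : ∀ z ∈ ball (0 : ℂ) 1, g z ≠ 0) (hM : 0 < projSpeed g 0) :
    ∃ (a : ℂ) (ρ : ℝ), projSpeed (fun w => g (a + ρ * w)) 0 = 1 ∧
      ∀ z ∈ ball (0 : ℂ) (projSpeed g 0 / 4), a + ρ * z ∈ ball (0 : ℂ) 1 ∧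
        projSpeed (fun w => g (a + ρ * w)) z ≤ 2 := by
  have han : ∀ z ∈ ball (0 : ℂ) 1, AnalyticAt ℂ g z := fun z hz =>
    hg.analyticAt (isOpen_ball.mem_nhds hz)
  have hsub : closedBall (0 : ℂ) (1 / 2) ⊆ ball 0 1 := closedBall_subset_ball (by norm_num)
  have hcont : ContinuousOn (fun z => projSpeed g z * (1 / 2 - ‖z‖)) (closedBall 0 (1 / 2)) := by
    intro z hz
    exact ((continuousAt_projSpeed (han z (hsub hz)) (h0 z (hsub hz))).mul
      (by fun_prop)).continuousWithinAt
  obtain ⟨a, ha, hmax⟩ := (isCompact_closedBall (0 : ℂ) (1 / 2)).exists_isMaxOn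
    ⟨0, by simp⟩ hcont
  rw [isMaxOn_iff] at hmax
  have ha' : ‖a‖ ≤ 1 / 2 := by simpa using ha
  have h1 : projSpeed g 0 * (1 / 2) ≤ projSpeed g a * (1 / 2 - ‖a‖) := by
    simpa using hmax 0 (by simp)
  have hnn : 0 ≤ projSpeed g a := norm_nonneg _
  have hapos : 0 < 1 / 2 - ‖a‖ := by
    rcases (sub_nonneg.2 ha').lt_or_eq with h | h
    · exact h
    · rw [← h] at h1; linarith
  have hspos : 0 < projSpeed g a := by
    rcases hnn.lt_or_eq with h | h
    · exact h
    · rw [← h] at h1; linarith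
  have hkey : ∀ z ∈ ball (0 : ℂ) (projSpeed g 0 / 4),
      ‖a + ((projSpeed g a)⁻¹ : ℝ) * z‖ ≤ ‖a‖ + (1 / 2 - ‖a‖) / 2 := by
    intro z hz
    rw [mem_ball_zero_iff] at hz
    refine (norm_add_le _ _).trans ?_
    rw [norm_mul, Complex.norm_real, Real.norm_of_nonneg (by positivity)]
    have : (projSpeed g a)⁻¹ * ‖z‖ ≤ (projSpeed g a)⁻¹ * (projSpeed g a * (1 / 2 - ‖a‖) / 2) := by
      gcongr; linarith
    have h3 : (projSpeed g a)⁻¹ * (projSpeed g a * (1 / 2 - ‖a‖) / 2) = (1 / 2 - ‖a‖) / 2 := by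
      field_simp
    linarith
  have hmem : ∀ z ∈ ball (0 : ℂ) (projSpeed g 0 / 4),
      a + ((projSpeed g a)⁻¹ : ℝ) * z ∈ closedBall (0 : ℂ) (1 / 2) := by
    intro z hz
    have := hkey z hz
    rw [mem_closedBall_zero_iff]
    linarith
  have hsp : ∀ z ∈ ball (0 : ℂ) (projSpeed g 0 / 4),
      projSpeed (fun w => g (a + ((projSpeed g a)⁻¹ : ℝ) * w)) z =
        (projSpeed g a)⁻¹ * projSpeed g (a + ((projSpeed g a)⁻¹ : ℝ) * z) := by
    intro z hz
    exact projSpeed_comp_affine (by positivity) (han _ (hsub (hmem z hz)))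
      (h0 _ (hsub (hmem z hz)))
  refine ⟨a, (projSpeed g a)⁻¹, ?_, ?_⟩
  · rw [hsp 0 (mem_ball_self (by positivity)), mul_zero, add_zero, inv_mul_cancel₀ hspos.ne']
  · intro z hz
    refine ⟨hsub (hmem z hz), ?_⟩
    rw [hsp z hz, inv_mul_le_iff₀ hspos]
    have h3 := hmax _ (hmem z hz)
    have h4 := hkey z hz
    set t := ‖a + ((projSpeed g a)⁻¹ : ℝ) * z‖
    set s := projSpeed g (a + ((projSpeed g a)⁻¹ : ℝ) * z) with hs
    have hs0 : 0 ≤ s := norm_nonneg _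
    have h5 : s * ((1 / 2 - ‖a‖) / 2) ≤ projSpeed g a * (1 / 2 - ‖a‖) := by
      refine le_trans (mul_le_mul_of_nonneg_left ?_ hs0) h3
      linarith
    nlinarith

lemma exists_tendsto_hyperfilter {E : Type*} [NormedAddCommGroup E] [ProperSpace E] {f : ℕ → E}
    {M : ℝ} (h : ∀ᶠ j in (hyperfilter ℕ : Filter ℕ), ‖f j‖ ≤ M) :
    ∃ a, Tendsto f (hyperfilter ℕ) (𝓝 a) := by
  obtain ⟨a, -, ha⟩ := (isCompact_closedBall (0 : E) M).ultrafilter_le_nhds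
    ((hyperfilter ℕ).map f) (by
      rw [le_principal_iff]
      change ∀ᶠ j in (hyperfilter ℕ : Filter ℕ), f j ∈ closedBall 0 M
      filter_upwards [h] with j hj
      simpa using hj)
  exact ⟨a, ha⟩

lemma hyperfilter_le_atTop : (hyperfilter ℕ : Filter ℕ) ≤ atTop :=
  Nat.cofinite_eq_atTop ▸ hyperfilter_le_cofinite

lemma tendstoUniformlyOn_of_lipschitz {E ι : Type*} [NormedAddCommGroup E] {l : Filter ι} [l.NeBot]
    {f : ι → ℂ → E} {φ : ℂ → E} {z₀ : ℂ} {r C : ℝ} (hC : 0 ≤ C)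
    (hf : ∀ᶠ j in l, ∀ x ∈ ball z₀ r, ∀ y ∈ ball z₀ r, ‖f j x - f j y‖ ≤ C * ‖x - y‖)
    (hφ : ∀ x ∈ ball z₀ r, Tendsto (fun j => f j x) l (𝓝 (φ x))) :
    TendstoUniformlyOn f φ l (ball z₀ r) ∧
      ∀ x ∈ ball z₀ r, ∀ y ∈ ball z₀ r, ‖φ x - φ y‖ ≤ C * ‖x - y‖ := by
  have hlip : ∀ x ∈ ball z₀ r, ∀ y ∈ ball z₀ r, ‖φ x - φ y‖ ≤ C * ‖x - y‖ := by
    intro x hx y hy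
    refine le_of_tendsto ((hφ x hx).sub (hφ y hy)).norm ?_
    filter_upwards [hf] with j hj using hj x hx y hy
  refine ⟨?_, hlip⟩
  rw [Metric.tendstoUniformlyOn_iff]
  intro ε hε
  set δ := ε / (4 * (C + 1)) with hδ
  have hδ0 : 0 < δ := by positivity
  have hCδ : C * δ ≤ ε / 4 := by
    rw [hδ, mul_div_assoc', div_le_div_iff₀ (by positivity) (by norm_num)]
    nlinarith
  obtain ⟨t, htb, htf, ht⟩ := Metric.finite_approx_of_totallyBounded
    (isCompact_closedBall z₀ r |>.totallyBounded.subset ball_subset_closedBall) δ hδ0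
  have h1 : ∀ᶠ j in l, ∀ y ∈ t, ‖f j y - φ y‖ < ε / 4 := by
    rw [eventually_all_finite htf]
    intro y hy
    have := (Metric.tendsto_nhds.1 (hφ y (htb hy))) (ε / 4) (by positivity)
    simpa [dist_eq_norm] using this
  filter_upwards [h1, hf] with j hj1 hj2 x hx
  obtain ⟨y, hy, hxy⟩ := Set.mem_iUnion₂.1 (ht hx)
  rw [mem_ball, dist_eq_norm] at hxy
  have h2 := hlip x hx y (htb hy)
  have h3 := hj2 x hx y (htb hy)
  have h4 := hj1 y hy
  have h5 : C * ‖x - y‖ ≤ ε / 4 := (mul_le_mul_of_nonneg_left hxy.le hC).trans hCδ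
  rw [dist_eq_norm]
  have h6 : φ x - f j x = (φ x - φ y) - (f j x - f j y) - (f j y - φ y) := by abel
  rw [h6]
  have h7 := norm_sub_le ((φ x - φ y) - (f j x - f j y)) (f j y - φ y)
  have h8 := norm_sub_le (φ x - φ y) (f j x - f j y)
  linarith

lemma norm_div_sub_div_le {a b c d : ℂ} {δ ε : ℝ} (hδ : 0 < δ) (hb : δ ≤ ‖b‖) (hd : δ ≤ ‖d‖)
    (hc : ‖c‖ ≤ 1) (hd1 : ‖d‖ ≤ 1) (hac : ‖a - c‖ ≤ ε) (hbd : ‖b - d‖ ≤ ε) :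
    ‖a / b - c / d‖ ≤ 2 * ε / δ ^ 2 := by
  have hb0 : b ≠ 0 := norm_pos_iff.1 (hδ.trans_le hb)
  have hd0 : d ≠ 0 := norm_pos_iff.1 (hδ.trans_le hd)
  have hε : 0 ≤ ε := (norm_nonneg _).trans hac
  have h1 : a / b - c / d = ((a - c) * d - c * (b - d)) / (b * d) := by
    field_simp
    ring
  have h2 : ‖(a - c) * d - c * (b - d)‖ ≤ 2 * ε := by
    refine (norm_sub_le _ _).trans ?_
    rw [norm_mul, norm_mul]
    nlinarith [norm_nonneg (a - c), norm_nonneg (b - d), norm_nonneg c, norm_nonneg d]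
  rw [h1, norm_div, norm_mul]
  apply div_le_div₀ (by positivity) h2 (by positivity)
  nlinarith

/-- **Brody's reparametrization lemma.** -/
theorem exists_brody_limit {q : ℕ} (g : ℕ → ℂ → Fin q → ℂ)
    (hg : ∀ j, DifferentiableOn ℂ (g j) (ball 0 1)) (h0 : ∀ j, ∀ z ∈ ball (0 : ℂ) 1, g j z ≠ 0)
    (hs : Tendsto (fun j => projSpeed (g j) 0) atTop atTop) :
    ∃ (τ : ℕ → ℂ → ℂ) (G : ℂ → Fin q → ℂ), (∀ j, Differentiable ℂ (τ j)) ∧ Differentiable ℂ G ∧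
      (∀ z, G z ≠ 0) ∧ (¬ ∃ (c : Fin q → ℂ) (u : ℂ → ℂ), ∀ z, G z = u z • c) ∧
      ∀ z₀ i, G z₀ i ≠ 0 → ∃ r > 0,
        (∀ᶠ j in (hyperfilter ℕ : Filter ℕ), ∀ z ∈ ball z₀ r,
          τ j z ∈ ball (0 : ℂ) 1 ∧ g j (τ j z) i ≠ 0) ∧
        (∀ z ∈ ball z₀ r, G z i ≠ 0) ∧
        ∀ l, TendstoUniformlyOn (fun j z => g j (τ j z) l / g j (τ j z) i)
          (fun z => G z l / G z i) (hyperfilter ℕ) (ball z₀ r) := by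
  have hrep : ∀ j, ∃ (a : ℂ) (ρ : ℝ), 0 < projSpeed (g j) 0 →
      projSpeed (fun w => g j (a + ρ * w)) 0 = 1 ∧
      ∀ z ∈ ball (0 : ℂ) (projSpeed (g j) 0 / 4), a + ρ * z ∈ ball (0 : ℂ) 1 ∧
        projSpeed (fun w => g j (a + ρ * w)) z ≤ 2 := by
    intro j
    by_cases h : 0 < projSpeed (g j) 0
    · obtain ⟨a, ρ, h'⟩ := exists_reparametrization (hg j) (h0 j) h
      exact ⟨a, ρ, fun _ => h'⟩
    · exact ⟨0, 0, fun h' => absurd h' h⟩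
  choose a ρ hrep using hrep
  set τ : ℕ → ℂ → ℂ := fun j z => a j + ρ j * z with hτ
  set h : ℕ → ℂ → Fin q → ℂ := fun j z => g j (τ j z) with hh
  have hτd : ∀ j, Differentiable ℂ (τ j) := fun j => by simp only [hτ]; fun_prop
  have hev : ∀ R : ℝ, ∀ᶠ j in (hyperfilter ℕ : Filter ℕ), projSpeed (h j) 0 = 1 ∧
      ∀ z ∈ ball (0 : ℂ) R, τ j z ∈ ball (0 : ℂ) 1 ∧ projSpeed (h j) z ≤ 2 := by
    intro R
    have h1 := hyperfilter_le_atTop ((tendsto_atTop.1 hs) (4 * R))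
    have h2 := hyperfilter_le_atTop ((tendsto_atTop.1 hs) 1)
    filter_upwards [h1, h2] with j hj1 hj2
    have hj1 : 4 * R ≤ projSpeed (g j) 0 := hj1
    have hj2 : 1 ≤ projSpeed (g j) 0 := hj2
    obtain ⟨h3, h4⟩ := hrep j (by linarith)
    refine ⟨h3, fun z hz => h4 z (ball_subset_ball (by linarith) hz)⟩
  have hnb : ∀ j z, τ j z ∈ ball (0 : ℂ) 1 → AnalyticAt ℂ (h j) z ∧ h j z ≠ 0 := by
    intro j z hz
    have h1 : AnalyticAt ℂ (g j) (τ j z) := (hg j).analyticAt (isOpen_ball.mem_nhds hz)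
    exact ⟨h1.comp ((hτd j).analyticAt z), h0 j _ hz⟩
  have hnn : ∀ R : ℝ, ∀ᶠ j in (hyperfilter ℕ : Filter ℕ), ∀ z ∈ ball (0 : ℂ) R,
      AnalyticAt ℂ (h j) z ∧ h j z ≠ 0 := by
    intro R
    filter_upwards [hev R] with j hj z hz using hnb j z (hj.2 z hz).1
  have hlip : ∀ R : ℝ, ∀ᶠ j in (hyperfilter ℕ : Filter ℕ), ∀ x ∈ ball (0 : ℂ) R,
      ∀ y ∈ ball (0 : ℂ) R, ‖lineProj (h j x) - lineProj (h j y)‖ ≤ 2 * ‖x - y‖ := by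
    intro R
    filter_upwards [hev R, hnn R] with j hj hj' x hx y hy
    exact (convex_ball (0 : ℂ) R).norm_image_sub_le_of_norm_fderiv_le (𝕜 := ℝ)
      (f := fun z => lineProj (h j z))
      (fun z hz => (contDiffAt_lineProj_comp (hj' z hz).1 (hj' z hz).2).differentiableAt
        (by norm_num)) (fun z hz => (hj.2 z hz).2) hy hx
  have hlim : ∀ z, ∃ p : Fin q → Fin q → ℂ,
      Tendsto (fun j => lineProj (h j z)) (hyperfilter ℕ) (𝓝 p) := by
    intro z
    refine exists_tendsto_hyperfilter (M := 1) (Eventually.of_forall fun j => ?_)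
    rw [pi_norm_le_iff_of_nonneg zero_le_one]
    intro i
    rw [pi_norm_le_iff_of_nonneg zero_le_one]
    exact fun k => norm_lineProj_le _ _ _
  choose φ hφ using hlim
  have hφc : ∀ z i k, Tendsto (fun j => lineProj (h j z) i k) (hyperfilter ℕ) (𝓝 (φ z i k)) :=
    fun z i k => tendsto_pi_nhds.1 (tendsto_pi_nhds.1 (hφ z) i) k
  have hφlip : ∀ x y, ‖φ x - φ y‖ ≤ 2 * ‖x - y‖ := by
    intro x y
    obtain ⟨R, hR⟩ := exists_gt (max ‖x‖ ‖y‖)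
    exact (tendstoUniformlyOn_of_lipschitz zero_le_two (hlip R) (fun z _ => hφ z)).2 x
      (by simpa using (le_max_left _ _).trans_lt hR) y
      (by simpa using (le_max_right _ _).trans_lt hR)
  have hcomp : ∀ (A B : Fin q → Fin q → ℂ) i k, ‖A i k - B i k‖ ≤ ‖A - B‖ := fun A B i k =>
    (norm_le_pi_norm ((A - B) i) k).trans (norm_le_pi_norm (A - B) i)
  have hφ1 : ∀ z i k, ‖φ z i k‖ ≤ 1 := fun z i k =>
    le_of_tendsto (hφc z i k).norm (Eventually.of_forall fun j => norm_lineProj_le _ _ _)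
  have hrank : ∀ z i k l m, φ z i k * φ z l m = φ z i m * φ z l k := by
    intro z i k l m
    refine tendsto_nhds_unique ((hφc z i k).mul (hφc z l m)) ?_
    simp only [lineProj_mul_lineProj _ i k l m]
    exact (hφc z i m).mul (hφc z l k)
  have hherm : ∀ z i k, (starRingEnd ℂ) (φ z i k) = φ z k i := by
    intro z i k
    refine tendsto_nhds_unique (((Complex.continuous_conj.tendsto _).comp (hφc z i k))) ?_
    simp only [Function.comp_def, conj_lineProj]
    exact hφc z k i
  have hdiag : ∀ z, ∃ i, φ z i i ≠ 0 := by
    intro z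
    by_contra! hcon
    have h1 : Tendsto (fun j => ∑ i, lineProj (h j z) i i) (hyperfilter ℕ) (𝓝 (∑ i, φ z i i)) :=
      tendsto_finsetSum _ fun i _ => hφc z i i
    have h2 : Tendsto (fun j => ∑ i, lineProj (h j z) i i) (hyperfilter ℕ) (𝓝 1) := by
      refine tendsto_const_nhds.congr' ?_
      filter_upwards [hnn (‖z‖ + 1)] with j hj
      rw [sum_lineProj (hj z (by simp)).2]
    have := tendsto_nhds_unique h1 h2
    simp [hcon] at this
  -- local convergence of affine coordinates
  have hloc : ∀ z₀ i, φ z₀ i i ≠ 0 → ∃ r > 0,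
      (∀ᶠ j in (hyperfilter ℕ : Filter ℕ), ∀ z ∈ ball z₀ r,
        τ j z ∈ ball (0 : ℂ) 1 ∧ h j z i ≠ 0) ∧
      (∀ z ∈ ball z₀ r, φ z i i ≠ 0) ∧
      ∀ l, TendstoUniformlyOn (fun j z => h j z l / h j z i)
          (fun z => φ z l i / φ z i i) (hyperfilter ℕ) (ball z₀ r) ∧
        DifferentiableOn ℂ (fun z => φ z l i / φ z i i) (ball z₀ r) := by
    intro z₀ i hi
    set δ := ‖φ z₀ i i‖ / 4 with hδ
    have hδ0 : 0 < δ := by have := norm_pos_iff.2 hi; positivity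
    have hzb : ball z₀ δ ⊆ ball (0 : ℂ) (‖z₀‖ + δ) := by
      intro z hz
      rw [mem_ball, dist_eq_norm] at hz
      rw [mem_ball_zero_iff]
      have := norm_add_le (z - z₀) z₀
      rw [sub_add_cancel] at this
      linarith
    have hφb : ∀ z ∈ ball z₀ δ, 2 * δ ≤ ‖φ z i i‖ := by
      intro z hz
      rw [mem_ball, dist_eq_norm] at hz
      have h1 := hcomp (φ z₀) (φ z) i i
      have h2 := hφlip z₀ z
      have h3 := norm_sub_norm_le (φ z₀ i i) (φ z i i)
      rw [norm_sub_rev] at hz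
      linarith
    have hU := (tendstoUniformlyOn_of_lipschitz zero_le_two (hlip (‖z₀‖ + δ)) (fun z _ => hφ z)).1
    rw [Metric.tendstoUniformlyOn_iff] at hU
    have hPb : ∀ᶠ j in (hyperfilter ℕ : Filter ℕ), ∀ z ∈ ball z₀ δ, δ ≤ ‖lineProj (h j z) i i‖ := by
      filter_upwards [hU δ hδ0] with j hj z hz
      have h1 := hj z (hzb hz)
      rw [dist_eq_norm] at h1
      have h2 := hcomp (φ z) (lineProj (h j z)) i i
      have h3 := norm_sub_norm_le (φ z i i) (lineProj (h j z) i i)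
      have := hφb z hz
      linarith
    have hne : ∀ᶠ j in (hyperfilter ℕ : Filter ℕ), ∀ z ∈ ball z₀ δ,
        τ j z ∈ ball (0 : ℂ) 1 ∧ h j z i ≠ 0 := by
      filter_upwards [hPb, hev (‖z₀‖ + δ)] with j hj hj' z hz
      refine ⟨(hj'.2 z (hzb hz)).1, apply_ne_zero_of_lineProj_ne_zero (j := i) ?_⟩
      exact norm_pos_iff.1 (hδ0.trans_le (hj z hz))
    have hφne : ∀ z ∈ ball z₀ δ, φ z i i ≠ 0 := fun z hz =>
      norm_pos_iff.1 (by have := hφb z hz; linarith)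
    refine ⟨δ, hδ0, hne, hφne, fun l => ?_⟩
    have hT : TendstoUniformlyOn (fun j z => h j z l / h j z i)
          (fun z => φ z l i / φ z i i) (hyperfilter ℕ) (ball z₀ δ) := by
      refine (tendstoUniformlyOn_of_lipschitz (C := 4 / δ ^ 2) (by positivity) ?_ ?_).1
      · filter_upwards [hPb, hne, hlip (‖z₀‖ + δ)] with j hj1 hj2 hj3 x hx y hy
        rw [← lineProj_div (hj2 x hx).2, ← lineProj_div (hj2 y hy).2]
        have h1 := hj3 x (hzb hx) y (hzb hy)
        refine (norm_div_sub_div_le hδ0 (hj1 x hx) (hj1 y hy) (norm_lineProj_le _ _ _)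
          (norm_lineProj_le _ _ _) ((hcomp _ _ _ _).trans h1)
          ((hcomp _ _ _ _).trans h1)).trans (le_of_eq ?_)
        ring
      · intro x hx
        refine ((hφc x l i).div (hφc x i i) (hφne x hx)).congr' ?_
        filter_upwards [hne] with j hj
        change lineProj (h j x) l i / lineProj (h j x) i i = _
        rw [lineProj_div (hj x hx).2]
    refine ⟨hT, hT.tendstoLocallyUniformlyOn.differentiableOn ?_ isOpen_ball⟩
    filter_upwards [hne] with j hj z hz
    have h1 := (hnb j z (hj z hz).1).1.differentiableAt
    have h2 := fun m => differentiableAt_pi.1 h1 m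
    exact ((h2 l).div (h2 i) (hj z hz).2).differentiableWithinAt
  choose m hm using hdiag
  choose r hr hr1 hr2 hr3 using fun z => hloc z (m z) (hm z)
  obtain ⟨G, hG, hG0, hGe⟩ := exists_global_lift
    (fun z₀ z l => φ z l (m z₀) / φ z (m z₀) (m z₀)) r hr
    (fun z₀ => differentiableOn_pi.2 fun l => (hr3 z₀ l).2)
    (fun z₀ z hz h1 => by
      have := congrFun h1 (m z₀)
      simp only [Pi.zero_apply] at this
      rw [div_self (hr2 z₀ z hz)] at this
      exact one_ne_zero this)
    (fun z₀ z hz => by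
      refine ⟨φ z (m z) (m z₀) / φ z (m z₀) (m z₀), funext fun l => ?_⟩
      simp only [Pi.smul_apply, smul_eq_mul]
      have h1 := hr2 z₀ z hz
      have h2 := hm z
      have h3 := hrank z l (m z₀) (m z) (m z)
      field_simp
      rw [h3]; ring)
  have hGφ : ∀ z, ∃ c, c ≠ 0 ∧ ∀ l, G z l = c * φ z l (m z) := by
    intro z
    obtain ⟨c, hc, h1⟩ := hGe z z (mem_ball_self (hr z))
    refine ⟨c / φ z (m z) (m z), div_ne_zero hc (hm z), fun l => ?_⟩
    rw [h1]
    simp only [Pi.smul_apply, smul_eq_mul]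
    ring
  have hGi : ∀ z i, G z i ≠ 0 ↔ φ z i i ≠ 0 := by
    intro z i
    obtain ⟨c, hc, h1⟩ := hGφ z
    have h2 := hrank z i i (m z) (m z)
    rw [h1, ← hherm z i (m z)] at *
    rw [Ne, Ne, not_iff_not]
    constructor
    · intro h3
      rw [(mul_eq_zero.1 h3).resolve_left hc, zero_mul] at h2
      exact (mul_eq_zero.1 h2).resolve_right (hm z)
    · intro h3
      rw [h3, zero_mul] at h2
      rcases mul_eq_zero.1 h2.symm with h4 | h4
      · rw [h4, mul_zero]
      · rw [(map_eq_zero _).1 h4, mul_zero]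
  have hGr : ∀ z i l, φ z i i ≠ 0 → G z l / G z i = φ z l i / φ z i i := by
    intro z i l hi
    have hGi' := (hGi z i).2 hi
    obtain ⟨c, hc, h1⟩ := hGφ z
    rw [div_eq_div_iff hGi' hi, h1, h1]
    have := hrank z l (m z) i i
    linear_combination c * this
  have hfinal : ∀ z₀ i, G z₀ i ≠ 0 → ∃ r > 0,
        (∀ᶠ j in (hyperfilter ℕ : Filter ℕ), ∀ z ∈ ball z₀ r,
          τ j z ∈ ball (0 : ℂ) 1 ∧ g j (τ j z) i ≠ 0) ∧
        (∀ z ∈ ball z₀ r, G z i ≠ 0) ∧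
        ∀ l, TendstoUniformlyOn (fun j z => g j (τ j z) l / g j (τ j z) i)
          (fun z => G z l / G z i) (hyperfilter ℕ) (ball z₀ r) := by
    intro z₀ i hi
    obtain ⟨s, hs0, hs1, hs2, hs3⟩ := hloc z₀ i ((hGi z₀ i).1 hi)
    refine ⟨s, hs0, hs1, fun z hz => (hGi z i).2 (hs2 z hz), fun l => ?_⟩
    exact (hs3 l).1.congr_right fun z hz => (hGr z i l (hs2 z hz)).symm
  refine ⟨τ, G, hτd, hG, hG0, ?_, hfinal⟩
  rintro ⟨c, u, hcu⟩
  obtain ⟨i, hi⟩ : ∃ i, G 0 i ≠ 0 := Function.ne_iff.1 (hG0 0)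
  obtain ⟨s, hs0, hs1, hs2, hs3⟩ := hfinal 0 i hi
  -- affine coordinates near the origin
  set v : Fin q → ℂ := fun l => G 0 l / G 0 i with hv
  have hv0 : v ≠ 0 := fun h1 => by
    have := congrFun h1 i
    simp [hv, hi] at this
  have hvz : ∀ z ∈ ball (0 : ℂ) s, ∀ l, G z l / G z i = v l := by
    intro z hz l
    have h1 := hs2 z hz
    simp only [hv]
    rw [hcu] at h1 hi ⊢
    rw [hcu 0]
    simp only [Pi.smul_apply, smul_eq_mul] at h1 hi ⊢
    have h2 := left_ne_zero_of_mul h1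
    have h3 := left_ne_zero_of_mul hi
    rw [mul_div_mul_left _ _ h2, mul_div_mul_left _ _ h3]
  set k : ℕ → ℂ → Fin q → ℂ := fun j z l => h j z l / h j z i with hk
  have hkd : ∀ᶠ j in (hyperfilter ℕ : Filter ℕ), ∀ l, DifferentiableOn ℂ (fun z => k j z l)
      (ball 0 s) := by
    filter_upwards [hs1] with j hj l z hz
    have h1 := (hnb j z (hj z hz).1).1.differentiableAt
    have h2 := fun m => differentiableAt_pi.1 h1 m
    exact ((h2 l).div (h2 i) (hj z hz).2).differentiableWithinAt
  have h0s : (0 : ℂ) ∈ ball (0 : ℂ) s := mem_ball_self hs0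
  have hk0 : Tendsto (fun j => k j 0) (hyperfilter ℕ) (𝓝 v) := by
    rw [tendsto_pi_nhds]
    intro l
    have := (hs3 l).tendsto_at h0s
    exact this
  have hkd0 : Tendsto (fun j => deriv (k j) 0) (hyperfilter ℕ) (𝓝 0) := by
    have h1 : ∀ l, Tendsto (fun j => deriv (fun z => k j z l) 0) (hyperfilter ℕ) (𝓝 0) := by
      intro l
      have h2 := (hs3 l).congr_right (g := fun _ => v l) fun z hz => hvz z hz l
      have h3 := h2.tendstoLocallyUniformlyOn.deriv
        (by filter_upwards [hkd] with j hj using hj l) isOpen_ball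
      have h4 := h3.tendsto_at h0s
      simpa using h4
    have h2 : ∀ᶠ j in (hyperfilter ℕ : Filter ℕ),
        deriv (k j) 0 = fun l => deriv (fun z => k j z l) 0 := by
      filter_upwards [hkd] with j hj
      exact deriv_pi fun l => (hj l).differentiableAt (isOpen_ball.mem_nhds h0s)
    refine Tendsto.congr' (EventuallyEq.symm h2) ?_
    exact tendsto_pi_nhds.2 fun l => by simpa using h1 l
  have hsp : ∀ᶠ j in (hyperfilter ℕ : Filter ℕ),
      1 ≤ ‖fderiv ℝ (lineProj (q := q)) (k j 0)‖ * ‖deriv (k j) 0‖ := by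
    filter_upwards [hev 1, hs1, hkd] with j hj1 hj2 hj3
    have h1 : projSpeed (h j) 0 = 1 := hj1.1
    have hkne : k j 0 ≠ 0 := fun h2 => by
      have h3 := congrFun h2 i
      have h4 : h j 0 i ≠ 0 := (hj2 0 h0s).2
      simp [hk, h4] at h3
    have h2 : (fun w => lineProj (h j w)) =ᶠ[𝓝 0] fun w => lineProj (k j w) := by
      filter_upwards [isOpen_ball.mem_nhds h0s] with z hz
      have h4 : h j z i ≠ 0 := (hj2 z hz).2
      rw [← lineProj_smul (inv_ne_zero h4)]
      congr 1
      funext l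
      simp only [hk, Pi.smul_apply, smul_eq_mul]
      ring
    have h3 : DifferentiableAt ℂ (k j) 0 :=
      differentiableAt_pi.2 fun l => (hj3 l).differentiableAt (isOpen_ball.mem_nhds h0s)
    have h4 := ((contDiffAt_lineProj hkne).differentiableAt (by norm_num)).hasFDerivAt
    have h5 := h3.hasDerivAt.hasFDerivAt.restrictScalars ℝ
    have h6 := HasFDerivAt.comp (g := lineProj) (0 : ℂ) h4 h5
    have h7 := h6.fderiv
    rw [projSpeed, h2.fderiv_eq] at h1
    simp only [Function.comp_def] at h7
    rw [h7] at h1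
    rw [← h1]
    refine (ContinuousLinearMap.opNorm_comp_le _ _).trans ?_
    refine mul_le_mul_of_nonneg_left ?_ (norm_nonneg _)
    rw [ContinuousLinearMap.norm_restrictScalars]
    simp
  have hcd : ContinuousAt (fderiv ℝ (lineProj (q := q))) v :=
    ((contDiffAt_lineProj hv0).fderiv_right (m := 0) (by norm_num)).continuousAt
  have hlim0 : Tendsto (fun j => ‖fderiv ℝ (lineProj (q := q)) (k j 0)‖ * ‖deriv (k j) 0‖)
      (hyperfilter ℕ) (𝓝 (‖fderiv ℝ (lineProj (q := q)) v‖ * ‖(0 : Fin q → ℂ)‖)) :=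
    (hcd.tendsto.comp hk0).norm.mul hkd0.norm
  have := ge_of_tendsto hlim0 hsp
  simp at this
  linarith

lemma exists_projSpeed_ne_zero {q : ℕ} {g : ℂ → Fin q → ℂ} (hg : Differentiable ℂ g)
    (h0 : ∀ z, g z ≠ 0)
    (hnc : ¬ ∃ (c : Fin q → ℂ) (u : ℂ → ℂ), Differentiable ℂ u ∧ ∀ z, g z = u z • c) :
    ∃ z, projSpeed g z ≠ 0 := by
  by_contra! hz
  refine hnc ?_
  have hconst : ∀ z, lineProj (g z) = lineProj (g 0) := fun z =>
    is_const_of_fderiv_eq_zero (𝕜 := ℝ) (f := fun w => lineProj (g w))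
      (fun w => (contDiffAt_lineProj_comp (hg.analyticAt w) (h0 w)).differentiableAt (by norm_num))
      (fun w => norm_eq_zero.1 (hz w)) z 0
  obtain ⟨i, -, hi⟩ := Finset.exists_ne_zero_of_sum_ne_zero
    (show ∑ i, lineProj (g 0) i i ≠ 0 by rw [sum_lineProj (h0 0)]; exact one_ne_zero)
  refine ⟨fun l => lineProj (g 0) l i / lineProj (g 0) i i, fun z => g z i,
    differentiable_pi.1 hg i, fun z => funext fun l => ?_⟩
  have h1 : g z i ≠ 0 := apply_ne_zero_of_lineProj_ne_zero (j := i) (by rw [hconst z]; exact hi)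
  rw [← hconst z, Pi.smul_apply, smul_eq_mul, lineProj_div h1, mul_div_cancel₀ _ h1]

/-- The entire curves `h j` in projective space, given in homogeneous coordinates, converge locally
uniformly along a fixed ultrafilter to the entire curve `G`. -/
structure IsProjLimit {q : ℕ} (h : ℕ → ℂ → Fin q → ℂ) (G : ℂ → Fin q → ℂ) : Prop where
  differentiable_seq : ∀ j, Differentiable ℂ (h j)
  differentiable : Differentiable ℂ G
  ne_zero : ∀ z, G z ≠ 0
  exists_tendstoUniformlyOn : ∀ z₀ i, G z₀ i ≠ 0 → ∃ r > 0,
    (∀ᶠ j in (hyperfilter ℕ : Filter ℕ), ∀ z ∈ ball z₀ r, h j z i ≠ 0) ∧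
    (∀ z ∈ ball z₀ r, G z i ≠ 0) ∧
    ∀ l, TendstoUniformlyOn (fun j z => h j z l / h j z i)
      (fun z => G z l / G z i) (hyperfilter ℕ) (ball z₀ r)

/-- Brody's reparametrization lemma. -/
theorem exists_isProjLimit {q : ℕ} (f : ℕ → ℂ → Fin q → ℂ) (hf : ∀ j, Differentiable ℂ (f j))
    (h0 : ∀ j z, f j z ≠ 0)
    (hnc : ∀ j, ¬ ∃ (c : Fin q → ℂ) (u : ℂ → ℂ), Differentiable ℂ u ∧ ∀ z, f j z = u z • c) :
    ∃ (τ : ℕ → ℂ → ℂ) (G : ℂ → Fin q → ℂ), IsProjLimit (fun j z => f j (τ j z)) G ∧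
      ¬ ∃ (c : Fin q → ℂ) (u : ℂ → ℂ), ∀ z, G z = u z • c := by
  choose a ha using fun j => exists_projSpeed_ne_zero (hf j) (h0 j) (hnc j)
  have ha' : ∀ j, 0 < projSpeed (f j) (a j) := fun j =>
    lt_of_le_of_ne (norm_nonneg _) (ha j).symm
  set ρ : ℕ → ℝ := fun j => j / projSpeed (f j) (a j) with hρ
  have hdiff : ∀ j, Differentiable ℂ fun z : ℂ => a j + ρ j * z := fun j => by fun_prop
  obtain ⟨τ, G, hτ, hG, hG0, hGc, hlim⟩ := exists_brody_limit (fun j z => f j (a j + ρ j * z))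
    (fun j => ((hf j).comp (hdiff j)).differentiableOn) (fun j z _ => h0 j _) (by
      have : ∀ j, projSpeed (fun z => f j (a j + ρ j * z)) 0 = j := by
        intro j
        have := (ha' j).le
        rw [projSpeed_comp_affine (g := f j) (by positivity) ((hf j).analyticAt _) (h0 j _),
          mul_zero, add_zero, hρ, div_mul_cancel₀ _ (ha j)]
      simp_rw [this]
      exact tendsto_natCast_atTop_atTop)
  refine ⟨fun j z => a j + ρ j * τ j z, G, ⟨fun j => (hf j).comp ((hdiff j).comp (hτ j)), hG, hG0,
    fun z₀ i hi => ?_⟩, hGc⟩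
  obtain ⟨r, hr, h1, h2, h3⟩ := hlim z₀ i hi
  exact ⟨r, hr, h1.mono fun j hj z hz => (hj z hz).2, h2, h3⟩

/-- A sequence of non-hyperbolic hypersurfaces
carries entire curves converging to a nonconstant entire curve. -/
theorem exists_isProjLimit_of_not_hyperbolic {q : ℕ} (P : ℕ → MvPolynomial (Fin q) ℂ)
    (hP : ∀ j, ¬ IsBrodyHyperbolicHypersurface (P j)) :
    ∃ (h : ℕ → ℂ → Fin q → ℂ) (G : ℂ → Fin q → ℂ), IsProjLimit h G ∧
      (∀ j z, eval (h j z) (P j) = 0) ∧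
      ¬ ∃ (c : Fin q → ℂ) (u : ℂ → ℂ), ∀ z, G z = u z • c := by
  have h1 : ∀ j : ℕ, ∃ g : ℂ → Fin q → ℂ, Differentiable ℂ g ∧ (∀ z, g z ≠ 0) ∧
      (∀ z, eval (g z) (P j) = 0) ∧
      ¬ ∃ (c : Fin q → ℂ) (u : ℂ → ℂ), Differentiable ℂ u ∧ ∀ z, g z = u z • c := by
    intro j
    have h2 := hP j
    unfold IsBrodyHyperbolicHypersurface at h2
    push Not at h2
    obtain ⟨f, hf, hf0, hfP, hfc⟩ := h2
    refine ⟨fun z i => f i z, differentiable_pi.2 hf, fun z h => ?_, hfP, ?_⟩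
    · obtain ⟨i, hi⟩ := hf0 z
      exact hi (congrFun h i)
    · rintro ⟨c, u, hu, h⟩
      obtain ⟨i, z, hiz⟩ := hfc c u hu
      refine hiz ?_
      have := congrFun (h z) i
      simpa [mul_comm] using this
  choose f hf hf0 hfP hfc using h1
  obtain ⟨τ, G, hlim, hGc⟩ := exists_isProjLimit f hf hf0 hfc
  exact ⟨_, G, hlim, fun j z => hfP j _, hGc⟩

/-- Hurwitz's theorem. -/
lemma hurwitz {ι : Type*} {l : Filter ι} [l.NeBot] {f : ι → ℂ → ℂ} {φ : ℂ → ℂ} {z₀ : ℂ} {r : ℝ}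
    (hr : 0 < r) (hf : ∀ᶠ j in l, DifferentiableOn ℂ (f j) (ball z₀ r))
    (hne : ∀ᶠ j in l, ∀ z ∈ ball z₀ r, f j z ≠ 0)
    (hlim : TendstoUniformlyOn f φ l (ball z₀ r)) (h0 : φ z₀ = 0) : ∀ᶠ z in 𝓝 z₀, φ z = 0 := by
  have hφ : DifferentiableOn ℂ φ (ball z₀ r) :=
    hlim.tendstoLocallyUniformlyOn.differentiableOn hf isOpen_ball
  have han : AnalyticAt ℂ φ z₀ := hφ.analyticAt (isOpen_ball.mem_nhds (mem_ball_self hr))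
  refine han.eventually_eq_zero_or_eventually_ne_zero.resolve_right fun hev => ?_
  rw [eventually_nhdsWithin_iff, Metric.eventually_nhds_iff] at hev
  obtain ⟨δ, hδ, hev⟩ := hev
  set ρ := min δ r / 2 with hρ
  have hρ0 : 0 < ρ := by positivity
  have hρδ : ρ < δ := by have := min_le_left δ r; linarith [lt_min hδ hr]
  have hρr : ρ < r := by have := min_le_right δ r; linarith [lt_min hδ hr]
  have hsub : closedBall z₀ ρ ⊆ ball z₀ r := closedBall_subset_ball hρr
  have hsph : ∀ z ∈ sphere z₀ ρ, φ z ≠ 0 := fun z hz => by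
    rw [mem_sphere] at hz
    exact hev (hz ▸ hρδ) fun h => by
      rw [Set.mem_singleton_iff.1 h, dist_self] at hz
      exact hρ0.ne hz
  obtain ⟨m, hm, hmin⟩ : ∃ m > 0, ∀ z ∈ sphere z₀ ρ, m ≤ ‖φ z‖ := by
    obtain ⟨w, hw, hmin⟩ := (isCompact_sphere z₀ ρ).exists_isMinOn
      (NormedSpace.sphere_nonempty.2 hρ0.le)
      ((hφ.continuousOn.mono (sphere_subset_closedBall.trans hsub)).norm)
    exact ⟨‖φ w‖, norm_pos_iff.2 (hsph w hw), fun z hz => hmin hz⟩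
  rw [Metric.tendstoUniformlyOn_iff] at hlim
  obtain ⟨j, hj1, hj2, hj3⟩ := (hf.and (hne.and (hlim (m / 3) (by positivity)))).exists
  have hmax := Complex.norm_le_of_forall_mem_frontier_norm_le (f := fun z => (f j z)⁻¹)
    (C := (m * (2 / 3))⁻¹) (U := ball z₀ ρ) (z := z₀) isBounded_ball
    ⟨(hj1.mono (ball_subset_closedBall.trans hsub)).inv fun z hz =>
      hj2 z (hsub (ball_subset_closedBall hz)), by
      rw [closure_ball _ hρ0.ne']
      exact (hj1.continuousOn.mono hsub).inv₀ fun z hz => hj2 z (hsub hz)⟩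
    (by
      rw [frontier_ball _ hρ0.ne']
      intro z hz
      rw [norm_inv]
      refine inv_anti₀ (by positivity) ?_
      have h1 := hj3 z (hsub (sphere_subset_closedBall hz))
      have h2 := hmin z hz
      rw [dist_eq_norm] at h1
      have h3 := norm_sub_norm_le (φ z) (f j z)
      linarith)
    (subset_closure (mem_ball_self hρ0))
  rw [norm_inv, inv_le_inv₀ (norm_pos_iff.2 (hj2 _ (mem_ball_self hr))) (by positivity)] at hmax
  have h1 := hj3 z₀ (mem_ball_self hr)
  rw [h0, dist_zero_left] at h1
  linarith

/-- Montel's theorem along an ultrafilter. -/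
lemma exists_tendstoUniformlyOn_of_norm_le {f : ℕ → ℂ → ℂ} {z₀ : ℂ} {r M : ℝ} (hr : 0 < r)
    (hf : ∀ᶠ j in (hyperfilter ℕ : Filter ℕ), DifferentiableOn ℂ (f j) (ball z₀ r) ∧
      ∀ z ∈ ball z₀ r, ‖f j z‖ ≤ M) :
    ∃ φ, TendstoUniformlyOn f φ (hyperfilter ℕ) (ball z₀ (r / 2)) := by
  have hsub : ball z₀ (r / 2) ⊆ ball z₀ r := ball_subset_ball (by linarith)
  have h1 : ∀ z, ∃ a, z ∈ ball z₀ (r / 2) → Tendsto (fun j => f j z) (hyperfilter ℕ) (𝓝 a) := by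
    intro z
    by_cases hz : z ∈ ball z₀ (r / 2)
    · obtain ⟨a, ha⟩ := exists_tendsto_hyperfilter (f := fun j => f j z)
        (hf.mono fun j hj => hj.2 z (hsub hz))
      exact ⟨a, fun _ => ha⟩
    · exact ⟨0, fun h => absurd h hz⟩
  choose φ hφ using h1
  have hM : 0 ≤ M := by
    obtain ⟨j, hj⟩ := hf.exists
    exact (norm_nonneg _).trans (hj.2 z₀ (mem_ball_self hr))
  refine ⟨φ, (tendstoUniformlyOn_of_lipschitz (C := M / (r / 4)) (by positivity) ?_ hφ).1⟩
  filter_upwards [hf] with j hj x hx y hy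
  refine (convex_ball z₀ (r / 2)).norm_image_sub_le_of_norm_deriv_le (𝕜 := ℂ)
    (fun w hw => hj.1.differentiableAt (isOpen_ball.mem_nhds (hsub hw))) (fun w hw => ?_) hy hx
  have hwr : closedBall w (r / 4) ⊆ ball z₀ r := by
    intro v hv
    rw [mem_closedBall] at hv
    rw [mem_ball] at hw ⊢
    linarith [dist_triangle v w z₀]
  refine Complex.norm_deriv_le_of_forall_mem_sphere_norm_le (by positivity) ?_ fun v hv =>
    hj.2 v (hwr (sphere_subset_closedBall hv))
  refine DifferentiableOn.diffContOnCl ?_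
  rw [closure_ball _ (by positivity)]
  exact hj.1.mono hwr

lemma eq_zero_of_eventually_eq_zero {φ : ℂ → ℂ} (hφ : Differentiable ℂ φ) {z₀ : ℂ}
    (h : ∀ᶠ z in 𝓝 z₀, φ z = 0) (z : ℂ) : φ z = 0 :=
  congrFun (AnalyticOnNhd.eq_of_eventuallyEq (f := φ) (g := 0) (fun w _ => hφ.analyticAt w)
    (fun _ _ => analyticAt_const) h) z

lemma IsProjLimit.linear {q : ℕ} {h : ℕ → ℂ → Fin q → ℂ} {G : ℂ → Fin q → ℂ}
    (hG : IsProjLimit h G) (a : Fin q → ℂ)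
    (hne : ∀ᶠ j in (hyperfilter ℕ : Filter ℕ), ∀ z, ∑ l, a l * h j z l ≠ 0) :
    (∀ z, ∑ l, a l * G z l ≠ 0) ∨ ∀ z, ∑ l, a l * G z l = 0 := by
  have hd : ∀ l, Differentiable ℂ fun z => G z l := differentiable_pi.1 hG.differentiable
  by_contra! hcon
  obtain ⟨⟨z₀, hz₀⟩, z₁, hz₁⟩ := hcon
  refine hz₁ (eq_zero_of_eventually_eq_zero (φ := fun z => ∑ l, a l * G z l) (z₀ := z₀)
    (by fun_prop) ?_ z₁)
  obtain ⟨i, hi⟩ := Function.ne_iff.1 (hG.ne_zero z₀)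
  obtain ⟨r, hr, h1, h2, h3⟩ := hG.exists_tendstoUniformlyOn z₀ i hi
  have h4 : TendstoUniformlyOn (fun j z => ∑ l, a l * (h j z l / h j z i))
      (fun z => ∑ l, a l * (G z l / G z i)) (hyperfilter ℕ) (ball z₀ r) := by
    rw [Metric.tendstoUniformlyOn_iff]
    intro ε hε
    set S := ∑ l, ‖a l‖ + 1 with hS
    have hS0 : 0 ≤ ∑ l, ‖a l‖ := Finset.sum_nonneg fun _ _ => norm_nonneg _
    have h5 := fun l => Metric.tendstoUniformlyOn_iff.1 (h3 l) (ε / S) (by positivity)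
    filter_upwards [eventually_all.2 h5] with j hj z hz
    rw [dist_eq_norm, ← Finset.sum_sub_distrib]
    calc ‖∑ l, (a l * (G z l / G z i) - a l * (h j z l / h j z i))‖
        ≤ ∑ l, ‖a l‖ * (ε / S) := by
          refine norm_sum_le_of_le _ fun l _ => ?_
          rw [← mul_sub, norm_mul, ← dist_eq_norm]
          exact mul_le_mul_of_nonneg_left (hj l z hz).le (norm_nonneg _)
      _ = ε * ((S - 1) / S) := by rw [← Finset.sum_mul, hS]; ring
      _ < ε * 1 := by
          refine mul_lt_mul_of_pos_left ?_ hε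
          rw [div_lt_one (by positivity)]
          linarith
      _ = ε := mul_one _
  have h5 := hurwitz hr (h1.mono fun j hj => by
      have := fun l => (differentiable_pi.1 (hG.differentiable_seq j) l).differentiableOn
        (s := ball z₀ r)
      exact DifferentiableOn.fun_sum fun l _ => ((this l).div (this i) hj).const_mul (a l))
    (by
      filter_upwards [h1, hne] with j hj hj' z hz h6
      refine hj' z ?_
      have : ∑ l, a l * (h j z l / h j z i) = (∑ l, a l * h j z l) / h j z i := by
        rw [Finset.sum_div]
        exact Finset.sum_congr rfl fun l _ => by ring
      rw [this, div_eq_zero_iff] at h6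
      exact h6.resolve_right (hj z hz)) h4 (by
      have : ∑ l, a l * (G z₀ l / G z₀ i) = (∑ l, a l * G z₀ l) / G z₀ i := by
        rw [Finset.sum_div]
        exact Finset.sum_congr rfl fun l _ => by ring
      rw [this, hz₀, zero_div])
  filter_upwards [h5, isOpen_ball.mem_nhds (mem_ball_self hr)] with z hz hz'
  have : ∑ l, a l * (G z l / G z i) = (∑ l, a l * G z l) / G z i := by
    rw [Finset.sum_div]
    exact Finset.sum_congr rfl fun l _ => by ring
  rw [this, div_eq_zero_iff] at hz
  exact hz.resolve_right (h2 z hz')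

lemma exists_entire_log {f : ℂ → ℂ} (hf : Differentiable ℂ f) (h0 : ∀ z, f z ≠ 0) :
    ∃ L, Differentiable ℂ L ∧ ∀ z, f z = Complex.exp (L z) := by
  have hd : Differentiable ℂ (deriv f) := fun z => (hf.analyticAt z).deriv.differentiableAt
  have hq : Differentiable ℂ fun z => deriv f z / f z := hd.div hf h0
  obtain ⟨L, hL⟩ := hq.isExactOn_univ
  have hL' : ∀ z, HasDerivAt L (deriv f z / f z) z := fun z => hL z (Set.mem_univ z)
  refine ⟨fun z => Complex.log (f 0) + (L z - L 0), fun z => by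
    have := (hL' z).differentiableAt
    fun_prop, fun z => ?_⟩
  have hc := is_const_of_deriv_eq_zero (f := fun z => f z * Complex.exp (-(L z - L 0)))
    (fun z => by
      have := (hL' z).differentiableAt
      have := hf z
      fun_prop)
    (fun z => by
      have h1 := (hf z).hasDerivAt.mul (((hL' z).sub_const (L 0)).neg.cexp)
      refine h1.deriv.trans ?_
      have := h0 z
      field_simp
      ring) z 0
  simp only [sub_self, neg_zero, Complex.exp_zero, mul_one] at hc
  rw [Complex.exp_add, Complex.exp_log (h0 0), ← hc, mul_assoc, ← Complex.exp_add,
    neg_add_cancel, Complex.exp_zero, mul_one]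

lemma exists_pow_two_pow_eq_one_of_isOpen {U : Set ℂ} (hU : IsOpen U) {w : ℂ} (hw : w ∈ U)
    (hw1 : ‖w‖ = 1) : ∃ m : ℕ, ∃ ω ∈ U, ω ^ 2 ^ m = 1 := by
  set t : ℝ := Complex.arg w / (2 * Real.pi) with ht
  have hwt : w = Complex.exp ((2 * Real.pi * t : ℝ) * Complex.I) := by
    rw [ht, mul_div_cancel₀ _ (by positivity)]
    conv_lhs => rw [← Complex.norm_mul_exp_arg_mul_I w, hw1]
    simp
  have hlim : Tendsto (fun m : ℕ => (⌊(2 : ℝ) ^ m * t⌋ : ℝ) / 2 ^ m) atTop (𝓝 t) := by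
    have h2 : Tendsto (fun m : ℕ => (2 : ℝ) ^ m) atTop atTop :=
      tendsto_pow_atTop_atTop_of_one_lt (by norm_num)
    have h3 : Tendsto (fun m : ℕ => t - ((2 : ℝ) ^ m)⁻¹) atTop (𝓝 t) := by
      simpa using (tendsto_const_nhds (x := t)).sub (tendsto_inv_atTop_zero.comp h2)
    refine tendsto_of_tendsto_of_tendsto_of_le_of_le h3 tendsto_const_nhds (fun m => ?_)
      fun m => ?_
    · have := Int.lt_floor_add_one ((2 : ℝ) ^ m * t)
      have hp : (0 : ℝ) < 2 ^ m := by positivity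
      rw [le_div_iff₀ hp, sub_mul, inv_mul_cancel₀ hp.ne']
      linarith
    · have := Int.floor_le ((2 : ℝ) ^ m * t)
      have hp : (0 : ℝ) < 2 ^ m := by positivity
      rw [div_le_iff₀ hp]
      linarith
  have hlim2 : Tendsto (fun m : ℕ => Complex.exp ((2 * Real.pi *
      ((⌊(2 : ℝ) ^ m * t⌋ : ℝ) / 2 ^ m) : ℝ) * Complex.I)) atTop (𝓝 w) := by
    have hcont : Continuous fun s : ℝ => Complex.exp ((2 * Real.pi * s : ℝ) * Complex.I) := by
      fun_prop
    have := (hcont.tendsto t).comp hlim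
    rw [← hwt] at this
    exact this
  obtain ⟨m, hm⟩ := (hlim2.eventually (hU.mem_nhds hw)).exists
  refine ⟨m, _, hm, ?_⟩
  rw [← Complex.exp_nat_mul, Complex.exp_eq_one_iff]
  refine ⟨⌊(2 : ℝ) ^ m * t⌋, ?_⟩
  push_cast
  field_simp

/-- Little Picard theorem. -/
theorem exists_eq_const_of_ne_zero_of_ne_one {f : ℂ → ℂ} (hf : Differentiable ℂ f)
    (h0 : ∀ z, f z ≠ 0) (h1 : ∀ z, f z ≠ 1) : ∃ c, ∀ z, f z = c := by
  by_contra! hnc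
  obtain ⟨L, hL, hLf⟩ := exists_entire_log hf h0
  set g : ℕ → ℂ → ℂ := fun j z => Complex.exp (L z / 2 ^ j) with hg
  have hgf : ∀ j z, g j z ^ 2 ^ j = f z := fun j z => by
    rw [hg, hLf, ← Complex.exp_nat_mul]
    push_cast
    rw [mul_div_cancel₀ _ (pow_ne_zero _ two_ne_zero)]
  have hg0 : ∀ j z, g j z ≠ 0 := fun j z => Complex.exp_ne_zero _
  have hgd : ∀ j, Differentiable ℂ (g j) := fun j => by fun_prop
  obtain ⟨τ, G, hG, hGc⟩ := exists_isProjLimit (fun j z => ![g j z, 1])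
    (fun j => differentiable_pi.2 fun i => by fin_cases i <;> simp [hgd j])
    (fun j z h => by simpa using congrFun h 1)
    (fun j => by
      rintro ⟨c, u, hu, h⟩
      have h3 : ∀ z, u z * c 1 = 1 := fun z => by simpa using (congrFun (h z) 1).symm
      have hc1 : c 1 ≠ 0 := fun h => by simpa [h] using h3 0
      obtain ⟨z, hz⟩ := hnc ((c 0 / c 1) ^ 2 ^ j)
      refine hz ?_
      rw [← hgf j]
      congr 1
      have h2 : g j z = u z * c 0 := by simpa using congrFun (h z) 0
      rw [h2, eq_div_iff hc1, mul_right_comm, h3, one_mul])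
  have hG0 : ∀ z, G z 0 ≠ 0 := by
    refine fun z h => (hG.linear ![1, 0] (Eventually.of_forall fun j z => ?_)).elim
      (fun h2 => h2 z (by simpa using h)) fun h2 => hGc ⟨![0, 1], fun z => G z 1, fun z => ?_⟩
    · simpa using hg0 j (τ j z)
    · ext i
      have := h2 z
      fin_cases i <;> simp_all
  have hG1 : ∀ z, G z 1 ≠ 0 := by
    refine fun z h => (hG.linear ![0, 1] (Eventually.of_forall fun j z => ?_)).elim
      (fun h2 => h2 z (by simpa using h)) fun h2 => hGc ⟨![1, 0], fun z => G z 0, fun z => ?_⟩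
    · simp
    · ext i
      have := h2 z
      fin_cases i <;> simp_all
  have hGω : ∀ (ω : ℂ) (m : ℕ), ω ^ 2 ^ m = 1 → ∀ z, G z 0 / G z 1 ≠ ω := by
    intro ω m hω z h
    rw [div_eq_iff (hG1 z)] at h
    refine (hG.linear ![1, -ω] (hyperfilter_le_atTop ?_)).elim
      (fun h2 => h2 z (by simp [h])) fun h2 => hGc ⟨![ω, 1], fun z => G z 1, fun z => ?_⟩
    · filter_upwards [eventually_ge_atTop m] with j hj z h3
      have h4 : g j (τ j z) = ω := by
        simp at h3
        linear_combination h3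
      refine h1 (τ j z) ?_
      rw [← hgf j, h4, ← Nat.sub_add_cancel hj, pow_add, mul_comm, pow_mul, hω, one_pow]
    · ext i
      have := h2 z
      simp at this
      fin_cases i
      · simp; linear_combination this
      · simp
  have hd := differentiable_pi.1 hG.differentiable
  set p : ℂ → ℂ := fun z => G z 0 / G z 1 with hp
  have hpd : Differentiable ℂ p := (hd 0).div (hd 1) hG1
  have hpc : ¬ ∃ c, ∀ z, p z = c := by
    rintro ⟨c, hc⟩
    refine hGc ⟨![c, 1], fun z => G z 1, fun z => ?_⟩
    ext i
    fin_cases i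
    · have := hc z
      simp only [hp, div_eq_iff (hG1 z)] at this
      simp [this, mul_comm]
    · simp
  have hopen : IsOpen (Set.range p) := by
    rw [← Set.image_univ]
    exact ((AnalyticOnNhd.is_constant_or_isOpenMap fun z _ => hpd.analyticAt z).resolve_left hpc)
      _ isOpen_univ
  have hcirc : ∀ z, ‖p z‖ ≠ 1 := by
    intro z hz
    obtain ⟨m, ω, ⟨y, rfl⟩, hω⟩ := exists_pow_two_pow_eq_one_of_isOpen hopen ⟨z, rfl⟩ hz
    exact hGω _ m hω y rfl
  have hdich : (∀ z, ‖p z‖ ≤ 1) ∨ ∀ z, 1 ≤ ‖p z‖ := by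
    by_contra! hcon
    obtain ⟨⟨a, ha⟩, b, hb⟩ := hcon
    obtain ⟨z, hz⟩ := mem_range_of_exists_le_of_exists_ge hpd.continuous.norm ⟨b, hb.le⟩ ⟨a, ha.le⟩
    exact hcirc z hz
  rcases hdich with hle | hge
  · exact hpc ⟨p 0, fun z => hpd.apply_eq_apply_of_bounded
      (isBounded_iff_forall_norm_le.2 ⟨1, by rintro _ ⟨z, rfl⟩; exact hle z⟩) z 0⟩
  · have hp0 : ∀ z, p z ≠ 0 := fun z => div_ne_zero (hG0 z) (hG1 z)
    have hid : Differentiable ℂ fun z => (p z)⁻¹ := hpd.inv hp0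
    refine hpc ⟨p 0, fun z => inv_injective (hid.apply_eq_apply_of_bounded
      (isBounded_iff_forall_norm_le.2 ⟨1, ?_⟩) z 0)⟩
    rintro _ ⟨z, rfl⟩
    rw [norm_inv]
    exact inv_le_one_of_one_le₀ (hge z)

/-- A pair of entire functions with three omitted ratios is constant. -/
lemma exists_eq_smul_of_ne {w u : ℂ → ℂ} (hw : Differentiable ℂ w) (hu : Differentiable ℂ u)
    {a b c : ℂ} (hab : a ≠ b) (hac : a ≠ c) (hbc : b ≠ c) (ha : ∀ z, w z - a * u z ≠ 0)
    (hb : ∀ z, w z - b * u z ≠ 0) (hc : ∀ z, w z - c * u z ≠ 0) :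
    ∃ (α β : ℂ) (s : ℂ → ℂ), ∀ z, w z = s z * α ∧ u z = s z * β := by
  have hab' := sub_ne_zero.2 hab
  have hac' := sub_ne_zero.2 hac
  have hbc' := sub_ne_zero.2 hbc
  obtain ⟨p, hp⟩ := exists_eq_const_of_ne_zero_of_ne_one
    (f := fun z => (a - b) / (a - c) * (w z - c * u z) / (w z - b * u z))
    (((hw.sub (hu.const_mul c)).const_mul _).div (hw.sub (hu.const_mul b)) hb)
    (fun z => div_ne_zero (mul_ne_zero (div_ne_zero hab' hac') (hc z)) (hb z))
    (fun z h => by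
      rw [div_eq_one_iff_eq (hb z), div_mul_eq_mul_div, div_eq_iff hac'] at h
      refine ha z ((mul_eq_zero.1 (?_ : (b - c) * (w z - a * u z) = 0)).resolve_left hbc')
      linear_combination -h)
  set q := p * (a - c) / (a - b) with hq
  have h1 : ∀ z, w z - c * u z = q * (w z - b * u z) := fun z => by
    have h2 := hp z
    have h3 := hb z
    rw [hq]
    field_simp at h2 ⊢
    linear_combination h2
  have hcb' : c - b ≠ 0 := sub_ne_zero.2 hbc.symm
  refine ⟨1 + b * ((1 - q) / (c - b)), (1 - q) / (c - b), fun z => w z - b * u z, fun z => ?_⟩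
  have h2 : u z = (w z - b * u z) * ((1 - q) / (c - b)) := by
    field_simp
    linear_combination -h1 z
  exact ⟨by linear_combination b * h2, h2⟩

lemma IsBrodyHyperbolicHypersurface.of_injective {p q : ℕ} {F : MvPolynomial (Fin q) ℂ}
    (hF : IsBrodyHyperbolicHypersurface F) {Q : MvPolynomial (Fin p) ℂ}
    {M : (Fin p → ℂ) →ₗ[ℂ] (Fin q → ℂ)} (hM : Function.Injective M)
    (h : ∀ v, eval v Q = 0 → eval (M v) F = 0) : IsBrodyHyperbolicHypersurface Q := by
  intro f hf hf0 hfQ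
  have hd : Differentiable ℂ fun z => M fun i => f i z :=
    (LinearMap.toContinuousLinearMap M).differentiable.comp (differentiable_pi.2 hf)
  obtain ⟨c, u, hu, hcu⟩ := hF (fun i z => M (fun i => f i z) i) (differentiable_pi.1 hd)
    (fun z => by
      obtain ⟨i, hi⟩ := hf0 z
      refine Function.ne_iff.1 (?_ : M (fun i => f i z) ≠ 0)
      rw [Ne, ← map_zero M, hM.eq_iff]
      exact fun h => hi (congrFun h i))
    (fun z => h _ (hfQ z))
  obtain ⟨L, hL⟩ := M.exists_leftInverse_of_injective (LinearMap.ker_eq_bot.2 hM)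
  refine ⟨L c, u, hu, fun i z => ?_⟩
  have h1 : M (fun i => f i z) = u z • c := funext fun i => by simp [hcu, mul_comm]
  have h2 := congrArg L h1
  rw [← LinearMap.comp_apply, hL, map_smul] at h2
  simpa [mul_comm] using congrFun h2 i

lemma eval_eq_zero_of_tendsto {q k : ℕ} {P : ℕ → MvPolynomial (Fin q) ℂ}
    {F : MvPolynomial (Fin q) ℂ} (hP : ∀ j, (P j).IsHomogeneous k) (hF : F.IsHomogeneous k)
    {l : Filter ℕ} [l.NeBot]
    (hlim : ∀ (x : ℕ → Fin q → ℂ) (a : Fin q → ℂ), Tendsto x l (𝓝 a) →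
      Tendsto (fun j => eval (x j) (P j)) l (𝓝 (eval a F)))
    {x : ℕ → Fin q → ℂ} {a : Fin q → ℂ} {i : Fin q} (ha : a i ≠ 0)
    (hx : ∀ m, Tendsto (fun j => x j m / x j i) l (𝓝 (a m / a i)))
    (h0 : ∀ᶠ j in l, eval (x j) (P j) = 0) : eval a F = 0 := by
  have h1 : Tendsto (fun j => (x j i)⁻¹ • x j) l (𝓝 ((a i)⁻¹ • a)) := by
    rw [tendsto_pi_nhds]
    intro m
    simpa [div_eq_inv_mul] using hx m
  have h2 := hlim _ _ h1
  have h3 : eval ((a i)⁻¹ • a) F = 0 := by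
    refine tendsto_nhds_unique h2 (tendsto_const_nhds.congr' ?_)
    filter_upwards [h0] with j hj
    rw [(hP j).eval_smul_eq, hj, mul_zero]
  rw [hF.eval_smul_eq] at h3
  exact (mul_eq_zero.1 h3).resolve_left (pow_ne_zero _ (inv_ne_zero ha))

lemma IsProjLimit.eval_eq_zero {q k : ℕ} {h : ℕ → ℂ → Fin q → ℂ} {G : ℂ → Fin q → ℂ}
    (hG : IsProjLimit h G) {P : ℕ → MvPolynomial (Fin q) ℂ}
    {F : MvPolynomial (Fin q) ℂ} (hP : ∀ j, (P j).IsHomogeneous k) (hF : F.IsHomogeneous k)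
    (hlim : ∀ (x : ℕ → Fin q → ℂ) (a : Fin q → ℂ), Tendsto x (hyperfilter ℕ) (𝓝 a) →
      Tendsto (fun j => eval (x j) (P j)) (hyperfilter ℕ) (𝓝 (eval a F)))
    (h0 : ∀ j z, eval (h j z) (P j) = 0) (z : ℂ) : eval (G z) F = 0 := by
  obtain ⟨i, hi⟩ := Function.ne_iff.1 (hG.ne_zero z)
  obtain ⟨r, hr, h1, h2, h3⟩ := hG.exists_tendstoUniformlyOn z i hi
  exact eval_eq_zero_of_tendsto hP hF hlim hi (fun m => (h3 m).tendsto_at (mem_ball_self hr))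
    (Eventually.of_forall fun j => h0 j z)

lemma tendsto_eval {q : ℕ} (F : MvPolynomial (Fin q) ℂ) {l : Filter ℕ} {x : ℕ → Fin q → ℂ}
    {a : Fin q → ℂ} (hx : Tendsto x l (𝓝 a)) :
    Tendsto (fun j => eval (x j) F) l (𝓝 (eval a F)) :=
  ((continuous_eval_comp F continuous_id).tendsto a).comp hx

/-- Brody hyperbolicity is an open condition. -/
theorem IsBrodyHyperbolicHypersurface.exists_add_smul {q k : ℕ} {F H : MvPolynomial (Fin q) ℂ}
    (hF : IsBrodyHyperbolicHypersurface F) (hFk : F.IsHomogeneous k) (hHk : H.IsHomogeneous k)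
    {ε : ℕ → ℂ} (hε : Tendsto ε atTop (𝓝 0)) :
    ∃ j, IsBrodyHyperbolicHypersurface (F + C (ε j) * H) := by
  by_contra! hcon
  obtain ⟨h, G, hG, hP, hGc⟩ := exists_isProjLimit_of_not_hyperbolic _ hcon
  have hFG := hG.eval_eq_zero (k := k) (F := F)
    (fun j => hFk.add (by simpa using (isHomogeneous_C (Fin q) (ε j)).mul hHk)) hFk
    (fun x a hx => by
      simpa using (tendsto_eval F hx).add
        ((hε.mono_left hyperfilter_le_atTop).mul (tendsto_eval H hx))) hP
  obtain ⟨c, u, -, hcu⟩ := hF (fun i z => G z i) (differentiable_pi.1 hG.differentiable)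
    (fun z => Function.ne_iff.1 (hG.ne_zero z)) hFG
  exact hGc ⟨c, u, fun z => funext fun i => by simp [hcu, mul_comm]⟩

lemma norm_deriv_div_le_projSpeed {q : ℕ} {g : ℂ → Fin q → ℂ} {z : ℂ} (hg : AnalyticAt ℂ g z)
    {i : Fin q} (hi : g z i ≠ 0) (m : Fin q) :
    ‖deriv (fun w => g w m / g w i) z‖ ≤ 2 / ‖lineProj (g z) i i‖ ^ 2 * projSpeed g z := by
  have h0 : g z ≠ 0 := fun h => hi (congrFun h i)
  have hd : HasFDerivAt (fun w => lineProj (g w)) (fderiv ℝ (fun w => lineProj (g w)) z) z :=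
    ((contDiffAt_lineProj_comp hg h0).differentiableAt (by norm_num)).hasFDerivAt
  set D := fderiv ℝ (fun w => lineProj (g w)) z with hD
  have hcomp : ∀ a b, HasDerivAt (fun t : ℝ => lineProj (g (z + t)) a b) (D 1 a b) 0 := by
    intro a b
    have h1 : HasDerivAt (fun t : ℝ => z + (t : ℂ)) 1 0 := by
      simpa using (Complex.ofRealCLM.hasDerivAt (x := (0 : ℝ))).const_add z
    have h2 : HasFDerivAt (fun w => lineProj (g w)) D (z + ((0 : ℝ) : ℂ)) := by simpa using hd
    have h3 := HasFDerivAt.comp_hasDerivAt (0 : ℝ) h2 h1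
    exact hasDerivAt_pi.1 (hasDerivAt_pi.1 h3 a) b
  have hgi : ∀ l, DifferentiableAt ℂ (fun w => g w l) z :=
    differentiableAt_pi.1 hg.differentiableAt
  have hratio : HasDerivAt (fun w => g w m / g w i) (deriv (fun w => g w m / g w i) z) z :=
    ((hgi m).div (hgi i) hi).hasDerivAt
  have hratio' : HasDerivAt (fun t : ℝ => g (z + t) m / g (z + t) i)
      (deriv (fun w => g w m / g w i) z) 0 := by
    have h1 : HasDerivAt (fun w => g (z + w) m / g (z + w) i)
        (deriv (fun w => g w m / g w i) z) ((0 : ℝ) : ℂ) := by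
      have := HasDerivAt.comp_const_add (a := z) (x := ((0 : ℝ) : ℂ))
        (f := fun w => g w m / g w i) (f' := deriv (fun w => g w m / g w i) z)
          (by simpa using hratio)
      exact this
    exact h1.comp_ofReal
  have hPi : lineProj (g z) i i ≠ 0 := by
    rw [lineProj]
    exact div_ne_zero (mul_ne_zero hi (by simpa using hi)) (sum_mul_conj_ne_zero h0)
  have hq := (hcomp m i).div (hcomp i i) (by simpa using hPi)
  have hev : (fun t : ℝ => g (z + t) m / g (z + t) i) =ᶠ[𝓝 0]
      fun t : ℝ => lineProj (g (z + t)) m i / lineProj (g (z + t)) i i := by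
    have hc : ContinuousAt (fun t : ℝ => g (z + t) i) 0 := by
      have h1 : ContinuousAt (fun w => g w i) (z + ((0 : ℝ) : ℂ)) := by
        simpa using (hgi i).continuousAt
      exact ContinuousAt.comp (f := fun t : ℝ => z + (t : ℂ)) h1 (by fun_prop)
    filter_upwards [hc.eventually_ne (by simpa using hi)] with t ht
    rw [lineProj_div ht]
  have heq := (hratio'.congr_of_eventuallyEq hev.symm).unique hq
  rw [heq]
  simp only [Complex.ofReal_zero, add_zero]
  have hDn : ∀ a b, ‖D 1 a b‖ ≤ projSpeed g z := fun a b =>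
    calc ‖D 1 a b‖ ≤ ‖D 1‖ := (norm_le_pi_norm (D 1 a) b).trans (norm_le_pi_norm (D 1) a)
      _ ≤ ‖D‖ * ‖(1 : ℂ)‖ := D.le_opNorm 1
      _ = projSpeed g z := by simp [projSpeed, hD]
  have hs : 0 ≤ projSpeed g z := norm_nonneg _
  rw [norm_div, norm_pow, div_mul_eq_mul_div]
  refine div_le_div_of_nonneg_right ?_ (by positivity)
  calc _ ≤ ‖D 1 m i‖ * ‖lineProj (g z) i i‖ + ‖lineProj (g z) m i‖ * ‖D 1 i i‖ := by
        rw [← norm_mul, ← norm_mul]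
        exact norm_sub_le _ _
    _ ≤ projSpeed g z * 1 + 1 * projSpeed g z := by
        gcongr
        · exact hDn _ _
        · exact norm_lineProj_le _ _ _
        · exact norm_lineProj_le _ _ _
        · exact hDn _ _
    _ = 2 * projSpeed g z := by ring

/-- On a hyperbolic hypersurface, holomorphic discs through a given point have bounded derivative
at that point. -/
theorem IsBrodyHyperbolicHypersurface.not_tendsto_deriv {q k : ℕ} {F : MvPolynomial (Fin q) ℂ}
    (hF : IsBrodyHyperbolicHypersurface F) (hFk : F.IsHomogeneous k) {r : ℝ} (hr : 0 < r)
    {g : ℕ → ℂ → Fin q → ℂ} (hg : ∀ j, DifferentiableOn ℂ (g j) (ball 0 r))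
    (h0 : ∀ j, ∀ z ∈ ball (0 : ℂ) r, g j z ≠ 0) (hgF : ∀ j, ∀ z ∈ ball (0 : ℂ) r, eval
      (g j z) F = 0)
    {p : Fin q → ℂ} (hp : ∀ j, ∃ c : ℂ, c ≠ 0 ∧ g j 0 = c • p) {i m : Fin q} (hpi : p i ≠ 0) :
    ¬ Tendsto (fun j => ‖deriv (fun w => g j w m / g j w i) 0‖) atTop atTop := by
  intro hlim
  have han : ∀ j, AnalyticAt ℂ (g j) 0 := fun j =>
    (hg j).analyticAt (isOpen_ball.mem_nhds (mem_ball_self hr))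
  have hmap : ∀ z ∈ ball (0 : ℂ) 1, (0 : ℂ) + (r : ℝ) * z ∈ ball (0 : ℂ) r := fun z hz => by
    rw [mem_ball_zero_iff] at hz
    rw [zero_add, mem_ball_zero_iff, norm_mul, Complex.norm_real, Real.norm_of_nonneg hr.le]
    nlinarith
  have hp0 : p ≠ 0 := fun h => hpi (congrFun h i)
  set κ := 2 / ‖lineProj p i i‖ ^ 2 with hκ
  have hPi : lineProj p i i ≠ 0 := by
    rw [lineProj]
    exact div_ne_zero (mul_ne_zero hpi (by simpa using hpi)) (sum_mul_conj_ne_zero hp0)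
  have hκ0 : 0 < κ := by positivity
  have hbound : ∀ j, ‖deriv (fun w => g j w m / g j w i) 0‖ ≤ κ * projSpeed (g j) 0 := fun j => by
    obtain ⟨c, hc, hcp⟩ := hp j
    have h1 := norm_deriv_div_le_projSpeed (han j) (i := i) (by simp [hcp, hc, hpi]) m
    rwa [hcp, lineProj_smul hc] at h1
  obtain ⟨τ, G, hτ, hG, hG0, hGc, hl⟩ := exists_brody_limit (fun j z => g j (0 + (r : ℝ) * z))
    (fun j => (hg j).comp (by fun_prop) hmap) (fun j z hz => h0 j _ (hmap z hz)) (by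
      have h1 : ∀ j, projSpeed (fun z => g j (0 + (r : ℝ) * z)) 0 = r * projSpeed (g j) 0 :=
        fun j => by
          rw [projSpeed_comp_affine hr.le (by simpa using han j)
            (by simpa using h0 j 0 (mem_ball_self hr))]
          simp
      simp_rw [h1]
      refine Tendsto.const_mul_atTop hr ?_
      refine tendsto_atTop_mono (fun j => ?_) (hlim.const_mul_atTop (inv_pos.2 hκ0))
      rw [inv_mul_le_iff₀ hκ0]
      exact hbound j)
  have hFG : ∀ z, eval (G z) F = 0 := by
    intro z
    obtain ⟨i, hi⟩ := Function.ne_iff.1 (hG0 z)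
    obtain ⟨ρ, hρ, h1, h2, h3⟩ := hl z i hi
    refine eval_eq_zero_of_tendsto (P := fun _ => F) (fun _ => hFk) hFk
      (fun x a hx => tendsto_eval F hx) hi (fun m => (h3 m).tendsto_at (mem_ball_self hρ)) ?_
    filter_upwards [h1] with j hj
    exact hgF j _ (hmap _ (hj z (mem_ball_self hρ)).1)
  obtain ⟨c, u, -, hcu⟩ := hF (fun i z => G z i) (differentiable_pi.1 hG)
    (fun z => Function.ne_iff.1 (hG0 z)) hFG
  exact hGc ⟨c, u, fun z => funext fun i => by simp [hcu, mul_comm]⟩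

/-- The product of the forms `X_m - ℓ_o(X_0, …, X_{m-1})`, made homogeneous of degree `k`. -/
noncomputable def prodForms {ι : Type*} [Fintype ι] {m : ℕ} (k : ℕ) (ℓ : ι → Fin m → ℂ) :
    MvPolynomial (Fin (m + 1)) ℂ :=
  X (Fin.last m) ^ (k - Fintype.card ι) *
    ∏ o, (X (Fin.last m) - ∑ i, C (ℓ o i) * X i.castSucc)

section prodForms

variable {ι : Type*} [Fintype ι] {m k : ℕ} {ℓ : ι → Fin m → ℂ}

lemma eval_prodForms (v : Fin (m + 1) → ℂ) : eval v (prodForms k ℓ) =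
    v (Fin.last m) ^ (k - Fintype.card ι) *
      ∏ o, (v (Fin.last m) - ∑ i, ℓ o i * v i.castSucc) := by
  simp [prodForms]

lemma isHomogeneous_prodForms (hk : Fintype.card ι ≤ k) : (prodForms k ℓ).IsHomogeneous k := by
  have h1 : (∏ o, (X (Fin.last m) - ∑ i, C (ℓ o i) * X i.castSucc :
      MvPolynomial (Fin (m + 1)) ℂ)).IsHomogeneous (∑ _o : ι, 1) :=
    IsHomogeneous.prod _ _ _ fun o _ => (isHomogeneous_X ℂ _).sub
      (IsHomogeneous.sum _ _ _ fun i _ => by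
        simpa using (isHomogeneous_C (Fin (m + 1)) (ℓ o i)).mul (isHomogeneous_X ℂ i.castSucc))
  have h2 := ((isHomogeneous_X ℂ (Fin.last m)).pow (k - Fintype.card ι)).mul h1
  have h3 : 1 * (k - Fintype.card ι) + ∑ _o : ι, 1 = k := by
    rw [one_mul, Finset.sum_const, smul_eq_mul, mul_one, Finset.card_univ]
    omega
  rwa [h3] at h2

end prodForms

/-- A deformation of `d {F = 0}` inside the cone over `{F = 0}`. -/
noncomputable def conePerturbation {m : ℕ} (d k : ℕ) (F : MvPolynomial (Fin m) ℂ)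
    (A : MvPolynomial (Fin (m + 1)) ℂ) (ε : ℂ) : MvPolynomial (Fin (m + 1)) ℂ :=
  rename Fin.castSucc F ^ (d - 1) * (rename Fin.castSucc F + C ε * A) +
    C (ε ^ (d + 1)) * X (Fin.last m) ^ (d * k)

lemma eval_conePerturbation {m d k : ℕ} {F : MvPolynomial (Fin m) ℂ}
    {A : MvPolynomial (Fin (m + 1)) ℂ} {ε : ℂ} (v : Fin (m + 1) → ℂ) :
    eval v (conePerturbation d k F A ε) = eval (v ∘ Fin.castSucc) F ^ (d - 1) *
      (eval (v ∘ Fin.castSucc) F + ε * eval v A) + ε ^ (d + 1) * v (Fin.last m) ^ (d * k) := by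
  simp [conePerturbation, eval_rename]

lemma isHomogeneous_conePerturbation {m d k : ℕ} (hd : 1 ≤ d) {F : MvPolynomial (Fin m) ℂ}
    (hF : F.IsHomogeneous k) {A : MvPolynomial (Fin (m + 1)) ℂ} (hA : A.IsHomogeneous k) (ε : ℂ) :
    (conePerturbation d k F A ε).IsHomogeneous (d * k) := by
  have hF' : (rename Fin.castSucc F).IsHomogeneous k := hF.rename_isHomogeneous
  have hC : ∀ (c : ℂ) {p : MvPolynomial (Fin (m + 1)) ℂ} {l : ℕ}, p.IsHomogeneous l →
      (C c * p).IsHomogeneous l := fun c p l hp => by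
    simpa using (isHomogeneous_C (Fin (m + 1)) c).mul hp
  refine IsHomogeneous.add ?_ (hC _ ?_)
  · have := (hF'.pow (d - 1)).mul (hF'.add (hC ε hA))
    convert this using 1
    obtain ⟨e, rfl⟩ := Nat.exists_eq_add_of_le' hd
    simp; ring
  · simpa using (isHomogeneous_X ℂ (Fin.last m)).pow (d * k)

lemma norm_le_of_pow_mul_add_eq {y a ε : ℂ} {d : ℕ} (hε : ‖ε‖ ≤ 1)
    (h : y ^ d * (y + a) = -ε) : ‖y‖ ≤ ‖a‖ + 1 := by
  by_contra! hcon
  have h1 : 1 < ‖y + a‖ := by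
    have := norm_sub_norm_le y (-a)
    rw [norm_neg, sub_neg_eq_add] at this
    linarith
  have h2 : 1 ≤ ‖y‖ ^ d := one_le_pow₀ (by linarith [norm_nonneg a])
  have h3 := congrArg norm h
  rw [norm_mul, norm_pow, norm_neg] at h3
  nlinarith

lemma exists_norm_eval_le {σ : Type*} [Fintype σ] (A : MvPolynomial σ ℂ) (B : ℝ) :
    ∃ M, ∀ v : σ → ℂ, ‖v‖ ≤ B → ‖eval v A‖ ≤ M := by
  obtain ⟨M, hM⟩ := (isCompact_closedBall (0 : σ → ℂ) B).exists_bound_of_continuousOn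
    (continuous_eval_comp A continuous_id).continuousOn
  exact ⟨M, fun v hv => hM v (by simpa using hv)⟩

lemma differentiableOn_eval_comp {σ : Type*} [Fintype σ] (A : MvPolynomial σ ℂ) {g : ℂ → σ → ℂ}
    {s : Set ℂ} (hg : DifferentiableOn ℂ g s) : DifferentiableOn ℂ (fun z => eval (g z) A) s := by
  have := differentiableOn_pi.1 hg
  induction A using MvPolynomial.induction_on with
  | C a => simp
  | add p q hp hq => simpa using hp.fun_add hq
  | mul_X p i hp => simpa using hp.fun_mul (this i)

/-- A limit of entire curves on the cone perturbations can cross the zero set of `A` outside of the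
hyperplane at infinity only by lying in it. -/
theorem eventually_eval_eq_zero_of_isProjLimit {m d k : ℕ} (hd : 2 ≤ d) {F : MvPolynomial (Fin m) ℂ}
    (hF : F.IsHomogeneous k) {A : MvPolynomial (Fin (m + 1)) ℂ} (hA : A.IsHomogeneous k)
    {ε : ℕ → ℂ} (hε0 : ∀ j, ε j ≠ 0) (hε : Tendsto ε atTop (𝓝 0))
    {h : ℕ → ℂ → Fin (m + 1) → ℂ} {G : ℂ → Fin (m + 1) → ℂ} (hG : IsProjLimit h G)
    (hP : ∀ j z, eval (h j z) (conePerturbation d k F A (ε j)) = 0) {t : ℂ}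
    (ht : eval (G t) A = 0) (hw : G t (Fin.last m) ≠ 0) :
    ∀ᶠ z in 𝓝 t, eval (G z) A = 0 := by
  obtain ⟨r, hr, h1, h2, h3⟩ := hG.exists_tendstoUniformlyOn t _ hw
  set ψ : ℕ → ℂ → Fin (m + 1) → ℂ := fun j z => (h j z (Fin.last m))⁻¹ • h j z with hψ
  set Ψ : ℂ → Fin (m + 1) → ℂ := fun z => (G z (Fin.last m))⁻¹ • G z with hΨ
  have hψlim : ∀ l, TendstoUniformlyOn (fun j z => ψ j z l) (fun z => Ψ z l) (hyperfilter ℕ)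
      (ball t r) := fun l => by
    simpa [hψ, hΨ, div_eq_inv_mul] using h3 l
  have hψd : ∀ᶠ j in (hyperfilter ℕ : Filter ℕ), DifferentiableOn ℂ (ψ j) (ball t r) := by
    filter_upwards [h1] with j hj
    have h4 := fun l => (differentiable_pi.1 (hG.differentiable_seq j) l).differentiableOn
      (s := ball t r)
    exact ((h4 _).inv hj).smul (hG.differentiable_seq j).differentiableOn
  have hΨd : DifferentiableOn ℂ Ψ (ball t r) := by
    have h4 := fun l => (differentiable_pi.1 hG.differentiable l).differentiableOn (s := ball t r)
    exact ((h4 _).inv h2).smul hG.differentiable.differentiableOn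
  have hsub : ball t (r / 2) ⊆ ball t r := ball_subset_ball (by linarith)
  have hsub' : ball t (r / 2 / 2) ⊆ ball t (r / 2) := ball_subset_ball (by linarith)
  obtain ⟨B, hB⟩ : ∃ B, ∀ᶠ j in (hyperfilter ℕ : Filter ℕ), ∀ z ∈ ball t (r / 2), ‖ψ j z‖ ≤ B := by
    obtain ⟨B, hB⟩ := (isCompact_closedBall t (r / 2)).exists_bound_of_continuousOn
      (hΨd.continuousOn.mono (closedBall_subset_ball (by linarith)))
    refine ⟨B + 1, ?_⟩
    have h4 := fun l => Metric.tendstoUniformlyOn_iff.1 (hψlim l) 1 one_pos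
    filter_upwards [eventually_all.2 h4] with j hj z hz
    have hBz := hB z (ball_subset_closedBall hz)
    refine (pi_norm_le_iff_of_nonneg (by linarith [norm_nonneg (Ψ z)])).2 fun l => ?_
    have h5 := hj l z (hsub hz)
    rw [dist_comm, dist_eq_norm] at h5
    have h6 := norm_sub_norm_le (ψ j z l) (Ψ z l)
    have h7 := norm_le_pi_norm (Ψ z) l
    linarith
  obtain ⟨M, hM⟩ := exists_norm_eval_le A B
  set a : ℕ → ℂ → ℂ := fun j z => eval (ψ j z) A with ha
  have haM : ∀ᶠ j in (hyperfilter ℕ : Filter ℕ), DifferentiableOn ℂ (a j) (ball t (r / 2)) ∧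
      ∀ z ∈ ball t (r / 2), ‖a j z‖ ≤ M := by
    filter_upwards [hB, hψd] with j hj hj'
    exact ⟨differentiableOn_eval_comp A (hj'.mono hsub), fun z hz => hM _ (hj z hz)⟩
  obtain ⟨α, hα⟩ := exists_tendstoUniformlyOn_of_norm_le (by positivity) haM
  have hαA : ∀ z ∈ ball t (r / 2 / 2), α z = eval (Ψ z) A := fun z hz => by
    refine tendsto_nhds_unique (hα.tendsto_at hz) (tendsto_eval A (tendsto_pi_nhds.2 fun l => ?_))
    exact (hψlim l).tendsto_at (hsub (hsub' hz))
  set y : ℕ → ℂ → ℂ := fun j z => eval (ψ j z ∘ Fin.castSucc) F / ε j with hy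
  have hrel : ∀ᶠ j in (hyperfilter ℕ : Filter ℕ), ∀ z ∈ ball t r,
      y j z ^ (d - 1) * (y j z + a j z) = - ε j := by
    filter_upwards [h1] with j hj z hz
    have h4 : eval (ψ j z) (conePerturbation d k F A (ε j)) = 0 := by
      rw [hψ, (isHomogeneous_conePerturbation (by omega) hF hA (ε j)).eval_smul_eq, hP, mul_zero]
    have h5 : ψ j z (Fin.last m) = 1 := by simp [hψ, hj z hz]
    rw [eval_conePerturbation, h5, one_pow, mul_one] at h4
    have h6 : eval (ψ j z ∘ Fin.castSucc) F = ε j * y j z := by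
      rw [hy, mul_div_cancel₀ _ (hε0 j)]
    rw [h6] at h4
    obtain ⟨e, rfl⟩ := Nat.exists_eq_add_of_le' hd
    simp only [Nat.add_succ_sub_one] at h4 ⊢
    have h7 : ε j ^ (e + 1 + 1) * (y j z ^ (e + 1) * (y j z + a j z) + ε j) = 0 := by
      linear_combination h4
    exact eq_neg_of_add_eq_zero_left ((mul_eq_zero.1 h7).resolve_left (pow_ne_zero _ (hε0 j)))
  have hyM : ∀ᶠ j in (hyperfilter ℕ : Filter ℕ), DifferentiableOn ℂ (y j) (ball t (r / 2)) ∧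
      ∀ z ∈ ball t (r / 2), ‖y j z‖ ≤ M + 1 := by
    have h4 : ∀ᶠ j in (hyperfilter ℕ : Filter ℕ), ‖ε j‖ ≤ 1 := hyperfilter_le_atTop <| by
      filter_upwards [hε.norm.eventually (gt_mem_nhds (by simp : ‖(0 : ℂ)‖ < 1))] with j hj
      exact hj.le
    filter_upwards [hψd, hrel, haM, h4] with j hj1 hj2 hj3 hj4
    refine ⟨(differentiableOn_eval_comp F (g := fun z => ψ j z ∘ Fin.castSucc)
      (differentiableOn_pi.2 fun l => (differentiableOn_pi.1 (hj1.mono hsub) _))).div_const _,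
      fun z hz => ?_⟩
    exact (norm_le_of_pow_mul_add_eq hj4 (hj2 z (hsub hz))).trans (by linarith [hj3.2 z hz])
  obtain ⟨η, hη⟩ := exists_tendstoUniformlyOn_of_norm_le (by positivity) hyM
  have htm : t ∈ ball t (r / 2 / 2) := mem_ball_self (by positivity)
  have hα0 : α t = 0 := by rw [hαA t htm, hΨ, hA.eval_smul_eq, ht, mul_zero]
  have hη0 : η t = 0 := by
    have h4 := (((hη.tendsto_at htm).pow (d - 1)).mul
      ((hη.tendsto_at htm).add (hα.tendsto_at htm)))
    have h5 : Tendsto (fun j => -ε j) (hyperfilter ℕ) (𝓝 0) := by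
      simpa using (hε.mono_left hyperfilter_le_atTop).neg
    have h6 := tendsto_nhds_unique h4 (h5.congr' (by
      filter_upwards [hrel] with j hj
      exact (hj t (mem_ball_self hr)).symm))
    rw [hα0, add_zero, ← pow_succ] at h6
    exact eq_zero_of_pow_eq_zero h6
  have hη1 := hurwitz (by positivity) (hyM.mono fun j hj => hj.1.mono hsub') (by
    filter_upwards [hrel] with j hj z hz h4
    have h5 := hj z (hsub (hsub' hz))
    rw [h4, zero_pow (by omega), zero_mul] at h5
    exact hε0 j (neg_eq_zero.1 h5.symm)) hη hη0
  have hη2 := hurwitz (f := fun j z => y j z + a j z) (φ := fun z => η z + α z) (by positivity)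
    ((hyM.and haM).mono fun j hj => (hj.1.1.add hj.2.1).mono hsub') (by
    filter_upwards [hrel] with j hj z hz h4
    have h5 := hj z (hsub (hsub' hz))
    rw [h4, mul_zero] at h5
    exact hε0 j (neg_eq_zero.1 h5.symm)) (hη.add hα) (by rw [hη0, hα0, add_zero])
  filter_upwards [hη1, hη2, isOpen_ball.mem_nhds htm] with z hz1 hz2 hz3
  rw [hz1, zero_add, hαA z hz3, hΨ, hA.eval_smul_eq] at hz2
  exact (mul_eq_zero.1 hz2).resolve_left
    (pow_ne_zero _ (inv_ne_zero (h2 z (hsub (hsub' hz3)))))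

/-- If the values of finitely many linear forms at every zero of `F` include three distinct nonzero
ones, then the cone over `{F = 0}`, with multiplicity `d`, has a hyperbolic deformation. -/
theorem exists_hyperbolic_of_forms {m k d : ℕ} (hk : 1 ≤ k) (hd : 2 ≤ d)
    {F : MvPolynomial (Fin m) ℂ} (hFk : F.IsHomogeneous k) (hF : IsBrodyHyperbolicHypersurface F)
    {ι : Type*} [Fintype ι] (ℓ : ι → Fin m → ℂ) (hι : Fintype.card ι ≤ k)
    (hℓ : ∀ c : Fin m → ℂ, c ≠ 0 → eval c F = 0 → ∃ a : Fin 3 → ι,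
      Function.Injective (fun s => ∑ i, ℓ (a s) i * c i) ∧ ∀ s, ∑ i, ℓ (a s) i * c i ≠ 0) :
    ∃ P : MvPolynomial (Fin (m + 1)) ℂ, P ≠ 0 ∧ P.IsHomogeneous (d * k) ∧
      IsBrodyHyperbolicHypersurface P := by
  set A := prodForms k ℓ with hA
  have hAk : A.IsHomogeneous k := isHomogeneous_prodForms hι
  set ε : ℕ → ℂ := fun j => 1 / ((j : ℂ) + 1) with hε
  have hε0 : ∀ j, ε j ≠ 0 := fun j => one_div_ne_zero (Nat.cast_add_one_ne_zero j)
  have hεlim : Tendsto ε atTop (𝓝 0) := tendsto_one_div_add_atTop_nhds_zero_nat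
  have hhom := fun j => isHomogeneous_conePerturbation (d := d) (by omega) hFk hAk (ε j)
  have hFz : eval (0 : Fin m → ℂ) F = 0 := by
    have := hFk.eval_smul_eq 0 0
    rwa [zero_smul, zero_pow (by omega), zero_mul] at this
  by_contra! hcon
  obtain ⟨h, G, hG, hP, hGc⟩ := exists_isProjLimit_of_not_hyperbolic
    (fun j => conePerturbation d k F A (ε j)) (fun j => hcon _ (fun h0 => by
      have h1 := eval_conePerturbation (d := d) (k := k) (F := F) (A := A) (ε := ε j)
        (Pi.single (Fin.last m) 1)
      have h2 : (Pi.single (Fin.last m) (1 : ℂ) : Fin (m + 1) → ℂ) ∘ Fin.castSucc = 0 := by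
        ext i
        simp [Fin.castSucc_ne_last]
      rw [h0, h2, hFz, zero_pow (by omega), zero_mul, zero_add] at h1
      simp only [map_zero, Pi.single_eq_same, one_pow, mul_one] at h1
      exact pow_ne_zero _ (hε0 j) h1.symm) (hhom j))
  have hFG : ∀ z, eval (G z ∘ Fin.castSucc) F = 0 := by
    intro z
    have h1 := hG.eval_eq_zero (k := d * k) (F := rename Fin.castSucc F ^ d)
      hhom (by
        have := (hFk.rename_isHomogeneous (f := Fin.castSucc)).pow d
        rwa [mul_comm] at this)
      (fun x a hx => by
        have h1 : Tendsto (fun j => x j ∘ Fin.castSucc) (hyperfilter ℕ) (𝓝 (a ∘ Fin.castSucc)) :=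
          tendsto_pi_nhds.2 fun l => tendsto_pi_nhds.1 hx _
        have h2 := tendsto_eval F h1
        have h3 := hεlim.mono_left hyperfilter_le_atTop
        have h4 := ((h2.pow (d - 1)).mul (h2.add (h3.mul (tendsto_eval A hx)))).add
          ((h3.pow (d + 1)).mul ((tendsto_pi_nhds.1 hx (Fin.last m)).pow (d * k)))
        simp_rw [eval_conePerturbation]
        convert h4 using 2
        rw [map_pow, eval_rename, zero_mul, add_zero, zero_pow (by omega), zero_mul, add_zero,
          ← pow_succ, Nat.sub_add_cancel (by omega)]) hP z
    rw [map_pow, eval_rename] at h1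
    exact eq_zero_of_pow_eq_zero h1
  have hGd := differentiable_pi.1 hG.differentiable
  have hdec : ∀ (c : Fin m → ℂ) (α : ℂ) (z s : ℂ), G z ∘ Fin.castSucc = s • c →
      G z (Fin.last m) = s * α → G z = s • (Fin.snoc c α : Fin (m + 1) → ℂ) := by
    intro c α z s h1 h2
    funext i
    refine Fin.lastCases ?_ (fun i => ?_) i
    · simpa using h2
    · simpa using congrFun h1 i
  have hU0 : ∃ z, G z ∘ Fin.castSucc ≠ 0 := by
    by_contra! hU
    exact hGc ⟨Fin.snoc (0 : Fin m → ℂ) 1, fun z => G z (Fin.last m), fun z =>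
      hdec 0 1 z _ (by rw [hU z, smul_zero]) (by rw [mul_one])⟩
  obtain ⟨c, u, hc0, hFc, hu, hcu⟩ := hF.exists_eq_smul (g := fun z => G z ∘ Fin.castSucc) hFk
    (differentiable_pi.2 fun i => hGd _) hU0 hFG
  have hev : ∀ z, eval (G z) A = G z (Fin.last m) ^ (k - Fintype.card ι) *
      ∏ o, (G z (Fin.last m) - (∑ i, ℓ o i * c i) * u z) := by
    intro z
    rw [hA, eval_prodForms]
    congr 1
    refine Finset.prod_congr rfl fun o _ => ?_
    rw [Finset.sum_mul]
    congr 1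
    refine Finset.sum_congr rfl fun i _ => ?_
    have := congrFun (hcu z) i
    simp only [Function.comp_apply, Pi.smul_apply, smul_eq_mul] at this
    rw [this]; ring
  have hne : ∀ o, ∑ i, ℓ o i * c i ≠ 0 → ∀ z, G z (Fin.last m) - (∑ i, ℓ o i * c i) * u z ≠ 0 := by
    intro o ho t ht
    have hu0 : u t ≠ 0 := fun h0 => by
      refine hG.ne_zero t ?_
      rw [hdec c 0 t (u t) (hcu t) (by rw [mul_zero]; simpa [h0] using ht), h0, zero_smul]
    have hw : G t (Fin.last m) ≠ 0 := by
      rw [sub_eq_zero.1 ht]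
      exact mul_ne_zero ho hu0
    have h1 := eventually_eval_eq_zero_of_isProjLimit hd hFk hAk hε0 hεlim hG hP (t := t)
      (by rw [hev, Finset.prod_eq_zero (Finset.mem_univ o) ht, mul_zero]) hw
    have h2 : ∃ᶠ z in 𝓝[≠] t, ∃ o, G z (Fin.last m) - (∑ i, ℓ o i * c i) * u z = 0 := by
      refine Eventually.frequently ?_
      have h3 : ∀ᶠ z in 𝓝 t, G z (Fin.last m) ≠ 0 :=
        (hGd (Fin.last m)).continuous.continuousAt.eventually_ne hw
      filter_upwards [nhdsWithin_le_nhds h1, nhdsWithin_le_nhds h3] with z hz hz'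
      rw [hev] at hz
      obtain ⟨o, -, ho⟩ := Finset.prod_eq_zero_iff.1
        ((mul_eq_zero.1 hz).resolve_left (pow_ne_zero _ hz'))
      exact ⟨o, ho⟩
    rw [frequently_exists] at h2
    obtain ⟨o', ho'⟩ := h2
    have h3 : ∀ z, G z (Fin.last m) - (∑ i, ℓ o' i * c i) * u z = 0 := fun z =>
      congrFun (AnalyticOnNhd.eq_of_frequently_eq
        (f := fun z => G z (Fin.last m) - (∑ i, ℓ o' i * c i) * u z) (g := fun _ => 0)
        (fun z _ => Differentiable.analyticAt ((hGd _).sub (hu.const_mul _)) z)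
        (fun z _ => analyticAt_const) ho') z
    exact hGc ⟨Fin.snoc c (∑ i, ℓ o' i * c i), u, fun z => hdec _ _ z _ (hcu z) (by
      linear_combination h3 z)⟩
  obtain ⟨a, hinj, ha⟩ := hℓ c hc0 hFc
  obtain ⟨α, β, s, hs⟩ := exists_eq_smul_of_ne (hGd (Fin.last m)) hu
    (hinj.ne (by decide : (0 : Fin 3) ≠ 1)) (hinj.ne (by decide : (0 : Fin 3) ≠ 2))
    (hinj.ne (by decide : (1 : Fin 3) ≠ 2)) (hne _ (ha 0)) (hne _ (ha 1)) (hne _ (ha 2))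
  exact hGc ⟨Fin.snoc (β • c) α, s, fun z => hdec _ _ z _
    (by rw [hcu, (hs z).2, smul_smul]) (hs z).1⟩

lemma eval_bind₁ {σ τ : Type*} (g : σ → MvPolynomial τ ℂ) (F : MvPolynomial σ ℂ) (v : τ → ℂ) :
    eval v (bind₁ g F) = eval (fun i => eval v (g i)) F :=
  eval₂Hom_bind₁ _ _ _ _

/-- A polynomial pulls back under a generic linear change of coordinates to one not vanishing at
finitely many given nonzero points. -/
lemma exists_linear_eval_ne_zero {m : ℕ} {F : MvPolynomial (Fin m) ℂ} (hF : ∃ x,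
    x ≠ 0 ∧ eval x F ≠ 0)
    {N : Set (Fin m → ℂ)} (hN : N.Finite) (hN0 : ∀ v ∈ N, v ≠ 0) :
    ∃ M : Matrix (Fin m) (Fin m) ℂ, M.det ≠ 0 ∧ ∀ v ∈ N, eval (M.mulVec v) F ≠ 0 := by
  obtain ⟨x, hx0, hx⟩ := hF
  set Q : (Fin m → ℂ) → MvPolynomial (Fin m × Fin m) ℂ := fun v =>
    bind₁ (fun i => ∑ j, X (i, j) * C (v j)) F with hQ
  have hQe : ∀ v (M : Matrix (Fin m) (Fin m) ℂ), eval (fun p => M p.1 p.2) (Q v) =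
      eval (M.mulVec v) F := by
    intro v M
    rw [hQ, eval_bind₁]
    congr 2
    funext i
    simp [Matrix.mulVec, dotProduct]
  have hprod : Matrix.det (Matrix.mvPolynomialX (Fin m) (Fin m) ℂ) * ∏ v ∈ hN.toFinset, Q v ≠ 0 :=
      by
    refine mul_ne_zero (Matrix.det_mvPolynomialX_ne_zero _ _)
        (Finset.prod_ne_zero_iff.2 fun v hv h0 => ?_)
    obtain ⟨i, hi⟩ := Function.ne_iff.1 (hN0 v (hN.mem_toFinset.1 hv))
    have h1 := hQe v (Matrix.of fun a b => if b = i then x a / v i else 0)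
    rw [h0, map_zero] at h1
    refine hx ?_
    rw [h1]
    congr 2
    funext a
    have hi' : v i ≠ 0 := hi
    simp [Matrix.mulVec, dotProduct, hi']
  obtain ⟨M, hM⟩ : ∃ M : Fin m × Fin m → ℂ, eval M
      (Matrix.det (Matrix.mvPolynomialX (Fin m) (Fin m) ℂ) * ∏ v ∈ hN.toFinset, Q v) ≠ 0 := by
    by_contra! hcon
    exact hprod (MvPolynomial.funext fun M => by rw [hcon, map_zero])
  rw [map_mul, map_prod] at hM
  refine ⟨Matrix.of fun a b => M (a, b), ?_, fun v hv => ?_⟩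
  · have := left_ne_zero_of_mul hM
    rwa [Matrix.eval_det_mvPolynomialX] at this
  · have := Finset.prod_ne_zero_iff.1 (right_ne_zero_of_mul hM) v (hN.mem_toFinset.2 hv)
    rw [← hQe]
    exact this


/-- The finite set of possible ratios of two nonzero values of the forms `x_j`, `2 ∑ x_j` at a
point where these forms have only two nonzero values. -/
noncomputable def exceptionalRatios (m : ℕ) : Finset ℂ :=
  {0, 1} ∪ (Finset.range (m + 1) ×ˢ Finset.range (m + 1)).biUnion fun p : ℕ × ℕ =>
    ({-(p.1 : ℂ) / p.2, (1 - 2 * (p.1 : ℂ)) / (2 * p.2), 2 * (p.1 : ℂ) / (1 - 2 * p.2)} : Finset ℂ)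

lemma exists_three_values {m : ℕ} {c : Fin m → ℂ} (hc : c ≠ 0)
    (h : ∀ (α : ℂ) (v : Fin m → ℂ), α ≠ 0 → v ≠ 0 → (∀ i, v i ∈ exceptionalRatios m) →
      c ≠ α • v) :
    ∃ a : Fin 3 → Option (Fin m), Function.Injective (fun s => ((a s).elim (2 * ∑ i, c i) c)) ∧
      ∀ s, (a s).elim (2 * ∑ i, c i) c ≠ 0 := by
  obtain ⟨i, hi⟩ := Function.ne_iff.1 hc
  have hi : c i ≠ 0 := hi
  set f : Option (Fin m) → ℂ := fun o => o.elim (2 * ∑ i, c i) c with hf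
  suffices H : ∃ j o, f j ≠ 0 ∧ f j ≠ c i ∧ f o ≠ 0 ∧ f o ≠ c i ∧ f o ≠ f j by
    obtain ⟨j, o, h1, h2, h3, h4, h5⟩ := H
    refine ⟨![some i, j, o], fun s t hst => ?_, fun s => ?_⟩
    · change f _ = f _ at hst
      have h6 : f (some i) = c i := rfl
      fin_cases s <;> fin_cases t <;> first | rfl | (exfalso; simp_all)
    · change f _ ≠ 0
      fin_cases s
      · exact hi
      · exact h1
      · exact h3
  by_contra! hcon
  set v : Fin m → ℂ := fun l => c l / c i with hv
  have hcv : c = c i • v := funext fun l => by simp [hv, mul_div_cancel₀ _ hi]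
  have hvi : v i = 1 := div_self hi
  refine h (c i) v hi (fun h0 => one_ne_zero (hvi ▸ congrFun h0 i)) ?_ hcv
  by_cases hall : ∀ l, v l = 0 ∨ v l = 1
  · intro l
    rcases hall l with h1 | h1 <;> simp [h1, exceptionalRatios]
  push Not at hall
  obtain ⟨j, hj0, hj1⟩ := hall
  set ρ := v j with hρ
  have hcl : ∀ l, c l = c i * v l := fun l => congrFun hcv l
  have hval : ∀ l, v l = 0 ∨ v l = 1 ∨ v l = ρ := by
    intro l
    by_contra! h1
    refine h1.2.2 ?_
    have h2 := hcon (some j) (some l) (by simp [hf, hcl j, hi, ← hρ, hj0]) (by simp [hf, hcl j,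
        hi, ← hρ, hj1])
      (by simp [hf, hcl l, hi, h1.1]) (by simp [hf, hcl l, hi, h1.2.1])
    simp only [hf, Option.elim_some] at h2
    simp [hv, hρ, h2]
  have hs : 2 * ∑ l, v l = 0 ∨ 2 * ∑ l, v l = 1 ∨ 2 * ∑ l, v l = ρ := by
    have hsum : f none = c i * (2 * ∑ l, v l) := by
      simp only [hf, Option.elim_none]
      rw [Finset.sum_congr rfl fun l _ => hcl l, ← Finset.mul_sum]
      ring
    by_contra! h1
    refine h1.2.2 ?_
    have h2 := hcon (some j) none (by simp [hf, hcl j, hi, ← hρ, hj0]) (by simp [hf, hcl j, hi,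
        ← hρ, hj1])
      (by rw [hsum]; exact mul_ne_zero hi h1.1)
      (by rw [hsum]; exact fun h2 => h1.2.1 (by rwa [mul_eq_left₀ hi] at h2))
    rw [hsum] at h2
    exact mul_left_cancel₀ hi (by rw [h2]; exact hcl j)
  set a := (Finset.univ.filter fun l => v l = 1).card with ha
  set b := (Finset.univ.filter fun l => v l = ρ).card with hb
  have hsum : ∑ l, v l = a + b * ρ := by
    have h1 : ∀ l, v l = (if v l = 1 then 1 else 0) + (if v l = ρ then 1 else 0) * ρ := by
      intro l
      rcases hval l with h2 | h2 | h2
      · rw [h2, if_neg zero_ne_one, if_neg hj0.symm]; simp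
      · rw [h2, if_pos rfl, if_neg hj1.symm]; simp
      · rw [h2, if_neg hj1, if_pos rfl]; simp
    rw [Finset.sum_congr rfl fun l _ => h1 l, Finset.sum_add_distrib, ← Finset.sum_mul,
      Finset.sum_boole, Finset.sum_boole]
  have hab : a ∈ Finset.range (m + 1) ∧ b ∈ Finset.range (m + 1) := by
    have h1 := fun p : Fin m → Prop => fun _ : DecidablePred p =>
      Finset.card_le_univ (Finset.univ.filter p)
    simp only [Fintype.card_fin] at h1
    exact ⟨Finset.mem_range_succ_iff.2 (h1 _ _), Finset.mem_range_succ_iff.2 (h1 _ _)⟩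
  have hb0 : (b : ℂ) ≠ 0 := by
    rw [Nat.cast_ne_zero, hb, Finset.card_ne_zero]
    exact ⟨j, by simp [hρ]⟩
  have h2b : (1 : ℂ) - 2 * b ≠ 0 := by
    intro h1
    have h2 : ((2 * b : ℕ) : ℂ) = ((1 : ℕ) : ℂ) := by
      push_cast
      linear_combination -h1
    rw [Nat.cast_inj] at h2
    omega
  have hρmem : ρ ∈ exceptionalRatios m := by
    refine Finset.mem_union_right _ (Finset.mem_biUnion.2 ⟨(a, b), Finset.mem_product.2 hab, ?_⟩)
    simp only [Finset.mem_insert, Finset.mem_singleton]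
    rw [hsum] at hs
    rcases hs with h1 | h1 | h1
    · left
      rw [eq_div_iff hb0]
      linear_combination (1 / 2) * h1
    · right; left
      rw [eq_div_iff (mul_ne_zero two_ne_zero hb0)]
      linear_combination h1
    · right; right
      rw [eq_div_iff h2b]
      linear_combination -h1
  intro l
  rcases hval l with h1 | h1 | h1
  · simp [h1, exceptionalRatios]
  · simp [h1, exceptionalRatios]
  · rwa [h1]

/-- Hyperbolic hypersurfaces of large degree deform cones. -/
theorem exists_hyperbolic_of_le_degree {m k d : ℕ} (hm : m + 1 ≤ k) (hd : 2 ≤ d)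
    {F : MvPolynomial (Fin m) ℂ} (hF0 : F ≠ 0) (hFk : F.IsHomogeneous k)
    (hF : IsBrodyHyperbolicHypersurface F) :
    ∃ P : MvPolynomial (Fin (m + 1)) ℂ, P ≠ 0 ∧ P.IsHomogeneous (d * k) ∧
      IsBrodyHyperbolicHypersurface P := by
  have hx : ∃ x, x ≠ 0 ∧ eval x F ≠ 0 := by
    obtain ⟨x, hx⟩ : ∃ x, eval x F ≠ 0 := by
      by_contra! hcon
      exact hF0 (MvPolynomial.funext fun x => by rw [hcon, map_zero])
    refine ⟨x, fun h0 => hx ?_, hx⟩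
    have := hFk.eval_smul_eq 0 x
    rwa [zero_smul, zero_pow (by omega), zero_mul, ← h0] at this
  obtain ⟨M, hM, hMN⟩ := exists_linear_eval_ne_zero hx
    (N := {v | (∀ i, v i ∈ exceptionalRatios m) ∧ v ≠ 0})
    ((Set.Finite.pi' fun _ : Fin m => (exceptionalRatios m).finite_toSet).subset
      fun v hv i => hv.1 i) (fun v hv => hv.2)
  set F' : MvPolynomial (Fin m) ℂ := bind₁ (fun i => ∑ j, C (M i j) * X j) F with hF'
  have hF'e : ∀ v, eval v F' = eval (M.mulVec v) F := fun v => by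
    rw [hF', eval_bind₁]
    congr 2
    funext i
    simp [Matrix.mulVec, dotProduct]
  have hF'k : F'.IsHomogeneous k := by
    have := hFk.aeval (S := ℂ) (n := 1) (fun i => ∑ j, C (M i j) * X j) fun i =>
      IsHomogeneous.sum _ _ _ fun j _ => by
        simpa using (isHomogeneous_C (Fin m) (M i j)).mul (isHomogeneous_X ℂ j)
    simpa using this
  have hF'h : IsBrodyHyperbolicHypersurface F' :=
    hF.of_injective (M := M.mulVecLin) (by
      rw [Matrix.coe_mulVecLin]
      exact Matrix.mulVec_injective_of_det_ne_zero hM)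
      fun v hv => by
        rw [hF'e] at hv
        exact hv
  refine exists_hyperbolic_of_forms (by omega) hd hF'k hF'h
    (fun o : Option (Fin m) => o.elim (fun _ => 2) (fun j => Pi.single j 1)) (by simpa using hm)
    fun c hc hFc => ?_
  obtain ⟨a, ha, ha0⟩ := exists_three_values hc fun α v hα hv hvm hcv => by
    refine hMN v ⟨hvm, hv⟩ ?_
    rw [hcv, hF'k.eval_smul_eq, hF'e] at hFc
    exact (mul_eq_zero.1 hFc).resolve_left (pow_ne_zero _ hα)
  have heq : ∀ o : Option (Fin m), ∑ i, (o.elim (fun _ => 2) (fun j => Pi.single j 1) :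
      Fin m → ℂ) i * c i = o.elim (2 * ∑ i, c i) c := by
    rintro (_ | j)
    · simp [Finset.mul_sum]
    · simp [Pi.single_apply]
  exact ⟨a, by simpa only [heq] using ha, by simpa only [heq] using ha0⟩

/-- A complex affine variety whose projection to a coordinate axis is infinite has cofinite
projection to this axis. -/
lemma finite_compl_of_infinite {ι κ : Type} [Finite ι] (E : κ → MvPolynomial (Option ι) ℂ)
    (h : {τ : ℂ | ∃ x : Option ι → ℂ, x none = τ ∧ ∀ i, eval x (E i) = 0}.Infinite) :
    {τ : ℂ | ∃ x : Option ι → ℂ, x none = τ ∧ ∀ i, eval x (E i) = 0}ᶜ.Finite := by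
  set J : Ideal (MvPolynomial (Option ι) ℂ) := Ideal.span (Set.range E) with hJ
  have hJeval : ∀ x : Option ι → ℂ, (∀ i, eval x (E i) = 0) → ∀ q ∈ J, eval x q = 0 := by
    intro x hx q hq
    have : J ≤ RingHom.ker (eval x) := Ideal.span_le.2 (by rintro _ ⟨i, rfl⟩; exact hx i)
    exact this hq
  set f : Polynomial ℂ →ₐ[ℂ] MvPolynomial (Option ι) ℂ := Polynomial.aeval (X none) with hf
  have hfe : ∀ (x : Option ι → ℂ) p, eval x (f p) = p.eval (x none) := by
    intro x p
    rw [hf, ← MvPolynomial.coe_aeval_eq_eval, RingHom.coe_coe, ← Polynomial.aeval_algHom_apply,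
      MvPolynomial.aeval_X, Polynomial.coe_aeval_eq_eval]
  have hae : ∀ (x : Option ι → ℂ) q, MvPolynomial.aeval x q = eval x q := fun x q => by
    rw [← MvPolynomial.coe_aeval_eq_eval, RingHom.coe_coe]
  have hdisj : Disjoint (J : Set (MvPolynomial (Option ι) ℂ))
      ((nonZeroDivisors (Polynomial ℂ)).map f : Set (MvPolynomial (Option ι) ℂ)) := by
    rw [Set.disjoint_left]
    rintro _ hq ⟨p, hp, rfl⟩
    have hp0 : p ≠ 0 := nonZeroDivisors.ne_zero hp
    refine h ((Polynomial.finite_setOfPred_isRoot hp0).subset ?_)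
    rintro τ ⟨x, rfl, hx⟩
    have := hJeval x hx _ hq
    rwa [hfe] at this
  obtain ⟨P, hP, hJP, hdP⟩ := Ideal.exists_le_prime_disjoint J _ hdisj
  let _ : Algebra (Polynomial ℂ) (MvPolynomial (Option ι) ℂ ⧸ P) :=
    ((Ideal.Quotient.mkₐ ℂ P).comp f).toRingHom.toAlgebra
  have halg : ∀ p : Polynomial ℂ, algebraMap (Polynomial ℂ) (MvPolynomial (Option ι) ℂ ⧸ P) p =
    Ideal.Quotient.mk P (f p) := fun _ => rfl
  have : IsScalarTower ℂ (Polynomial ℂ) (MvPolynomial (Option ι) ℂ ⧸ P) :=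
    IsScalarTower.of_algebraMap_eq fun r => by
      rw [halg, ← Polynomial.C_eq_algebraMap, hf, Polynomial.aeval_C]
      rfl
  have hinj : Function.Injective
      (algebraMap (Polynomial ℂ) (MvPolynomial (Option ι) ℂ ⧸ P)) := by
    rw [injective_iff_map_eq_zero]
    intro p hp
    by_contra hp0
    rw [halg, Ideal.Quotient.eq_zero_iff_mem] at hp
    exact Set.disjoint_left.1 hdP hp ⟨p, mem_nonZeroDivisors_of_ne_zero hp0, rfl⟩
  have : IsDomain (MvPolynomial (Option ι) ℂ ⧸ P) := Ideal.Quotient.isDomain P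
  have : FaithfulSMul (Polynomial ℂ) (MvPolynomial (Option ι) ℂ ⧸ P) :=
    (faithfulSMul_iff_algebraMap_injective _ _).2 hinj
  have : Module.Flat (Polynomial ℂ) (MvPolynomial (Option ι) ℂ ⧸ P) := inferInstance
  have : Algebra.FiniteType (Polynomial ℂ) (MvPolynomial (Option ι) ℂ ⧸ P) :=
    Algebra.FiniteType.of_restrictScalars_finiteType ℂ _ _
  have : Algebra.FinitePresentation (Polynomial ℂ) (MvPolynomial (Option ι) ℂ ⧸ P) :=
    Algebra.FinitePresentation.of_finiteType.1 inferInstance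
  have hopen := (PrimeSpectrum.isOpenMap_comap_of_hasGoingDown_of_finitePresentation
    (R := Polynomial ℂ) (S := MvPolynomial (Option ι) ℂ ⧸ P)).isOpen_range
  obtain ⟨_, ⟨p, rfl⟩, hp, hsub⟩ :=
    PrimeSpectrum.isTopologicalBasis_basic_opens.exists_subset_of_mem_open
      (Set.mem_range_self (⊥ : PrimeSpectrum (MvPolynomial (Option ι) ℂ ⧸ P))) hopen
  have hp0 : p ≠ 0 := by
    rintro rfl
    exact hp (Ideal.zero_mem _)
  refine (Polynomial.finite_setOfPred_isRoot hp0).subset fun c hc => ?_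
  by_contra hpc
  refine hc ?_
  have hprime : (Ideal.span {Polynomial.X - Polynomial.C c}).IsPrime :=
    (Ideal.span_singleton_prime (Polynomial.X_sub_C_ne_zero c)).2 (Polynomial.prime_X_sub_C c)
  obtain ⟨Q, hQ⟩ := hsub (show (⟨_, hprime⟩ : PrimeSpectrum (Polynomial ℂ)) ∈ _ from
    fun hmem => hpc (Polynomial.dvd_iff_isRoot.1 (Ideal.mem_span_singleton.1 hmem)))
  obtain ⟨M, hM, hQM⟩ := Ideal.exists_le_maximal (Q.asIdeal.comap (Ideal.Quotient.mk P))
    (Ideal.IsPrime.ne_top inferInstance)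
  obtain ⟨x, rfl⟩ := isMaximal_iff_eq_vanishingIdeal_singleton.1 hM
  refine ⟨x, ?_, fun i => ?_⟩
  · have h1 : Polynomial.X - Polynomial.C c ∈ Ideal.span {Polynomial.X - Polynomial.C c} :=
      Ideal.mem_span_singleton_self _
    have h2 : Polynomial.X - Polynomial.C c ∈ (PrimeSpectrum.comap
      (algebraMap (Polynomial ℂ) (MvPolynomial (Option ι) ℂ ⧸ P)) Q).asIdeal := by
      rw [hQ]; exact h1
    have h3 := hQM (show f (Polynomial.X - Polynomial.C c) ∈ _ from h2)
    rw [mem_vanishingIdeal_singleton_iff, hae, hfe] at h3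
    simpa [sub_eq_zero] using h3
  · have h1 : E i ∈ Q.asIdeal.comap (Ideal.Quotient.mk P) := by
      rw [Ideal.mem_comap, Ideal.Quotient.eq_zero_iff_mem.2
        (hJP (Ideal.subset_span (Set.mem_range_self i)))]
      exact Ideal.zero_mem _
    have h2 := hQM h1
    rwa [mem_vanishingIdeal_singleton_iff, hae] at h2

lemma exists_norm_lt_of_hasDerivAt {ι κ : Type} [Fintype ι] [Fintype κ]
    (E : κ → MvPolynomial (Option ι) ℂ) (h0 : ∀ i, eval 0 (E i) = 0)
    (h : ∀ w : κ → ℂ, ∃ v : ι → ℂ, ∀ i,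
      HasDerivAt (fun t : ℂ => eval (fun o => o.elim 0 fun j => t * v j) (E i)) (w i) 0) (R : ℝ) :
    ∃ (τ : ℂ) (v : ι → ℂ), R < ‖τ‖ ∧ ∀ i, eval (fun o => o.elim τ v) (E i) = 0 := by
  classical
  set φ : (Option ι → ℂ) → ℂ × (κ → ℂ) := fun x => (x none, fun i => eval x (E i)) with hφ
  have hcd : ContDiff ℂ 1 φ := by
    have h1 : ∀ q : MvPolynomial (Option ι) ℂ, ContDiff ℂ 1 fun x => eval x q := by
      intro q
      induction q using MvPolynomial.induction_on with
      | C a => simpa using contDiff_const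
      | add p q hp hq => simpa using hp.add hq
      | mul_X p n hp => simpa using hp.mul (contDiff_apply ℂ ℂ n)
    exact (contDiff_apply ℂ ℂ none).prodMk (contDiff_pi.2 fun i => h1 (E i))
  have hst : HasStrictFDerivAt φ (fderiv ℂ φ 0) 0 := hcd.hasStrictFDerivAt one_ne_zero
  have hsurj : (fderiv ℂ φ 0).range = ⊤ := by
    rw [LinearMap.range_eq_top]
    rintro ⟨t, w⟩
    set e : Option ι → ℂ := fun o => o.elim t 0 with he
    have hfst : ∀ y : Option ι → ℂ, (fderiv ℂ φ 0 y).1 = y none := by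
      intro y
      have h1 : HasFDerivAt (fun x : Option ι → ℂ => x none)
          ((ContinuousLinearMap.fst ℂ ℂ (κ → ℂ)).comp (fderiv ℂ φ 0)) 0 :=
        (ContinuousLinearMap.fst ℂ ℂ (κ → ℂ)).hasFDerivAt.comp _ hst.hasFDerivAt
      have h2 : HasFDerivAt (fun x : Option ι → ℂ => x none)
          (ContinuousLinearMap.proj (R := ℂ) (φ := fun _ : Option ι => ℂ) none) 0 :=
        (ContinuousLinearMap.proj (R := ℂ) (φ := fun _ : Option ι => ℂ) none).hasFDerivAt
      exact congrArg (fun A : (Option ι → ℂ) →L[ℂ] ℂ => A y) (h1.unique h2)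
    obtain ⟨v, hv⟩ := h (w - (fderiv ℂ φ 0 e).2)
    set y : Option ι → ℂ := fun o => o.elim 0 v with hy
    have hsnd : (fderiv ℂ φ 0 y).2 = w - (fderiv ℂ φ 0 e).2 := by
      funext i
      have hl : HasDerivAt (fun t : ℂ => t • y) y 0 := by
        simpa using (hasDerivAt_id (0 : ℂ)).smul_const y
      have h1 : HasFDerivAt φ (fderiv ℂ φ 0) ((0 : ℂ) • y) := by
        rw [zero_smul]; exact hst.hasFDerivAt
      have h2 := (hasDerivAt_pi.1 ((ContinuousLinearMap.snd ℂ ℂ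
          (κ → ℂ)).hasFDerivAt.comp_hasDerivAt 0
        (h1.comp_hasDerivAt (0 : ℂ) hl))) i
      refine h2.unique ?_
      refine (hv i).congr_of_eventuallyEq (Eventually.of_forall fun t => ?_)
      change eval (t • y) (E i) = _
      congr 2
      funext o
      cases o <;> simp [hy]
    refine ⟨e + y, ?_⟩
    change fderiv ℂ φ 0 (e + y) = _
    rw [map_add]
    refine Prod.ext ?_ ?_
    · rw [Prod.fst_add, hfst, hfst]; simp [he, hy]
    · rw [Prod.snd_add, hsnd]; simp
  have hmap := hst.map_nhds_eq_of_surj hsurj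
  have hφ0 : φ 0 = (0, 0) := by
    simp only [hφ, h0]; rfl
  rw [hφ0] at hmap
  have hrange : Set.range φ ∈ 𝓝 ((0 : ℂ), (0 : κ → ℂ)) := by
    rw [← hmap]; exact range_mem_map
  have hS : {τ : ℂ | ∃ x : Option ι → ℂ, x none = τ ∧ ∀ i, eval x (E i) = 0} ∈ 𝓝 (0 : ℂ) := by
    have hc : ContinuousAt (fun τ : ℂ => (τ, (0 : κ → ℂ))) 0 := by fun_prop
    filter_upwards [hc hrange]
    rintro τ ⟨x, hx⟩
    exact ⟨x, congrArg Prod.fst hx, fun i => congrFun (congrArg Prod.snd hx) i⟩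
  have hfin := finite_compl_of_infinite E (infinite_of_mem_nhds 0 hS)
  obtain ⟨τ, hτ, hτR⟩ : ∃ τ : ℂ, τ ∉ {τ : ℂ | ∃ x : Option ι → ℂ, x none = τ ∧
      ∀ i, eval x (E i) = 0}ᶜ ∧ R < ‖τ‖ := by
    obtain ⟨B, hB⟩ := hfin.isBounded.exists_norm_le
    refine ⟨((|B| + |R| + 1 : ℝ) : ℂ), fun hmem => ?_, ?_⟩
    · have := hB _ hmem
      rw [Complex.norm_real, Real.norm_of_nonneg (by positivity)] at this
      linarith [le_abs_self B, abs_nonneg R]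
    · rw [Complex.norm_real, Real.norm_of_nonneg (by positivity)]
      linarith [le_abs_self R, abs_nonneg B]
  obtain ⟨x, rfl, hx⟩ := not_not.1 hτ
  refine ⟨x none, fun j => x (some j), hτR, fun i => ?_⟩
  rw [← hx i]
  congr 2
  funext o
  cases o <;> rfl

/-- Hyperbolicity is an open condition, here along the pencil through any other form. -/
lemma IsBrodyHyperbolicHypersurface.exists_add_mul {q k : ℕ} {F H : MvPolynomial (Fin q) ℂ}
    (hF : IsBrodyHyperbolicHypersurface F) (hFk : F.IsHomogeneous k) (hHk : H.IsHomogeneous k) :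
    ∃ R : ℝ, ∀ τ : ℂ, R < ‖τ‖ → IsBrodyHyperbolicHypersurface (H + C τ * F) := by
  by_contra! hcon
  choose τ hτ hnot using fun n : ℕ => hcon n
  have hinf : Tendsto (fun n => (τ n)⁻¹) atTop (𝓝 0) := by
    rw [tendsto_zero_iff_norm_tendsto_zero]
    simp only [norm_inv]
    exact (tendsto_atTop_mono (fun n => (hτ n).le) tendsto_natCast_atTop_atTop).inv_tendsto_atTop
  obtain ⟨j, hj⟩ := hF.exists_add_smul hFk hHk hinf
  refine hnot j fun f hf hz h0 => hj f hf hz fun z => ?_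
  have hτ0 : τ j ≠ 0 := norm_pos_iff.1 ((Nat.cast_nonneg j).trans_lt (hτ j))
  have := h0 z
  simp only [map_add, map_mul, eval_C] at this ⊢
  field_simp
  linear_combination this

/-- Hypersurfaces of small degree contain lines, so they are not hyperbolic. -/
theorem not_isBrodyHyperbolicHypersurface_of_div_two_lt {p k : ℕ} (hk : 1 ≤ k) (hkp : k / 2 < p)
    {F : MvPolynomial (Fin (p + 2)) ℂ} (hFk : F.IsHomogeneous k) :
    ¬ IsBrodyHyperbolicHypersurface F := by
  classical
  intro hF
  set e : Fin p → ℕ := fun j => min (2 * j) (k - 1) with he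
  set H : MvPolynomial (Fin (p + 2)) ℂ :=
    ∑ j : Fin p, X j.succ.succ * (X 0 ^ (k - 1 - e j) * X 1 ^ e j) with hH
  have hHk : H.IsHomogeneous k := by
    refine IsHomogeneous.sum _ _ _ fun j _ => ?_
    have h1 : 1 + (1 * (k - 1 - e j) + 1 * e j) = k := by
      have : e j ≤ k - 1 := min_le_right _ _
      omega
    have h2 := (isHomogeneous_X ℂ j.succ.succ).mul
      (((isHomogeneous_X ℂ (0 : Fin (p + 2))).pow (k - 1 - e j)).mul
        ((isHomogeneous_X ℂ (1 : Fin (p + 2))).pow (e j)))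
    rw [h1] at h2
    exact h2
  obtain ⟨R, hR⟩ := hF.exists_add_mul hFk hHk
  set pt : (Fin p × Bool → ℂ) → ℂ → Fin (p + 2) → ℂ := fun v t =>
    Fin.cons 1 (Fin.cons t fun j => v (j, false) + t * v (j, true)) with hpt
  set ptX : ℂ → Fin (p + 2) → MvPolynomial (Option (Fin p × Bool)) ℂ := fun t =>
    Fin.cons 1 (Fin.cons (C t) fun j => X (some (j, false)) + C t * X (some (j, true))) with hptX
  have hpte : ∀ (τ : ℂ) v t i, eval (fun o : Option (Fin p × Bool) => o.elim τ v) (ptX t i) =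
      pt v t i := by
    intro τ v t i
    refine Fin.cases ?_ (fun i => Fin.cases ?_ (fun j => ?_) i) i <;> simp [hpt, hptX]
  set E : Fin (k + 1) → MvPolynomial (Option (Fin p × Bool)) ℂ := fun i =>
    bind₁ (ptX (i : ℕ)) H + X none * bind₁ (ptX (i : ℕ)) F with hE
  have hEe : ∀ (τ : ℂ) v i, eval (fun o : Option (Fin p × Bool) => o.elim τ v) (E i) =
      eval (pt v (i : ℕ)) H + τ * eval (pt v (i : ℕ)) F := by
    intro τ v i
    simp only [hE, map_add, map_mul, eval_bind₁, hpte, eval_X, Option.elim_none]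
  set L : (Fin p × Bool → ℂ) →ₗ[ℂ] (ℂ → ℂ) := ∑ j : Fin p, LinearMap.pi fun t =>
    (t ^ e j) • (LinearMap.proj (j, false) + t • LinearMap.proj (j, true)) with hL
  have hLe : ∀ v t, L v t = ∑ j : Fin p, t ^ e j * (v (j, false) + t * v (j, true)) := by
    intro v t
    simp [hL, mul_add]
  have hHe : ∀ v t, eval (pt v t) H = L v t := by
    intro v t
    rw [hLe, hH, map_sum]
    refine Finset.sum_congr rfl fun j _ => ?_
    have h0 : pt v t 0 = 1 := rfl
    have h1 : pt v t 1 = t := rfl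
    have h2 : pt v t j.succ.succ = v (j, false) + t * v (j, true) := rfl
    simp only [map_mul, map_pow, eval_X, h0, h1, h2, one_pow]
    ring
  suffices h : ∃ (τ : ℂ) (v : Fin p × Bool → ℂ), R < ‖τ‖ ∧
      ∀ i, eval (fun o => o.elim τ v) (E i) = 0 by
    obtain ⟨τ, v, hτ, hv⟩ := h
    have hG := hR τ hτ
    set G := H + C τ * F with hGdef
    have hGk : G.IsHomogeneous k := hHk.add (by simpa using (isHomogeneous_C _ τ).mul hFk)
    set g : Fin (p + 2) → Polynomial ℂ := Fin.cons 1 (Fin.cons Polynomial.X fun j =>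
      Polynomial.C (v (j, false)) + Polynomial.X * Polynomial.C (v (j, true))) with hg
    have hge : ∀ t i, (g i).eval t = pt v t i := by
      intro t i
      refine Fin.cases ?_ (fun i => Fin.cases ?_ (fun j => ?_) i) i <;> simp [hpt, hg]
      exact mul_comm _ _
    have hgd : ∀ i, (g i).natDegree ≤ 1 := by
      intro i
      refine Fin.cases ?_ (fun i => Fin.cases ?_ (fun j => ?_) i) i <;> simp only [hg,
          Fin.cons_zero, Fin.cons_succ]
      · simp
      · simp
      · compute_degree
    have hae : ∀ t, (MvPolynomial.aeval g G).eval t = eval (pt v t) G := by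
      intro t
      have h1 := MvPolynomial.comp_aeval_apply (f := g) (Polynomial.aeval (R := ℂ) t) G
      rw [Polynomial.coe_aeval_eq_eval] at h1
      rw [h1]
      simp [hge, MvPolynomial.aeval_eq_eval]
    have hzero : MvPolynomial.aeval g G = 0 := by
      refine Polynomial.eq_zero_of_natDegree_lt_card_of_eval_eq_zero _
        (f := fun i : Fin (k + 1) => ((i : ℕ) : ℂ)) (fun i j hij => Fin.ext
          (Nat.cast_injective hij))
        (fun i => ?_) ?_
      · rw [hae, hGdef, map_add, map_mul, eval_C, ← hEe, hv]
      · rw [Fintype.card_fin, Nat.lt_succ_iff]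
        have := MvPolynomial.aeval_natDegree_le G hGk.totalDegree_le g (n := 1) hgd
        simpa using this
    have hdiff : ∀ i, Differentiable ℂ fun z => pt v z i := by
      intro i
      simp only [← hge]
      exact (g i).differentiable
    obtain ⟨c, u, -, hcu⟩ := hG (fun i z => pt v z i) hdiff (fun z => ⟨0, one_ne_zero⟩)
      (fun z => by rw [← hae, hzero, Polynomial.eval_zero])
    have h0 : ∀ z, (1 : ℂ) = c 0 * u z := fun z => hcu 0 z
    have h1 : ∀ z, z = c 1 * u z := fun z => hcu 1 z
    have h2 : u 0 ≠ 0 := fun h => one_ne_zero ((h0 0).trans (by rw [h, mul_zero]))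
    have h3 : c 1 = 0 := (mul_eq_zero.1 (h1 0).symm).resolve_right h2
    have h4 := h1 1
    rw [h3, zero_mul] at h4
    exact one_ne_zero h4
  refine exists_norm_lt_of_hasDerivAt E (fun i => ?_) (fun w => ?_) R
  · have h1 : (0 : Option (Fin p × Bool) → ℂ) = fun o => o.elim 0 0 := by
      funext o; cases o <;> rfl
    rw [h1, hEe, hHe, map_zero]
    simp
  · set f := Lagrange.interpolate Finset.univ (fun i : Fin (k + 1) => ((i : ℕ) : ℂ)) w with hf
    have hinj : Set.InjOn (fun i : Fin (k + 1) => ((i : ℕ) : ℂ)) (Finset.univ : Finset (Fin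
        (k + 1))) :=
      fun i _ j _ hij => Fin.ext (Nat.cast_injective hij)
    have hfe : ∀ i : Fin (k + 1), f.eval ((i : ℕ) : ℂ) = w i := fun i =>
      Lagrange.eval_interpolate_at_node w hinj (Finset.mem_univ i)
    have hfd : f.natDegree < k + 1 := by
      have := Lagrange.degree_interpolate_lt w hinj
      rw [Finset.card_univ, Fintype.card_fin] at this
      exact Nat.lt_succ_iff.2 (Polynomial.natDegree_le_of_degree_le (Order.le_of_lt_succ
          (by exact_mod_cast this)))
    have hmono : ∀ l : ℕ, l < k + 1 → ∃ v, ∀ t, L v t = t ^ l := by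
      intro l hl
      have hlp : l / 2 < p := lt_of_le_of_lt (Nat.div_le_div_right (by omega)) hkp
      have key : ∀ b : Bool, l = e ⟨l / 2, hlp⟩ + (if b then 1 else 0) →
          ∃ v, ∀ t, L v t = t ^ l := by
        intro b hb
        refine ⟨Pi.single (⟨l / 2, hlp⟩, b) 1, fun t => ?_⟩
        rw [hLe, Finset.sum_eq_single ⟨l / 2, hlp⟩]
        · conv_rhs => rw [hb]
          cases b <;> simp [pow_succ]
        · intro j _ hj
          simp [hj]
        · simp
      by_cases h1 : l = e ⟨l / 2, hlp⟩
      · exact key false (by simpa using h1)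
      · refine key true ?_
        simp only [he, if_true] at h1 ⊢
        omega
    choose! V hV using hmono
    refine ⟨∑ l ∈ Finset.range (k + 1), f.coeff l • V l, fun i => ?_⟩
    set v := ∑ l ∈ Finset.range (k + 1), f.coeff l • V l with hv
    have hLv : L v ((i : ℕ) : ℂ) = w i := by
      rw [hv, map_sum, Finset.sum_apply, ← hfe i, Polynomial.eval_eq_sum_range' hfd]
      refine Finset.sum_congr rfl fun l hl => ?_
      rw [map_smul, Pi.smul_apply, hV l (Finset.mem_range.1 hl), smul_eq_mul]
    have hlin : (fun t : ℂ => eval (fun o : Option (Fin p × Bool) => o.elim 0 fun j => t * v j)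
        (E i)) =
        fun t => t * w i := by
      funext t
      rw [hEe, zero_mul, add_zero]
      refine (hHe (t • v) _).trans ?_
      rw [map_smul, Pi.smul_apply, hLv, smul_eq_mul]
    rw [hlin]
    simpa using (hasDerivAt_id (0 : ℂ)).mul_const (w i)

/-- Homogeneous polynomials in three variables, written out. -/
lemma MvPolynomial.IsHomogeneous.exists_eval_eq_sum {k : ℕ} {F : MvPolynomial (Fin 3) ℂ}
    (hF : F.IsHomogeneous k) :
    ∃ c : ℕ → ℕ → ℂ, ∀ v : Fin 3 → ℂ, eval v F =
      ∑ i ∈ Finset.range (k + 1), ∑ j ∈ Finset.range (k + 1 - i),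
        c i j * (v 0 ^ i * v 1 ^ j * v 2 ^ (k - i - j)) := by
  refine ⟨fun i j => ∑ d ∈ F.support, if i = d 0 ∧ j = d 1 then F.coeff d else 0, fun v => ?_⟩
  simp_rw [Finset.sum_mul]
  rw [eval_eq', Finset.sum_congr rfl fun i _ => Finset.sum_comm, Finset.sum_comm]
  refine Finset.sum_congr rfl fun d hd => ?_
  have hdk : d 0 + d 1 + d 2 = k := by
    rw [← hF (mem_support_iff.1 hd), Finsupp.weight_apply, Finsupp.sum_fintype _ _ (by simp),
      Fin.sum_univ_three]
    simp
  rw [Finset.sum_eq_single (d 0), Finset.sum_eq_single (d 1)]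
  · rw [if_pos ⟨rfl, rfl⟩, Fin.prod_univ_three]
    congr 3
    omega
  · intro j _ hj
    simp [hj]
  · intro hj
    exact absurd (Finset.mem_range.2 (by omega)) hj
  · intro i _ hi
    simp [hi]
  · intro hi
    exact absurd (Finset.mem_range.2 (by omega)) hi

lemma exists_quadratic_root (a b c : ℂ) : ∃ s t : ℂ, (s, t) ≠ 0 ∧ s ^ 2 * a + s * t * b + t ^ 2 *
    c = 0 := by
  by_cases hc : c = 0
  · exact ⟨0, 1, by simp, by simp [hc]⟩
  · obtain ⟨r, hr⟩ := IsAlgClosed.exists_pow_nat_eq (b ^ 2 - 4 * a * c) two_pos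
    refine ⟨1, (-b + r) / (2 * c), by simp, ?_⟩
    field_simp
    linear_combination hr

/-- Plane conics are not hyperbolic. -/
theorem not_isBrodyHyperbolicHypersurface_conic {F : MvPolynomial (Fin 3) ℂ}
    (hF : F.IsHomogeneous 2) : ¬ IsBrodyHyperbolicHypersurface F := by
  intro hFh
  obtain ⟨c, hc⟩ := hF.exists_eval_eq_sum
  simp only [Finset.sum_range_succ, Finset.sum_range_zero, Nat.reduceAdd, Nat.reduceSub] at hc
  set B : (Fin 3 → ℂ) → (Fin 3 → ℂ) → ℂ := fun v w =>
    2 * c 0 0 * v 2 * w 2 + c 0 1 * (v 1 * w 2 + v 2 * w 1) + 2 * c 0 2 * v 1 * w 1 +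
    c 1 0 * (v 0 * w 2 + v 2 * w 0) + c 1 1 * (v 0 * w 1 + v 1 * w 0) + 2 * c 2 0 * v 0 *
        w 0 with hB
  have hquad : ∀ (s t : ℂ) v w, eval (s • v + t • w) F =
      s ^ 2 * eval v F + s * t * B v w + t ^ 2 * eval w F := by
    intro s t v w
    simp only [hc, hB, Pi.add_apply, Pi.smul_apply, smul_eq_mul]
    ring
  have hBlin : ∀ (s t : ℂ) u v w, B u (s • v + t • w) = s * B u v + t * B u w := by
    intro s t u v w
    simp only [hB, Pi.add_apply, Pi.smul_apply, smul_eq_mul]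
    ring
  have hplane : ∀ (i : Fin 3) (s t : ℂ), (s, t) ≠ 0 →
      (s • Pi.single (i + 1) 1 + t • Pi.single (i + 2) 1 : Fin 3 → ℂ) ≠ 0 ∧
      (s • Pi.single (i + 1) 1 + t • Pi.single (i + 2) 1 : Fin 3 → ℂ) i = 0 := by
    intro i s t hst
    refine ⟨fun h => hst ?_, by fin_cases i <;> simp⟩
    have h1 := congrFun h (i + 1)
    have h2 := congrFun h (i + 2)
    fin_cases i <;> simp_all
  obtain ⟨a, ha0, ha⟩ : ∃ a, a ≠ 0 ∧ eval a F = 0 := by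
    obtain ⟨s, t, hst, h⟩ := exists_quadratic_root (eval (Pi.single (0 + 1) 1) F)
      (B (Pi.single (0 + 1) 1) (Pi.single (0 + 2) 1)) (eval (Pi.single (0 + 2) 1) F)
    exact ⟨_, (hplane 0 s t hst).1, by rw [hquad, h]⟩
  obtain ⟨i, hi⟩ := Function.ne_iff.1 ha0
  have hspan : ∀ w : Fin 3 → ℂ, w ≠ 0 → w i = 0 → ∀ r : ℂ, w ≠ r • a := by
    rintro w hw hwi r rfl
    rcases mul_eq_zero.1 hwi with h | h
    · exact hw (by rw [h, zero_smul])
    · exact hi h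
  have hBaa : B a a = 0 := by
    have h1 := hquad 1 1 a a
    have h2 := hF.eval_smul_eq 2 a
    rw [two_smul, ha] at h2
    simp only [one_smul, h2, ha] at h1
    linear_combination -h1
  by_cases hφ : ∃ v, B a v ≠ 0
  · obtain ⟨v, hv⟩ := hφ
    obtain ⟨w, hw0, hwi, hw⟩ : ∃ w : Fin 3 → ℂ, w ≠ 0 ∧ w i = 0 ∧ B a w = 0 := by
      by_cases h1 : B a (Pi.single (i + 1) 1) = 0
      · refine ⟨_, (hplane i 1 0 (by simp)).1, (hplane i 1 0 (by simp)).2, ?_⟩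
        rw [hBlin, h1]; ring
      · refine ⟨_, (hplane i (-B a (Pi.single (i + 2) 1)) (B a (Pi.single (i + 1) 1))
          (by simp [h1])).1, (hplane i _ _ (by simp [h1])).2, ?_⟩
        rw [hBlin]; ring
    set g : ℂ → Fin 3 → ℂ := fun t => (eval (v + t • w) F) • a + (-(B a v)) • (v + t • w) with hg
    have hBg : ∀ t, B a (g t) = -(B a v) ^ 2 := by
      intro t
      have h1 := hBlin 1 t a v w
      rw [one_smul, hw] at h1
      rw [hg, hBlin, h1, hBaa]
      ring
    have hgd : Differentiable ℂ g := by
      have h1 : ∀ i, Differentiable ℂ fun t : ℂ => (v + t • w) i := fun i => by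
        simp only [Pi.add_apply, Pi.smul_apply]; fun_prop
      rw [differentiable_pi]
      intro i
      simp only [hg, hc, Pi.add_apply, Pi.smul_apply, smul_eq_mul]
      fun_prop
    obtain ⟨p, u, hp, -, -, hgu⟩ := hFh.exists_eq_smul hF hgd ⟨0, fun h0 => by
        have h1 := hBg 0
        rw [h0] at h1
        have h2 : B a 0 = 0 := by simp [hB]
        rw [h2] at h1
        exact pow_ne_zero 2 hv (neg_eq_zero.1 h1.symm)⟩ fun t => by
      have h1 := hBlin 1 t a v w
      rw [one_smul, hw] at h1
      rw [hg, hquad, h1, ha]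
      ring
    have hBu : ∀ t, u t * B a p = -(B a v) ^ 2 := by
      intro t
      have h1 := hBlin (u t) 0 a p p
      rw [zero_smul, add_zero, ← hgu, hBg] at h1
      rw [h1]; ring
    have hBp : B a p ≠ 0 := fun h0 => by
      have h1 := hBu 0
      rw [h0, mul_zero] at h1
      exact pow_ne_zero 2 hv (neg_eq_zero.1 h1.symm)
    have hu : u 0 = u 1 := mul_right_cancel₀ hBp ((hBu 0).trans (hBu 1).symm)
    have hg01 : g 0 = g 1 := by rw [hgu, hgu, hu]
    refine hspan w hw0 hwi ((eval (v + (1 : ℂ) • w) F - eval v F) / B a v) ?_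
    have h1 : (B a v) • w = (eval (v + (1 : ℂ) • w) F - eval v F) • a := by
      simp only [hg, zero_smul, add_zero] at hg01
      funext j
      have h2 := congrFun hg01 j
      simp only [Pi.add_apply, Pi.smul_apply, smul_eq_mul] at h2 ⊢
      linear_combination h2
    rw [div_eq_inv_mul, mul_smul, ← h1, smul_smul, inv_mul_cancel₀ hv, one_smul]
  · push Not at hφ
    obtain ⟨v, hv0, hvi, hv⟩ : ∃ v : Fin 3 → ℂ, v ≠ 0 ∧ v i = 0 ∧ eval v F = 0 := by
      obtain ⟨s, t, hst, h⟩ := exists_quadratic_root (eval (Pi.single (i + 1) 1) F)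
        (B (Pi.single (i + 1) 1) (Pi.single (i + 2) 1)) (eval (Pi.single (i + 2) 1) F)
      exact ⟨_, (hplane i s t hst).1, (hplane i s t hst).2, by rw [hquad, h]⟩
    obtain ⟨p, u, hp, -, -, hgu⟩ := hFh.exists_eq_smul hF (g := fun t => v + t • a)
      (by fun_prop) ⟨0, by simpa using hv0⟩ fun t => by
        have h1 := hquad t 1 a v
        rw [one_smul, add_comm] at h1
        rw [h1, ha, hφ, hv]
        ring
    have h0 := hgu 0
    have h1 := hgu 1
    simp only [zero_smul, add_zero, one_smul] at h0 h1
    rw [h0] at h1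
    have h2 : a = (u 1 - u 0) • p := by rw [sub_smul]; exact eq_sub_of_add_eq' h1
    have hu : u 1 - u 0 ≠ 0 := fun hu => ha0 (by rw [h2, hu, zero_smul])
    refine hspan v hv0 hvi (u 0 / (u 1 - u 0)) ?_
    rw [h2, smul_smul, div_mul_cancel₀ _ hu, ← h0]

/-- A pencil `H + τ F` with `F` hyperbolic has a hyperbolic member satisfying prescribed
coefficient conditions after a linear substitution, as soon as the conditions hold and are
linearly independent to first order for `H` itself. -/
theorem IsBrodyHyperbolicHypersurface.exists_section {ι κ κ' : Type} [Fintype ι] [Fintype κ]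
    [Fintype κ'] {q p m k : ℕ} {F H : MvPolynomial (Fin q) ℂ}
    (hF : IsBrodyHyperbolicHypersurface F) (hFk : F.IsHomogeneous k) (hHk : H.IsHomogeneous k)
    (A : Fin q → Fin p → MvPolynomial ι ℂ) (x : κ → Fin m → Fin p → ℂ) (a : κ → Fin m → ℂ)
    (D : κ' → MvPolynomial ι ℂ)
    (h0 : ∀ i, ∑ s, a i s * eval (fun l => ∑ b, eval 0 (A l b) * x i s b) H = 0)
    (hD0 : ∀ j, eval 0 (D j) = 0)
    (h : ∀ (w : κ → ℂ) (w' : κ' → ℂ), ∃ v : ι → ℂ,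
      (∀ i, HasDerivAt (fun t : ℂ => ∑ s, a i s *
        eval (fun l => ∑ b, eval (fun o => t * v o) (A l b) * x i s b) H) (w i) 0) ∧
      ∀ j, HasDerivAt (fun t : ℂ => eval (fun o => t * v o) (D j)) (w' j) 0) :
    ∃ (τ : ℂ) (v : ι → ℂ), IsBrodyHyperbolicHypersurface (H + C τ * F) ∧
      (∀ i, ∑ s, a i s * eval (fun l => ∑ b, eval v (A l b) * x i s b) (H + C τ * F) = 0) ∧
      ∀ j, eval v (D j) = 0 := by
  obtain ⟨R, hR⟩ := hF.exists_add_mul hFk hHk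
  let y (i : κ) (s : Fin m) (l : Fin q) : MvPolynomial (Option ι) ℂ :=
    ∑ b, rename some (A l b) * C (x i s b)
  let E : κ ⊕ κ' → MvPolynomial (Option ι) ℂ := Sum.elim
    (fun i => ∑ s, C (a i s) * (bind₁ (y i s) H + X none * bind₁ (y i s) F))
    (fun j => rename some (D j))
  have hinl (τ : ℂ) (v : ι → ℂ) (i : κ) : eval (fun o : Option ι => o.elim τ v) (E (.inl i)) =
      ∑ s, a i s * eval (fun l => ∑ b, eval v (A l b) * x i s b) (H + C τ * F) := by
    simp only [E, y, Sum.elim_inl, map_sum, map_mul, map_add, eval_C, eval_X, eval_bind₁,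
      eval_rename, Option.elim_none]
    rfl
  have hinr (τ : ℂ) (v : ι → ℂ) (j : κ') : eval (fun o : Option ι => o.elim τ v) (E (.inr j)) =
      eval v (D j) := by
    simp only [E, Sum.elim_inr, eval_rename]
    rfl
  have hzero : (fun o : Option ι => o.elim (0 : ℂ) (0 : ι → ℂ)) = 0 := by
    funext o; cases o <;> rfl
  have hC : H + C 0 * F = H := by simp
  obtain ⟨τ, v, hτ, hv⟩ := exists_norm_lt_of_hasDerivAt E (by
    rintro (i | j)
    · rw [← hzero, hinl, hC, h0]
    · rw [← hzero, hinr, hD0]) (by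
    intro w
    obtain ⟨v, h1, h2⟩ := h (fun i => w (.inl i)) (fun j => w (.inr j))
    refine ⟨v, ?_⟩
    rintro (i | j)
    · refine (h1 i).congr_of_eventuallyEq (Eventually.of_forall fun t => ?_)
      exact (hinl 0 (fun o => t * v o) i).trans (by rw [hC])
    · exact (h2 j).congr_of_eventuallyEq (Eventually.of_forall fun t =>
        hinr 0 (fun o => t * v o) j)) R
  exact ⟨τ, v, hR τ hτ, fun i => by rw [← hinl]; exact hv _, fun j => by
    rw [← hinr τ]; exact hv _⟩

lemma eq_zero_or_eq_zero_of_mul {f g : ℂ → ℂ} (hf : Differentiable ℂ f) (hg : Differentiable ℂ g)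
    (h : ∀ z, f z * g z = 0) : (∀ z, f z = 0) ∨ ∀ z, g z = 0 := by
  have := AnalyticOnNhd.eq_zero_or_eq_zero_of_mul_eq_zero
    (fun z _ => hf.analyticAt z) (fun z _ => hg.analyticAt z) (fun z _ => h z)
    (isPreconnected_univ)
  simpa using this

lemma exists_proportional_of_quadratic {f g : ℂ → ℂ} (hf : Differentiable ℂ f)
    (hg : Differentiable ℂ g) {a b c : ℂ} (habc : ¬ (a = 0 ∧ b = 0 ∧ c = 0))
    (h : ∀ z, a * f z ^ 2 + b * g z ^ 2 + c * (f z * g z) = 0) :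
    ∃ (r s : ℂ) (u : ℂ → ℂ), Differentiable ℂ u ∧ (∀ z, f z = r * u z) ∧ ∀ z, g z = s * u z := by
  by_cases ha : a = 0
  · subst ha
    rcases eq_zero_or_eq_zero_of_mul hg ((hg.const_mul b).fun_add (hf.const_mul c))
      (fun z => by linear_combination h z) with h1 | h1
    · exact ⟨1, 0, f, hf, fun z => by simp, fun z => by simp [h1]⟩
    · by_cases hb : b = 0
      · have hc : c ≠ 0 := fun hc => habc ⟨rfl, hb, hc⟩
        refine ⟨0, 1, g, hg, fun z => ?_, fun z => by simp⟩
        simpa [hb, hc] using h1 z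
      · refine ⟨1, -c / b, f, hf, fun z => by simp, fun z => ?_⟩
        field_simp
        linear_combination h1 z
  · obtain ⟨r, hr⟩ : ∃ r : ℂ, a * r ^ 2 + c * r + b = 0 := by
      obtain ⟨s, t, hst, h0⟩ := exists_quadratic_root a c b
      have ht : t ≠ 0 := by
        rintro rfl
        have : s = 0 := by simpa [ha] using h0
        exact hst (by simp [this])
      refine ⟨s / t, ?_⟩
      field_simp
      linear_combination h0
    rcases eq_zero_or_eq_zero_of_mul (hf.fun_sub (hg.const_mul r))
      ((hf.const_mul a).fun_add (hg.const_mul (c + a * r)))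
      (fun z => by linear_combination h z - g z ^ 2 * hr) with h1 | h1
    · exact ⟨r, 1, g, hg, fun z => by linear_combination h1 z, fun z => by simp⟩
    · refine ⟨-(c + a * r) / a, 1, g, hg, fun z => ?_, fun z => by simp⟩
      field_simp
      linear_combination h1 z

lemma not_isBrodyHyperbolicHypersurface_of_line {Q : MvPolynomial (Fin 3) ℂ} {l : Fin 3 → ℂ → ℂ}
    (hl : ∀ i, Differentiable ℂ (l i)) {i j : Fin 3} (hi : ∀ z, l i z = 1) (hj : ∀ z, l j z = z)
    (hQ : ∀ z, eval (fun i => l i z) Q = 0) : ¬ IsBrodyHyperbolicHypersurface Q := by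
  intro h
  obtain ⟨c, u, -, hu⟩ := h l hl (fun z => ⟨i, by simp [hi]⟩) hQ
  have h1 := hu i 0
  have h2 := hu j 0
  have h3 := hu j 1
  rw [hi] at h1
  rw [hj] at h2 h3
  have h4 : u 0 ≠ 0 := by rintro h; simp [h] at h1
  have h5 : c j = 0 := by simpa [h4] using h2.symm
  simp [h5] at h3

lemma not_isBrodyHyperbolicHypersurface_three_nodes {Q : MvPolynomial (Fin 3) ℂ} {k : ℕ}
    (hQk : Q.IsHomogeneous k) {a b c d e f : ℂ}
    (hQ : ∀ v, eval v Q = a * (v 1 * v 2) ^ 2 + b * (v 0 * v 2) ^ 2 + c * (v 0 * v 1) ^ 2 +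
      v 0 * v 1 * v 2 * (d * v 0 + e * v 1 + f * v 2)) : ¬ IsBrodyHyperbolicHypersurface Q := by
  intro hB
  have hx : ¬ ∀ z : ℂ, eval ![1, 0, z] Q = 0 := fun h => by
    refine not_isBrodyHyperbolicHypersurface_of_line (l := ![fun _ => 1, fun _ => 0, id])
      (i := 0) (j := 2) ?_ (fun z => rfl) (fun z => rfl) (fun z => ?_) hB
    · intro i; fin_cases i
      · exact differentiable_const _
      · exact differentiable_const _
      · exact differentiable_id
    · refine Eq.trans ?_ (h z); congr 2; funext i; fin_cases i <;> rfl
  have hy : ¬ ∀ z : ℂ, eval ![0, 1, z] Q = 0 := fun h => by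
    refine not_isBrodyHyperbolicHypersurface_of_line (l := ![fun _ => 0, fun _ => 1, id])
      (i := 1) (j := 2) ?_ (fun z => rfl) (fun z => rfl) (fun z => ?_) hB
    · intro i; fin_cases i
      · exact differentiable_const _
      · exact differentiable_const _
      · exact differentiable_id
    · refine Eq.trans ?_ (h z); congr 2; funext i; fin_cases i <;> rfl
  let P : MvPolynomial (Fin 3) ℂ := C a * X 0 ^ 2 + C b * X 1 ^ 2 + C c * X 2 ^ 2 +
    C d * (X 1 * X 2) + C e * (X 0 * X 2) + C f * (X 0 * X 1)
  have hP : P.IsHomogeneous 2 := by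
    have h1 (r : ℂ) (i : Fin 3) : (C r * X i ^ 2 : MvPolynomial (Fin 3) ℂ).IsHomogeneous 2 := by
      simpa using (isHomogeneous_C _ r).mul (((isHomogeneous_X ℂ i)).pow 2)
    have h2 (r : ℂ) (i j : Fin 3) :
        (C r * (X i * X j) : MvPolynomial (Fin 3) ℂ).IsHomogeneous 2 := by
      simpa using (isHomogeneous_C _ r).mul ((isHomogeneous_X ℂ i).mul (isHomogeneous_X ℂ j))
    exact (((((h1 a 0).add (h1 b 1)).add (h1 c 2)).add (h2 d 1 2)).add (h2 e 0 2)).add (h2 f 0 1)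
  refine not_isBrodyHyperbolicHypersurface_conic hP fun g hg hg0 hgP => ?_
  replace hgP (z : ℂ) : a * g 0 z ^ 2 + b * g 1 z ^ 2 + c * g 2 z ^ 2 + d * (g 1 z * g 2 z) +
      e * (g 0 z * g 2 z) + f * (g 0 z * g 1 z) = 0 := by
    simpa [P] using hgP z
  by_cases h0 : ∀ z, g 0 z = 0
  · obtain ⟨r, s, u, hu, h1, h2⟩ := exists_proportional_of_quadratic (hg 1) (hg 2)
      (a := b) (b := c) (c := d) (fun ⟨hb, hc, hd⟩ => hx fun z => by simp [hQ, hb])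
      (fun z => by have := hgP z; rw [h0] at this; linear_combination this)
    refine ⟨![0, r, s], u, hu, fun i z => ?_⟩
    fin_cases i
    · simpa using h0 z
    · exact h1 z
    · exact h2 z
  by_cases h1 : ∀ z, g 1 z = 0
  · obtain ⟨r, s, u, hu, h0, h2⟩ := exists_proportional_of_quadratic (hg 0) (hg 2)
      (a := a) (b := c) (c := e) (fun ⟨hb, hc, hd⟩ => hy fun z => by simp [hQ, hb])
      (fun z => by have := hgP z; rw [h1] at this; linear_combination this)
    refine ⟨![r, 0, s], u, hu, fun i z => ?_⟩
    fin_cases i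
    · exact h0 z
    · simpa using h1 z
    · exact h2 z
  by_cases h2 : ∀ z, g 2 z = 0
  · obtain ⟨r, s, u, hu, h0, h1⟩ := exists_proportional_of_quadratic (hg 0) (hg 1)
      (a := a) (b := b) (c := f) (fun ⟨hb, hc, hd⟩ => hy fun z => by simp [hQ, hb])
      (fun z => by have := hgP z; rw [h2] at this; linear_combination this)
    refine ⟨![r, s, 0], u, hu, fun i z => ?_⟩
    fin_cases i
    · exact h0 z
    · exact h1 z
    · simpa using h2 z
  have h01 : ¬ ∀ z, g 0 z * g 1 z = 0 := fun h =>
    (eq_zero_or_eq_zero_of_mul (hg 0) (hg 1) h).elim h0 h1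
  have h02 : ¬ ∀ z, g 0 z * g 2 z = 0 := fun h =>
    (eq_zero_or_eq_zero_of_mul (hg 0) (hg 2) h).elim h0 h2
  have h12 : ¬ ∀ z, g 1 z * g 2 z = 0 := fun h =>
    (eq_zero_or_eq_zero_of_mul (hg 1) (hg 2) h).elim h1 h2
  obtain ⟨p, u, -, -, hu, hp⟩ := hB.exists_eq_smul hQk
    (g := fun z => ![g 1 z * g 2 z, g 0 z * g 2 z, g 0 z * g 1 z])
    (by
      rw [differentiable_pi]
      intro i; fin_cases i
      · exact (hg 1).fun_mul (hg 2)
      · exact (hg 0).fun_mul (hg 2)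
      · exact (hg 0).fun_mul (hg 1))
    (by
      push Not at h01
      obtain ⟨z, hz⟩ := h01
      exact ⟨z, fun h => hz (by simpa using congrFun h 2)⟩)
    (fun z => by
      rw [hQ]
      simp only [Matrix.cons_val]
      linear_combination (g 0 z * g 1 z * g 2 z) ^ 2 * hgP z)
  have e0 (z : ℂ) : g 1 z * g 2 z = u z * p 0 := congrFun (hp z) 0
  have e1 (z : ℂ) : g 0 z * g 2 z = u z * p 1 := congrFun (hp z) 1
  have e2 (z : ℂ) : g 0 z * g 1 z = u z * p 2 := congrFun (hp z) 2
  have p0 : p 0 ≠ 0 := fun h => h12 fun z => by simp [e0, h]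
  have p1 : p 1 ≠ 0 := fun h => h02 fun z => by simp [e1, h]
  have p2 : p 2 ≠ 0 := fun h => h01 fun z => by simp [e2, h]
  have hu0 : ¬ ∀ z, u z = 0 := fun h => h01 fun z => by simp [e2, h]
  have k1 := (eq_zero_or_eq_zero_of_mul hu (((hg 1).const_mul (p 1)).fun_sub
    ((hg 0).const_mul (p 0))) (fun z => by
      linear_combination g 0 z * e0 z - g 1 z * e1 z)).resolve_left hu0
  have k2 := (eq_zero_or_eq_zero_of_mul hu (((hg 2).const_mul (p 2)).fun_sub
    ((hg 0).const_mul (p 0))) (fun z => by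
      linear_combination g 0 z * e0 z - g 2 z * e2 z)).resolve_left hu0
  refine ⟨![1, p 0 / p 1, p 0 / p 2], g 0, hg 0, fun i z => ?_⟩
  fin_cases i
  · simp
  · have := k1 z
    simp
    field_simp
    linear_combination this
  · have := k2 z
    simp
    field_simp
    linear_combination this

lemma IsBrodyHyperbolicHypersurface.exists_pullback {p q k : ℕ} {F : MvPolynomial (Fin q) ℂ}
    (hF : IsBrodyHyperbolicHypersurface F) (hFk : F.IsHomogeneous k)
    {B : Matrix (Fin q) (Fin p) ℂ} (hB : Function.Injective B.mulVec) :
    ∃ Q : MvPolynomial (Fin p) ℂ, Q.IsHomogeneous k ∧ IsBrodyHyperbolicHypersurface Q ∧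
      ∀ x, eval x Q = eval (fun l => ∑ b, B l b * x b) F := by
  have he (x : Fin p → ℂ) : eval x (bind₁ (fun l => ∑ b, C (B l b) * X b) F) =
      eval (fun l => ∑ b, B l b * x b) F := by
    simp [eval_bind₁]
  refine ⟨bind₁ (fun l => ∑ b, C (B l b) * X b) F, ?_, ?_, he⟩
  · have hg (i : Fin q) : (∑ b, C (B i b) * X b : MvPolynomial (Fin p) ℂ).IsHomogeneous 1 :=
      IsHomogeneous.sum _ _ _ fun j _ => by
        simpa using (isHomogeneous_C _ (B i j)).mul (isHomogeneous_X ℂ j)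
    simpa using hFk.aeval (S := ℂ) (n := 1) _ hg
  · refine hF.of_injective (M := B.mulVecLin) (by rwa [Matrix.coe_mulVecLin]) fun v hv => ?_
    rw [he] at hv
    exact hv

/-- The derivative at the origin of a quartic form along a line of linear substitutions. -/
lemma hasDerivAt_quartic (p a : Fin 3 → ℂ) (b : ℂ) :
    HasDerivAt (fun t : ℂ => t * b * ((p 0 + t * a 0) ^ 3 + (p 1 + t * a 1) ^ 3 +
      (p 2 + t * a 2) ^ 3) + (p 0 + t * a 0) ^ 2 * (p 1 + t * a 1) ^ 2 +
      (p 1 + t * a 1) ^ 2 * (p 2 + t * a 2) ^ 2 + (p 2 + t * a 2) ^ 2 * (p 0 + t * a 0) ^ 2)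
    (b * (p 0 ^ 3 + p 1 ^ 3 + p 2 ^ 3) + 2 * p 0 * p 1 * (a 0 * p 1 + p 0 * a 1) +
      2 * p 1 * p 2 * (a 1 * p 2 + p 1 * a 2) + 2 * p 2 * p 0 * (a 2 * p 0 + p 2 * a 0)) 0 := by
  have h (i : Fin 3) : HasDerivAt (fun t : ℂ => p i + t * a i) (a i) 0 := by
    simpa using ((hasDerivAt_id (0 : ℂ)).mul_const (a i)).const_add (p i)
  have hb : HasDerivAt (fun t : ℂ => t * b) b 0 := by
    simpa using (hasDerivAt_id (0 : ℂ)).mul_const b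
  refine ((((hb.fun_mul ((((h 0).fun_pow 3).fun_add ((h 1).fun_pow 3)).fun_add
    ((h 2).fun_pow 3))).fun_add (((h 0).fun_pow 2).fun_mul ((h 1).fun_pow 2))).fun_add
    (((h 1).fun_pow 2).fun_mul ((h 2).fun_pow 2))).fun_add
    (((h 2).fun_pow 2).fun_mul ((h 0).fun_pow 2))).congr_deriv ?_
  simp
  ring

/-- Quartic surfaces in three-dimensional projective space are not hyperbolic. -/
theorem not_isBrodyHyperbolicHypersurface_quartic {F : MvPolynomial (Fin 4) ℂ}
    (hFk : F.IsHomogeneous 4) : ¬ IsBrodyHyperbolicHypersurface F := by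
  intro hF
  let H : MvPolynomial (Fin 4) ℂ := X 3 * (X 0 ^ 3 + X 1 ^ 3 + X 2 ^ 3) + X 0 ^ 2 * X 1 ^ 2 +
    X 1 ^ 2 * X 2 ^ 2 + X 2 ^ 2 * X 0 ^ 2
  have hHk : H.IsHomogeneous 4 := by
    have h3 (i : Fin 4) : (X i ^ 3 : MvPolynomial (Fin 4) ℂ).IsHomogeneous 3 := by
      simpa using (isHomogeneous_X ℂ i).pow 3
    have h2 (i j : Fin 4) : (X i ^ 2 * X j ^ 2 : MvPolynomial (Fin 4) ℂ).IsHomogeneous 4 := by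
      simpa using ((isHomogeneous_X ℂ i).pow 2).mul ((isHomogeneous_X ℂ j).pow 2)
    exact ((((isHomogeneous_X ℂ 3).mul (((h3 0).add (h3 1)).add (h3 2))).add (h2 0 1)).add
      (h2 1 2)).add (h2 2 0)
  let A : Fin 4 → Fin 3 → MvPolynomial (Fin 10) ℂ :=
    ![![1, X 0, X 1], ![X 2, 1, X 3], ![X 4, X 5, 1], ![X 6, X 7, X 8]]
  let x : Fin 9 → Fin 4 → Fin 3 → ℂ :=
    ![![![1, 0, 0], 0, 0, 0], ![![0, 1, 0], 0, 0, 0], ![![0, 0, 1], 0, 0, 0],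
      ![![2, 1, 0], ![2, -1, 0], ![1, 1, 0], ![1, -1, 0]],
      ![![2, 0, 1], ![2, 0, -1], ![1, 0, 1], ![1, 0, -1]],
      ![![1, 2, 0], ![-1, 2, 0], ![1, 1, 0], ![-1, 1, 0]],
      ![![0, 2, 1], ![0, 2, -1], ![0, 1, 1], ![0, 1, -1]],
      ![![1, 0, 2], ![-1, 0, 2], ![1, 0, 1], ![-1, 0, 1]],
      ![![0, 1, 2], ![0, -1, 2], ![0, 1, 1], ![0, -1, 1]]]
  let a : Fin 9 → Fin 4 → ℂ :=
    ![![1, 0, 0, 0], ![1, 0, 0, 0], ![1, 0, 0, 0], ![1, -1, -2, 2], ![1, -1, -2, 2],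
      ![1, -1, -2, 2], ![1, -1, -2, 2], ![1, -1, -2, 2], ![1, -1, -2, 2]]
  let Δ : MvPolynomial (Fin 10) ℂ := 1 + X 0 * X 3 * X 4 + X 1 * X 2 * X 5 - X 0 * X 2 -
    X 3 * X 5 - X 1 * X 4
  let D : Unit → MvPolynomial (Fin 10) ℂ := fun _ => Δ * (1 + X 9) - 1
  have hA (v : Fin 10 → ℂ) (p : Fin 3 → ℂ) :
      eval (fun l => ∑ b, eval v (A l b) * p b) H =
        (v 6 * p 0 + v 7 * p 1 + v 8 * p 2) * ((p 0 + v 0 * p 1 + v 1 * p 2) ^ 3 +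
          (v 2 * p 0 + p 1 + v 3 * p 2) ^ 3 + (v 4 * p 0 + v 5 * p 1 + p 2) ^ 3) +
        (p 0 + v 0 * p 1 + v 1 * p 2) ^ 2 * (v 2 * p 0 + p 1 + v 3 * p 2) ^ 2 +
        (v 2 * p 0 + p 1 + v 3 * p 2) ^ 2 * (v 4 * p 0 + v 5 * p 1 + p 2) ^ 2 +
        (v 4 * p 0 + v 5 * p 1 + p 2) ^ 2 * (p 0 + v 0 * p 1 + v 1 * p 2) ^ 2 := by
    simp [H, A, Fin.sum_univ_three]
  obtain ⟨τ, v, hG, hv, hD⟩ := hF.exists_section hFk hHk A x a D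
    (fun i => by
      simp only [hA]
      fin_cases i <;> simp [Fin.sum_univ_four, x, a])
    (fun j => by simp [D, Δ]) (fun w w' => by
      let v : Fin 10 → ℂ := ![(w 5 / 12 - w 0) / 2, (w 7 / 12 - w 0) / 2, (w 3 / 12 - w 1) / 2,
        (w 8 / 12 - w 1) / 2, (w 4 / 12 - w 2) / 2, (w 6 / 12 - w 2) / 2, w 0, w 1, w 2, w' ()]
      refine ⟨v, fun i => ?_, fun j => ?_⟩
      · have key (p : Fin 3 → ℂ) := (hasDerivAt_quartic p
          ![v 0 * p 1 + v 1 * p 2, v 2 * p 0 + v 3 * p 2, v 4 * p 0 + v 5 * p 1]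
          (v 6 * p 0 + v 7 * p 1 + v 8 * p 2)).congr_of_eventuallyEq
          (f₁ := fun t : ℂ => eval (fun l => ∑ b, eval (fun o => t * v o) (A l b) * p b) H)
          (Eventually.of_forall fun t => by
            simp only [hA, Matrix.cons_val]
            ring)
        refine (HasDerivAt.fun_sum (u := Finset.univ)
          fun s _ => (key (x i s)).const_mul (a i s)).congr_deriv ?_
        fin_cases i <;> simp [Fin.sum_univ_four, x, a, v] <;> ring
      · have hX (i : Fin 10) : HasDerivAt (fun t : ℂ => t * v i) (v i) 0 := by
          simpa using (hasDerivAt_id (0 : ℂ)).mul_const (v i)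
        have h1 := (((((((hasDerivAt_const (0 : ℂ) (1 : ℂ)).fun_add
          (((hX 0).fun_mul (hX 3)).fun_mul (hX 4))).fun_add
          (((hX 1).fun_mul (hX 2)).fun_mul (hX 5))).fun_sub
          ((hX 0).fun_mul (hX 2))).fun_sub ((hX 3).fun_mul (hX 5))).fun_sub
          ((hX 1).fun_mul (hX 4))).fun_mul
          ((hasDerivAt_const (0 : ℂ) (1 : ℂ)).fun_add (hX 9))).sub_const 1
        refine (h1.congr_of_eventuallyEq (Eventually.of_forall fun t => ?_)).congr_deriv ?_
        · simp [D, Δ]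
        · simp [v])
  let B : Matrix (Fin 4) (Fin 3) ℂ := fun l b => eval v (A l b)
  have hB : Function.Injective B.mulVec := by
    have hdet : (B.submatrix Fin.castSucc id).det ≠ 0 := by
      intro h
      have h1 : eval v Δ = 0 := by
        have he (i j : Fin 3) : B.submatrix Fin.castSucc id i j = eval v (A i.castSucc j) := rfl
        rw [← h, Matrix.det_fin_three]
        simp only [he]
        simp [A, Δ]
        ring
      simpa [D, h1] using hD ()
    intro y z hyz
    refine Matrix.mulVec_injective_of_det_ne_zero hdet ?_
    funext i
    exact congrFun hyz i.castSucc
  have hFτ : (C τ * F).IsHomogeneous 4 := by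
    simpa using (isHomogeneous_C _ τ).mul hFk
  obtain ⟨Q, hQk, hQ, hQe⟩ := hG.exists_pullback (hHk.add hFτ) hB
  obtain ⟨c, hc⟩ := hQk.exists_eval_eq_sum
  simp only [Finset.sum_range_succ, Finset.sum_range_zero, Nat.reduceAdd, Nat.reduceSub] at hc
  have hv' (i : Fin 9) : ∑ s, a i s * eval (x i s) Q = 0 := by
    simp only [hQe]
    exact hv i
  simp only [hc] at hv'
  have h0 := hv' 0
  have h1 := hv' 1
  have h2 := hv' 2
  have h3 := hv' 3
  have h4 := hv' 4
  have h5 := hv' 5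
  have h6 := hv' 6
  have h7 := hv' 7
  have h8 := hv' 8
  simp [Fin.sum_univ_four, x, a] at h0 h1 h2 h3 h4 h5 h6 h7 h8
  refine not_isBrodyHyperbolicHypersurface_three_nodes hQk (a := c 0 2) (b := c 2 0) (c := c 2 2)
    (d := c 2 1) (e := c 1 2) (f := c 1 1) (fun y => ?_) hQ
  rw [hc]
  have k3 : c 3 1 = 0 := by linear_combination h3 / 12
  have k4 : c 3 0 = 0 := by linear_combination h4 / 12
  have k5 : c 1 3 = 0 := by linear_combination h5 / 12
  have k6 : c 0 3 = 0 := by linear_combination h6 / 12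
  have k7 : c 1 0 = 0 := by linear_combination h7 / 12
  have k8 : c 0 1 = 0 := by linear_combination h8 / 12
  simp only [h0, h1, h2, k3, k4, k5, k6, k7, k8]
  ring

lemma exists_differentiableOn_implicit {f : ℂ × ℂ → ℂ} {x y c : ℂ} (hf : ContDiff ℂ 1 f)
    (hc : HasDerivAt (fun w => f (x, w)) c y) (hc0 : c ≠ 0) :
    ∃ r > 0, ∃ ψ : ℂ → ℂ, DifferentiableOn ℂ ψ (ball x r) ∧ ψ x = y ∧
      ∀ z ∈ ball x r, f (z, ψ z) = f (x, y) := by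
  have hcd : ContDiffAt ℂ 1 f (x, y) := hf.contDiffAt
  have hinv : (fderiv ℂ f (x, y) ∘L .inr ℂ ℂ ℂ).IsInvertible := by
    refine ⟨ContinuousLinearEquiv.smulLeft (Units.mk0 c hc0), ?_⟩
    ext
    have h1 : HasDerivAt (fun w => f (x, w)) (fderiv ℂ f (x, y) (0, 1)) y :=
      (hf.differentiable one_ne_zero (x, y)).hasFDerivAt.comp_hasDerivAt y
        ((hasDerivAt_const y x).prodMk (hasDerivAt_id y))
    simpa [Units.smul_def] using hc.unique h1
  have h1 := hcd.contDiffAt_implicitFunction one_ne_zero hinv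
  have h2 := hcd.eventually_apply_implicitFunction one_ne_zero hinv
  have h3 := h1.eventually (by simp)
  obtain ⟨r, hr, h⟩ := Metric.eventually_nhds_iff_ball.1 (h2.and h3)
  exact ⟨r, hr, _, fun z hz =>
    (((h z hz).2).differentiableAt one_ne_zero).differentiableWithinAt,
    hcd.implicitFunction_apply_self one_ne_zero hinv, fun z hz => (h z hz).1⟩

/-- The tangent map of a smooth plane cubic `αx³ + βy³ + γz³ + δxyz = 0`. -/
noncomputable def cubicTangentMap (α β γ : ℂ) (v : Fin 3 → ℂ) : Fin 3 → ℂ :=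
  ![v 0 * (β * v 1 ^ 3 - γ * v 2 ^ 3), v 1 * (γ * v 2 ^ 3 - α * v 0 ^ 3),
    v 2 * (α * v 0 ^ 3 - β * v 1 ^ 3)]

section

variable {Q : MvPolynomial (Fin 3) ℂ} {α β γ δ : ℂ}

lemma eval_cubicTangentMap
    (hQ : ∀ v, eval v Q = α * v 0 ^ 3 + β * v 1 ^ 3 + γ * v 2 ^ 3 + δ * (v 0 * v 1 * v 2))
    {v : Fin 3 → ℂ} (hv : eval v Q = 0) : eval (cubicTangentMap α β γ v) Q = 0 := by
  rw [hQ] at hv ⊢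
  simp only [cubicTangentMap, Matrix.cons_val]
  linear_combination (α * v 0 ^ 3 - β * v 1 ^ 3) * (β * v 1 ^ 3 - γ * v 2 ^ 3) *
    (γ * v 2 ^ 3 - α * v 0 ^ 3) * hv

lemma cubicTangentMap_ne_zero
    (hQ : ∀ v, eval v Q = α * v 0 ^ 3 + β * v 1 ^ 3 + γ * v 2 ^ 3 + δ * (v 0 * v 1 * v 2))
    (hα : α ≠ 0) (hβ : β ≠ 0) (hγ : γ ≠ 0) (h : δ ^ 3 + 27 * (α * β * γ) ≠ 0)
    {v : Fin 3 → ℂ} (hv : eval v Q = 0) (hv0 : v ≠ 0) : cubicTangentMap α β γ v ≠ 0 := by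
  intro hT
  rw [hQ] at hv
  have t0 : v 0 * (β * v 1 ^ 3 - γ * v 2 ^ 3) = 0 := congrFun hT 0
  have t1 : v 1 * (γ * v 2 ^ 3 - α * v 0 ^ 3) = 0 := congrFun hT 1
  have t2 : v 2 * (α * v 0 ^ 3 - β * v 1 ^ 3) = 0 := congrFun hT 2
  by_cases h0 : v 0 = 0
  · by_cases h1 : v 1 = 0
    · have h2 : v 2 = 0 := by simpa [h0, h1, hγ] using hv
      exact hv0 (by funext i; fin_cases i <;> assumption)
    · have h2 : v 2 = 0 := by simpa [h0, h1, hγ] using t1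
      exact h1 (by simpa [h0, h2, hβ] using hv)
  · by_cases h1 : v 1 = 0
    · have h2 : v 2 = 0 := by simpa [h0, h1, hγ] using t0
      exact h0 (by simpa [h1, h2, hα] using hv)
    · by_cases h2 : v 2 = 0
      · simp [h2, h0, h1, hβ] at t0
      · have e0 := (mul_eq_zero.1 t0).resolve_left h0
        have e1 := (mul_eq_zero.1 t1).resolve_left h1
        have e2 : δ * (v 0 * v 1 * v 2) = -3 * (α * v 0 ^ 3) := by
          linear_combination hv - e0 - 2 * e1
        have e3 : β * v 1 ^ 3 = α * v 0 ^ 3 := by linear_combination e0 + e1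
        have e4 : γ * v 2 ^ 3 = α * v 0 ^ 3 := by linear_combination e1
        apply h
        have e5 : (v 0 * v 1 * v 2) ^ 3 * (δ ^ 3 + 27 * (α * β * γ)) = 0 := by
          calc _ = (δ * (v 0 * v 1 * v 2)) ^ 3 +
                27 * ((α * v 0 ^ 3) * (β * v 1 ^ 3) * (γ * v 2 ^ 3)) := by ring
            _ = 0 := by rw [e2, e3, e4]; ring
        simpa [h0, h1, h2] using e5

/-- Smooth plane cubics in Hesse form are not hyperbolic: iterating the tangent map on a disc
through one of its repelling fixed points makes the derivatives blow up. -/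
lemma not_isBrodyHyperbolicHypersurface_hesse (hQk : Q.IsHomogeneous 3)
    (hQ : ∀ v, eval v Q = α * v 0 ^ 3 + β * v 1 ^ 3 + γ * v 2 ^ 3 + δ * (v 0 * v 1 * v 2))
    (hα : α ≠ 0) (hβ : β ≠ 0) (hγ : γ ≠ 0) (h : δ ^ 3 + 27 * (α * β * γ) ≠ 0) :
    ¬ IsBrodyHyperbolicHypersurface Q := by
  intro hB
  obtain ⟨z₀, hz₀⟩ := IsAlgClosed.exists_pow_nat_eq (-β / γ) (n := 3) (by norm_num)
  have hz : γ * z₀ ^ 3 = -β := by rw [hz₀]; field_simp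
  have hz0 : z₀ ≠ 0 := by
    rintro rfl
    exact hβ (by simpa using hz.symm)
  obtain ⟨r, hr, ψ, hψ, hψ0, hψQ⟩ := exists_differentiableOn_implicit
    (f := fun p : ℂ × ℂ => γ * p.2 ^ 3 + δ * (p.1 * p.2) + β + α * p.1 ^ 3) (x := 0) (y := z₀)
    (c := γ * (3 * z₀ ^ 2)) (by fun_prop)
    (by simpa using (((hasDerivAt_pow 3 z₀).const_mul γ).add_const β)) (by simp [hγ, hz0])
  let T := cubicTangentMap α β γ
  let g : ℕ → ℂ → Fin 3 → ℂ := fun m w => T^[m] ![w, 1, ψ w]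
  have hg1 (m : ℕ) (w : ℂ) : g (m + 1) w = T (g m w) := Function.iterate_succ_apply' T m _
  have hT0 (m : ℕ) (w : ℂ) : g (m + 1) w 0 =
      g m w 0 * (β * g m w 1 ^ 3 - γ * g m w 2 ^ 3) := by rw [hg1]; rfl
  have hT1 (m : ℕ) (w : ℂ) : g (m + 1) w 1 =
      g m w 1 * (γ * g m w 2 ^ 3 - α * g m w 0 ^ 3) := by rw [hg1]; rfl
  have hT2 (m : ℕ) (w : ℂ) : g (m + 1) w 2 =
      g m w 2 * (α * g m w 0 ^ 3 - β * g m w 1 ^ 3) := by rw [hg1]; rfl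
  have hgd (m : ℕ) (i : Fin 3) : DifferentiableOn ℂ (fun w => g m w i) (ball 0 r) := by
    induction m generalizing i with
    | zero =>
      fin_cases i
      · exact differentiableOn_id
      · exact differentiableOn_const 1
      · exact hψ
    | succ m ih =>
      have h3 (a : ℂ) (i : Fin 3) : DifferentiableOn ℂ (fun w => a * g m w i ^ 3) (ball 0 r) :=
        ((ih i).fun_pow 3).const_mul a
      fin_cases i
      · exact ((ih 0).fun_mul ((h3 β 1).fun_sub (h3 γ 2))).congr fun w _ => hT0 m w
      · exact ((ih 1).fun_mul ((h3 γ 2).fun_sub (h3 α 0))).congr fun w _ => hT1 m w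
      · exact ((ih 2).fun_mul ((h3 α 0).fun_sub (h3 β 1))).congr fun w _ => hT2 m w
  have hgQ (m : ℕ) : ∀ w ∈ ball (0 : ℂ) r, eval (g m w) Q = 0 ∧ g m w ≠ 0 := by
    intro w hw
    induction m with
    | zero =>
      refine ⟨?_, fun h => one_ne_zero (congrFun h 1 : (1 : ℂ) = 0)⟩
      have h1 := hψQ w hw
      simp only [hz] at h1
      rw [hQ]
      simp only [g, Function.iterate_zero_apply, Matrix.cons_val]
      linear_combination h1
    | succ m ih =>
      rw [hg1]
      exact ⟨eval_cubicTangentMap hQ ih.1, cubicTangentMap_ne_zero hQ hα hβ hγ h ih.1 ih.2⟩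
  have hgp (m : ℕ) : ∃ c : ℂ, c ≠ 0 ∧ g m 0 = c • ![0, 1, z₀] := by
    induction m with
    | zero => exact ⟨1, one_ne_zero, by simp [g, hψ0]⟩
    | succ m ih =>
      obtain ⟨c, hc, hm⟩ := ih
      have c0 : g m 0 0 = 0 := by simp [hm]
      have c1 : g m 0 1 = c := by simp [hm]
      have c2 : g m 0 2 = c * z₀ := by simp [hm]
      refine ⟨-β * c ^ 4, by simp [hβ, hc], ?_⟩
      funext i
      fin_cases i
      · refine (hT0 m 0).trans ?_
        simp [c0]
      · refine (hT1 m 0).trans ?_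
        simp only [c0, c1, c2]
        simp
        linear_combination c ^ 4 * hz
      · refine (hT2 m 0).trans ?_
        simp only [c0, c1, c2]
        simp
        ring
  have hder (m : ℕ) : HasDerivAt (fun w => g m w 0 / g m w 1) ((-2) ^ m) 0 := by
    induction m with
    | zero => simpa [g] using hasDerivAt_id' (0 : ℂ)
    | succ m ih =>
      obtain ⟨c, hc, hm⟩ := hgp m
      have c0 : g m 0 0 = 0 := by simp [hm]
      have c1 : g m 0 1 = c := by simp [hm]
      have c2 : g m 0 2 = c * z₀ := by simp [hm]
      have hd (i : Fin 3) (a : ℂ) : DifferentiableAt ℂ (fun w => a * g m w i ^ 3) 0 :=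
        (((hgd m i).differentiableAt (ball_mem_nhds 0 hr)).fun_pow 3).const_mul a
      have hden : γ * g m 0 2 ^ 3 - α * g m 0 0 ^ 3 = -β * c ^ 3 := by
        rw [c0, c2]
        linear_combination c ^ 3 * hz
      have hnum : β * g m 0 1 ^ 3 - γ * g m 0 2 ^ 3 = 2 * β * c ^ 3 := by
        rw [c1, c2]
        linear_combination -c ^ 3 * hz
      have hdd := ((hd 1 β).fun_sub (hd 2 γ)).fun_div ((hd 2 γ).fun_sub (hd 0 α))
        (by rw [hden]; simp [hβ, hc])
      refine ((ih.fun_mul hdd.hasDerivAt).congr_of_eventuallyEq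
        (Eventually.of_forall fun w => ?_)).congr_deriv ?_
      · simp only [hT0, hT1]
        rw [mul_div_mul_comm]
      · rw [hden, hnum, c0]
        field_simp
        ring
  refine hB.not_tendsto_deriv hQk hr (g := g) (p := ![0, 1, z₀]) (i := 1) (m := 0)
    (fun m => differentiableOn_pi.2 fun i => hgd m i) (fun m w hw => (hgQ m w hw).2)
    (fun m w hw => (hgQ m w hw).1) hgp (by simp) ?_
  have : (fun m => ‖deriv (fun w => g m w 0 / g m w 1) 0‖) = fun m : ℕ => (2 : ℝ) ^ m := by
    funext m
    rw [(hder m).deriv]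
    simp
  rw [this]
  exact tendsto_pow_atTop_atTop_of_one_lt one_lt_two

end

/-- Along a sequence `ε → 0`, generic perturbations of a Hesse cubic are smooth. -/
lemma exists_tendsto_zero_hesse (α β γ δ : ℂ) : ∃ ε : ℕ → ℂ, Tendsto ε atTop (𝓝 0) ∧
    ∀ j, α + ε j ≠ 0 ∧ β + ε j ≠ 0 ∧ γ + ε j ≠ 0 ∧
      δ ^ 3 + 27 * ((α + ε j) * (β + ε j) * (γ + ε j)) ≠ 0 := by
  let q (a : ℂ) : Polynomial ℂ := Polynomial.X + Polynomial.C a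
  have hq (a : ℂ) : (q a).Monic := Polynomial.monic_X_add_C a
  let R : Polynomial ℂ := Polynomial.C (δ ^ 3) + Polynomial.C 27 * (q α * q β * q γ)
  have hR : R ≠ 0 := by
    intro h
    have hz (z : ℂ) : δ ^ 3 + 27 * ((z + α) * (z + β) * (z + γ)) = 0 := by
      simpa [R, q] using congrArg (Polynomial.eval z) h
    have : (162 : ℂ) = 0 := by
      linear_combination hz 3 - 3 * hz 2 + 3 * hz 1 - hz 0
    norm_num at this
  have hP : q α * q β * q γ * R ≠ 0 :=
    mul_ne_zero (((hq α).mul (hq β)).mul (hq γ)).ne_zero hR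
  have hfin : {z | (q α * q β * q γ * R).IsRoot z}.Finite := Polynomial.finite_setOfPred_isRoot hP
  have hex (j : ℕ) : ∃ z ∈ ball (0 : ℂ) (1 / (j + 1)), ¬ (q α * q β * q γ * R).IsRoot z := by
    by_contra! hcon
    exact infinite_of_mem_nhds (0 : ℂ) (ball_mem_nhds 0 (by positivity : (0 : ℝ) < 1 / (j + 1)))
      (hfin.subset hcon)
  choose ε hε hroot using hex
  refine ⟨ε, ?_, fun j => ?_⟩
  · rw [tendsto_zero_iff_norm_tendsto_zero]
    exact squeeze_zero (fun j => norm_nonneg _) (fun j => (mem_ball_zero_iff.1 (hε j)).le)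
      tendsto_one_div_add_atTop_nhds_zero_nat
  · have := hroot j
    simp only [Polynomial.IsRoot, Polynomial.eval_mul, mul_eq_zero, not_or] at this
    obtain ⟨⟨⟨h1, h2⟩, h3⟩, h4⟩ := this
    simp [q, R] at h1 h2 h3 h4
    refine ⟨?_, ?_, ?_, ?_⟩
    · rwa [add_comm]
    · rwa [add_comm]
    · rwa [add_comm]
    · intro h; apply h4; linear_combination h

lemma hasDerivAt_cubic (p a : Fin 3 → ℂ) :
    HasDerivAt (fun t : ℂ => (p 0 + t * a 0) ^ 3 + (p 1 + t * a 1) ^ 3 + (p 2 + t * a 2) ^ 3)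
      (3 * (p 0 ^ 2 * a 0 + p 1 ^ 2 * a 1 + p 2 ^ 2 * a 2)) 0 := by
  have h (i : Fin 3) : HasDerivAt (fun t : ℂ => p i + t * a i) (a i) 0 := by
    simpa using ((hasDerivAt_id (0 : ℂ)).mul_const (a i)).const_add (p i)
  refine ((((h 0).fun_pow 3).fun_add ((h 1).fun_pow 3)).fun_add
    ((h 2).fun_pow 3)).congr_deriv ?_
  simp
  ring

/-- Plane cubics are not hyperbolic. -/
theorem not_isBrodyHyperbolicHypersurface_cubic {F : MvPolynomial (Fin 3) ℂ}
    (hFk : F.IsHomogeneous 3) : ¬ IsBrodyHyperbolicHypersurface F := by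
  intro hF
  let H : MvPolynomial (Fin 3) ℂ := X 0 ^ 3 + X 1 ^ 3 + X 2 ^ 3
  have hHk : H.IsHomogeneous 3 := by
    have h3 (i : Fin 3) : (X i ^ 3 : MvPolynomial (Fin 3) ℂ).IsHomogeneous 3 := by
      simpa using (isHomogeneous_X ℂ i).pow 3
    exact ((h3 0).add (h3 1)).add (h3 2)
  let A : Fin 3 → Fin 3 → MvPolynomial (Fin 7) ℂ :=
    ![![1, X 0, X 1], ![X 2, 1, X 3], ![X 4, X 5, 1]]
  let x : Fin 6 → Fin 3 → Fin 3 → ℂ :=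
    ![![![1, 1, 0], ![1, 0, 0], ![0, 1, 0]], ![![1, -1, 0], ![1, 0, 0], ![0, 1, 0]],
      ![![0, 1, 1], ![0, 1, 0], ![0, 0, 1]], ![![0, 1, -1], ![0, 1, 0], ![0, 0, 1]],
      ![![1, 0, 1], ![1, 0, 0], ![0, 0, 1]], ![![1, 0, -1], ![1, 0, 0], ![0, 0, 1]]]
  let a : Fin 6 → Fin 3 → ℂ :=
    ![![1, -1, -1], ![1, -1, 1], ![1, -1, -1], ![1, -1, 1], ![1, -1, -1], ![1, -1, 1]]
  let Δ : MvPolynomial (Fin 7) ℂ := 1 + X 0 * X 3 * X 4 + X 1 * X 2 * X 5 - X 0 * X 2 -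
    X 3 * X 5 - X 1 * X 4
  let D : Unit → MvPolynomial (Fin 7) ℂ := fun _ => Δ * (1 + X 6) - 1
  have hA (v : Fin 7 → ℂ) (p : Fin 3 → ℂ) :
      eval (fun l => ∑ b, eval v (A l b) * p b) H =
        (p 0 + v 0 * p 1 + v 1 * p 2) ^ 3 + (v 2 * p 0 + p 1 + v 3 * p 2) ^ 3 +
          (v 4 * p 0 + v 5 * p 1 + p 2) ^ 3 := by
    simp [H, A, Fin.sum_univ_three]
  obtain ⟨τ, v, hG, hv, hD⟩ := hF.exists_section hFk hHk A x a D
    (fun i => by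
      simp only [hA]
      fin_cases i <;> simp [Fin.sum_univ_three, x, a] <;> norm_num)
    (fun j => by simp [D, Δ]) (fun w w' => by
      let v : Fin 7 → ℂ := ![(w 0 - w 1) / 6, (w 4 - w 5) / 6, (w 0 + w 1) / 6, (w 2 - w 3) / 6,
        (w 4 + w 5) / 6, (w 2 + w 3) / 6, w' ()]
      refine ⟨v, fun i => ?_, fun j => ?_⟩
      · have key (p : Fin 3 → ℂ) := (hasDerivAt_cubic p
          ![v 0 * p 1 + v 1 * p 2, v 2 * p 0 + v 3 * p 2, v 4 * p 0 + v 5 * p 1]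
          ).congr_of_eventuallyEq
          (f₁ := fun t : ℂ => eval (fun l => ∑ b, eval (fun o => t * v o) (A l b) * p b) H)
          (Eventually.of_forall fun t => by
            simp only [hA, Matrix.cons_val]
            ring)
        refine (HasDerivAt.fun_sum (u := Finset.univ)
          fun s _ => (key (x i s)).const_mul (a i s)).congr_deriv ?_
        fin_cases i <;> simp [Fin.sum_univ_three, x, a, v] <;> ring
      · have hX (i : Fin 7) : HasDerivAt (fun t : ℂ => t * v i) (v i) 0 := by
          simpa using (hasDerivAt_id (0 : ℂ)).mul_const (v i)
        have h1 := (((((((hasDerivAt_const (0 : ℂ) (1 : ℂ)).fun_add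
          (((hX 0).fun_mul (hX 3)).fun_mul (hX 4))).fun_add
          (((hX 1).fun_mul (hX 2)).fun_mul (hX 5))).fun_sub
          ((hX 0).fun_mul (hX 2))).fun_sub ((hX 3).fun_mul (hX 5))).fun_sub
          ((hX 1).fun_mul (hX 4))).fun_mul
          ((hasDerivAt_const (0 : ℂ) (1 : ℂ)).fun_add (hX 6))).sub_const 1
        refine (h1.congr_of_eventuallyEq (Eventually.of_forall fun t => ?_)).congr_deriv ?_
        · simp [D, Δ]
        · simp [v])
  let B : Matrix (Fin 3) (Fin 3) ℂ := fun l b => eval v (A l b)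
  have hB : Function.Injective B.mulVec := by
    refine Matrix.mulVec_injective_of_det_ne_zero fun h => ?_
    have h1 : eval v Δ = 0 := by
      have he (i j : Fin 3) : B i j = eval v (A i j) := rfl
      rw [← h, Matrix.det_fin_three]
      simp only [he]
      simp [A, Δ]
      ring
    simpa [D, h1] using hD ()
  have hFτ : (C τ * F).IsHomogeneous 3 := by
    simpa using (isHomogeneous_C _ τ).mul hFk
  obtain ⟨Q, hQk, hQ, hQe⟩ := hG.exists_pullback (hHk.add hFτ) hB
  obtain ⟨c, hc⟩ := hQk.exists_eval_eq_sum
  simp only [Finset.sum_range_succ, Finset.sum_range_zero, Nat.reduceAdd, Nat.reduceSub] at hc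
  have hv' (i : Fin 6) : ∑ s, a i s * eval (x i s) Q = 0 := by
    simp only [hQe]
    exact hv i
  simp only [hc] at hv'
  have h0 := hv' 0
  have h1 := hv' 1
  have h2 := hv' 2
  have h3 := hv' 3
  have h4 := hv' 4
  have h5 := hv' 5
  simp [Fin.sum_univ_three, x, a] at h0 h1 h2 h3 h4 h5
  have k0 : c 2 1 = 0 := by linear_combination (h0 - h1) / 2
  have k1 : c 1 2 = 0 := by linear_combination (h0 + h1) / 2
  have k2 : c 0 2 = 0 := by linear_combination (h2 - h3) / 2
  have k3 : c 0 1 = 0 := by linear_combination (h2 + h3) / 2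
  have k4 : c 2 0 = 0 := by linear_combination (h4 - h5) / 2
  have k5 : c 1 0 = 0 := by linear_combination (h4 + h5) / 2
  obtain ⟨ε, hε, hne⟩ := exists_tendsto_zero_hesse (c 3 0) (c 0 3) (c 0 0) (c 1 1)
  obtain ⟨j, hj⟩ := hQ.exists_add_smul hQk hHk hε
  obtain ⟨hα, hβ, hγ, hδ⟩ := hne j
  have hHε : (C (ε j) * H).IsHomogeneous 3 := by
    simpa using (isHomogeneous_C _ (ε j)).mul hHk
  refine not_isBrodyHyperbolicHypersurface_hesse (hQk.add hHε) (fun y => ?_) hα hβ hγ hδ hj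
  rw [map_add, hc]
  simp only [k0, k1, k2, k3, k4, k5]
  simp [H]
  ring

theorem not_isBrodyHyperbolicHypersurface_of_le {n k : ℕ} (hn : 2 ≤ n) (hk : 1 ≤ k)
    (hkn : k ≤ n + 1) {F : MvPolynomial (Fin (n + 1)) ℂ} (hFk : F.IsHomogeneous k) :
    ¬ IsBrodyHyperbolicHypersurface F := by
  obtain ⟨p, rfl⟩ : ∃ p, n = p + 1 := ⟨n - 1, by omega⟩
  by_cases h : k / 2 < p
  · exact not_isBrodyHyperbolicHypersurface_of_div_two_lt hk h hFk
  · obtain ⟨rfl, rfl⟩ | ⟨rfl, rfl⟩ | ⟨rfl, rfl⟩ :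
        (p = 1 ∧ k = 2) ∨ (p = 1 ∧ k = 3) ∨ (p = 2 ∧ k = 4) := by omega
    · exact not_isBrodyHyperbolicHypersurface_conic hFk
    · exact not_isBrodyHyperbolicHypersurface_cubic hFk
    · exact not_isBrodyHyperbolicHypersurface_quartic hFk

end

/-- If `H_{n,k}` is non-empty then `H_{n+1,dk}` is non-empty for every `d ≥ 2`:
the existence of a Brody hyperbolic hypersurface of degree `k` in ℙⁿ (`n ≥ 2`)
implies the existence of a Brody hyperbolic hypersurface of degree `dk` in
ℙ^{n+1}. -/
theorem exists_hyperbolic_hypersurface_next_dimension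
    (n k d : ℕ) (hn : 2 ≤ n) (hk : 1 ≤ k) (hd : 2 ≤ d)
    (hexists : ∃ F : MvPolynomial (Fin (n + 1)) ℂ, F ≠ 0 ∧ F.IsHomogeneous k ∧
      IsBrodyHyperbolicHypersurface F) :
    ∃ P : MvPolynomial (Fin (n + 2)) ℂ, P ≠ 0 ∧ P.IsHomogeneous (d * k) ∧
      IsBrodyHyperbolicHypersurface P := by
  obtain ⟨F, hF0, hFk, hF⟩ := hexists
  by_cases h : k ≤ n + 1
  · exact absurd hF (not_isBrodyHyperbolicHypersurface_of_le hn hk h hFk)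
  · exact exists_hyperbolic_of_le_degree (by omega) hd hF0 hFk hF
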